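/- Let P ⊂ ℝ^n be a lattice polytope with non-empty interior and let −γ_1(P), …, −γ_n(P) be the roots of the Ehrhart polynomial of P, normalized so that Σ_{i=1}^n γ_i(P)^{−1}·complete products give E_i(P) = σ_i(1/γ_1(P),…,1/γ_n(P)). Then Σ_{i=1}^n γ_i(P) ≤ ((n+1)/2)·Σ_{i=1}^n λ_i(DP, ℤ^n), where DP = P − P, and the standard simplex S_n = conv{0, e_1, …, e_n} shows the inequality is best possible. -/

import Mathlib

open MeasureTheory Set Filter Pointwise RealInnerProductSpace
open scoped ENNReal

noncomputable section

namespace Paper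

/-- Euclidean space `ℝ^n`. -/
abbrev Euc (n : ℕ) := EuclideanSpace ℝ (Fin n)

variable {n : ℕ}

/-- A convex body: a compact convex set with non-empty interior. -/
def IsConvexBody (K : Set (Euc n)) : Prop :=
  Convex ℝ K ∧ IsCompact K ∧ (interior K).Nonempty

/-- The centroid of `K` lies at the origin, i.e. `∫_K x dx = 0`. -/
def CentroidAtOrigin (K : Set (Euc n)) : Prop :=
  (∫ x in K, x) = (0 : Euc n)

/-- The lattice generated by the family `b`. -/
def latticeOf (b : Fin n → Euc n) : Set (Euc n) :=
  {x | ∃ z : Fin n → ℤ, x = ∑ i, (z i : ℝ) • b i}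

/-- The determinant of the lattice generated by `b`. -/
def latticeDet (b : Fin n → Euc n) : ℝ :=
  |Matrix.det (Matrix.of fun i j => b j i)|

/-- The integer lattice `ℤ^n` inside `ℝ^n`. -/
def stdLattice (n : ℕ) : Set (Euc n) :=
  {x | ∀ i, ∃ m : ℤ, x i = (m : ℝ)}

/-- `succMin K Λ i` is the `i`-th successive minimum
`λ_i(K,Λ) = inf {t > 0 : t•K contains at least i linearly independent points of Λ}`. -/
def succMin (K Λ : Set (Euc n)) (i : ℕ) : ℝ :=
  sInf {t : ℝ | 0 < t ∧ ∃ v : Fin i → Euc n,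
    LinearIndependent ℝ v ∧ ∀ j, v j ∈ Λ ∧ v j ∈ t • K}

/-- Surface area of a convex body, via the (outer) Minkowski content. -/
def surfaceArea (K : Set (Euc n)) : ℝ :=
  limUnder (nhdsWithin (0 : ℝ) (Ioi 0)) fun ε =>
    ((volume (Metric.cthickening ε K)).toReal - (volume K).toReal) / ε

/-- The `k`-th elementary symmetric function of `ρ 0, …, ρ (n-1)`. -/
def esym (n k : ℕ) (ρ : Fin n → ℝ) : ℝ :=
  ∑ J ∈ Finset.powersetCard k (Finset.univ : Finset (Fin n)), ∏ i ∈ J, ρ i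

/-- A rational polytope: convex hull of finitely many points with rational coordinates. -/
def IsRationalPolytope (P : Set (Euc n)) : Prop :=
  ∃ V : Finset (Euc n), (∀ v ∈ V, ∀ i, ∃ q : ℚ, v i = (q : ℝ)) ∧
    P = convexHull ℝ (V : Set (Euc n))

/-- A lattice polytope: convex hull of finitely many points of `ℤ^n`. -/
def IsLatticePolytope (P : Set (Euc n)) : Prop :=
  ∃ V : Finset (Euc n), (∀ v ∈ V, v ∈ stdLattice n) ∧
    P = convexHull ℝ (V : Set (Euc n))

/-- `F` is a facet of `P`: an `(n-1)`-dimensional face cut out by a supporting hyperplane. -/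
def IsFacet (P F : Set (Euc n)) : Prop :=
  ∃ (a : Euc n) (b : ℝ), a ≠ 0 ∧ (∀ x ∈ P, ⟪a, x⟫ ≤ b) ∧
    F = {x | x ∈ P ∧ ⟪a, x⟫ = b} ∧
    Module.finrank ℝ (affineSpan ℝ F).direction = n - 1

/-- The determinant of a `k`-dimensional lattice `L ⊆ ℝ^n` (given as a set of points):
the square root of the Gram determinant of any ℤ-basis of `L`. -/
def sublatticeDetOf (k : ℕ) (L : Set (Euc n)) : ℝ :=
  sInf {d : ℝ | ∃ c : Fin k → Euc n, LinearIndependent ℝ c ∧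
    L = {x | ∃ z : Fin k → ℤ, x = ∑ i, (z i : ℝ) • c i} ∧
    d = Real.sqrt (Matrix.det (Matrix.of fun i j => ⟪c i, c j⟫))}

/-- The lattice surface area
`lE_{n-1}(P) = (1/2) ∑_{F facet of P} vol_{n-1}(F) / det(aff₀(F) ∩ ℤ^n)`,
where `vol_{n-1}` is realized by the `(n-1)`-dimensional Hausdorff measure. -/
def latticeSurfaceArea (P : Set (Euc n)) : ℝ :=
  (1/2) * ∑ᶠ F ∈ {F : Set (Euc n) | IsFacet P F},
    (μH[(n : ℝ) - 1] F).toReal /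
      sublatticeDetOf (n - 1) (((affineSpan ℝ F).direction : Set (Euc n)) ∩ stdLattice n)

/-- `D_i(Λ)`: the minimal determinant of an `i`-dimensional sublattice of `Λ`. -/
def minSublatticeDet (Λ : Set (Euc n)) (i : ℕ) : ℝ :=
  sInf {d : ℝ | ∃ c : Fin i → Euc n, LinearIndependent ℝ c ∧ (∀ j, c j ∈ Λ) ∧
    d = Real.sqrt (Matrix.det (Matrix.of fun k l => ⟪c k, c l⟫))}

/-- `D_min(Λ) = min {D_i(Λ)^(1/i) : 1 ≤ i ≤ n}`. -/
def Dmin (Λ : Set (Euc n)) : ℝ :=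
  sInf {d : ℝ | ∃ i : Fin n, d = minSublatticeDet Λ ((i : ℕ) + 1) ^ ((1 : ℝ) / ((i : ℕ) + 1))}

/-- The polar lattice `Λ^⋆ = {x : ⟨x,y⟩ ∈ ℤ for all y ∈ Λ}`. -/
def polarLattice (Λ : Set (Euc n)) : Set (Euc n) :=
  {x | ∀ y ∈ Λ, ∃ m : ℤ, ⟪x, y⟫ = (m : ℝ)}

/-- The standard cross-polytope `C_n^⋆ = conv{±e_1, …, ±e_n}`. -/
def crossPolytope (n : ℕ) : Set (Euc n) :=
  convexHull ℝ ((Set.range fun i : Fin n => EuclideanSpace.single i (1 : ℝ)) ∪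
    (Set.range fun i : Fin n => -EuclideanSpace.single i (1 : ℝ)))

/-- The standard simplex `S_n = conv{0, e_1, …, e_n}`. -/
def stdSimplexSet (n : ℕ) : Set (Euc n) :=
  convexHull ℝ (insert 0 (Set.range fun i : Fin n => EuclideanSpace.single i (1 : ℝ)))

/-- The all-ones vector `𝟙 = (1,…,1)`. -/
def allOnes (n : ℕ) : Euc n := WithLp.toLp 2 fun _ => (1 : ℝ)

/-- The simplex `T_n = -𝟙 + (n+1) S_n`. -/
def Tn (n : ℕ) : Set (Euc n) :=
  (fun x => ((n : ℝ) + 1) • x - allOnes n) '' stdSimplexSet n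


/-- bounded, compactly supported log-concave functions -/
structure LC {E : Type*} [NormedAddCommGroup E] [NormedSpace ℝ E] [MeasurableSpace E]
    (f : E → ℝ) : Prop where
  meas : Measurable f
  nonneg : ∀ y, 0 ≤ f y
  bdd : ∃ M, ∀ y, f y ≤ M
  supp : ∃ R, ∀ y, f y ≠ 0 → ‖y‖ ≤ R
  lc : ∀ x y (s t : ℝ), 0 < s → 0 < t → s + t = 1 → f x ^ s * f y ^ t ≤ f (s • x + t • y)

theorem integ_of {E : Type*} [NormedAddCommGroup E] [NormedSpace ℝ E] [ProperSpace E]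
    [MeasurableSpace E] [BorelSpace E] (μ : Measure E) [IsFiniteMeasureOnCompacts μ]
    {f : E → ℝ} (hm : Measurable f) (M R : ℝ) (hb : ∀ y, |f y| ≤ M)
    (hs : ∀ y, f y ≠ 0 → ‖y‖ ≤ R) : Integrable f μ := by
  have h1 : IntegrableOn f (Metric.closedBall 0 R) μ := by
    refine Measure.integrableOn_of_bounded (M := M) ?_ hm.aestronglyMeasurable ?_
    · exact (isCompact_closedBall (0:E) R).measure_lt_top.ne
    · exact Eventually.of_forall (fun y => by simpa using hb y)
  refine (integrableOn_iff_integrable_of_support_subset ?_).1 h1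
  intro y hy
  simpa using hs y hy

section
variable {E : Type*} [NormedAddCommGroup E] [NormedSpace ℝ E] [MeasurableSpace E] {f : E → ℝ}

theorem LC.pos_of (hf : LC f) {y : E} (h : f y ≠ 0) : 0 < f y :=
  lt_of_le_of_ne (hf.nonneg y) (Ne.symm h)

theorem LC.min_le (hf : LC f) (x y : E) (s t : ℝ) (hs : 0 ≤ s) (ht : 0 ≤ t) (hst : s + t = 1) :
    min (f x) (f y) ≤ f (s • x + t • y) := by
  rcases hs.eq_or_lt with rfl | hs
  · have : t = 1 := by linarith
    subst this; simp
  rcases ht.eq_or_lt with rfl | ht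
  · have : s = 1 := by linarith
    subst this; simp
  refine le_trans ?_ (hf.lc x y s t hs ht hst)
  have hm : 0 ≤ min (f x) (f y) := le_min (hf.nonneg x) (hf.nonneg y)
  calc min (f x) (f y) = min (f x) (f y) ^ s * min (f x) (f y) ^ t := by
        rw [← Real.rpow_add_of_nonneg hm hs.le ht.le, hst, Real.rpow_one]
    _ ≤ _ := by
        gcongr
        · exact Real.rpow_nonneg (hf.nonneg x) _
        · exact min_le_left _ _
        · exact min_le_right _ _

theorem LC.convex_gt (hf : LC f) (u : ℝ) : Convex ℝ {y | u < f y} := by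
  intro x hx y hy s t hs ht hst
  exact lt_of_lt_of_le (lt_min hx hy) (hf.min_le x y s t hs ht hst)

theorem LC.convex (hf : LC f) : Convex ℝ {y | f y ≠ 0} := by
  convert hf.convex_gt 0 using 1
  ext y
  exact ⟨fun h => hf.pos_of h, fun h => ne_of_gt h⟩

theorem LC.integrable [ProperSpace E] [BorelSpace E] (hf : LC f) (μ : Measure E)
    [IsFiniteMeasureOnCompacts μ] : Integrable f μ := by
  obtain ⟨M, hM⟩ := hf.bdd
  obtain ⟨R, hR⟩ := hf.supp
  exact integ_of μ hf.meas M R (fun y => by rw [abs_of_nonneg (hf.nonneg y)]; exact hM y) hR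

theorem LC.exists_bound (hf : LC f) : ∃ M, 0 < M ∧ ∀ y, f y ≤ M := by
  obtain ⟨M, hM⟩ := hf.bdd
  exact ⟨max M 1, by positivity, fun y => (hM y).trans (le_max_left _ _)⟩

theorem LC.exists_rad (hf : LC f) : ∃ R, 0 < R ∧ ∀ y, f y ≠ 0 → ‖y‖ ≤ R := by
  obtain ⟨M, hM⟩ := hf.supp
  exact ⟨max M 1, by positivity, fun y h => (hM y h).trans (le_max_left _ _)⟩

theorem LC.smul (hf : LC f) {c : ℝ} (hc : 0 < c) : LC (fun y => c * f y) where
  meas := hf.meas.const_mul c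
  nonneg y := mul_nonneg hc.le (hf.nonneg y)
  bdd := by
    obtain ⟨M, hM⟩ := hf.bdd
    exact ⟨c * M, fun y => mul_le_mul_of_nonneg_left (hM y) hc.le⟩
  supp := by
    obtain ⟨R, hR⟩ := hf.supp
    exact ⟨R, fun y h => hR y (right_ne_zero_of_mul h)⟩
  lc x y s t hs ht hst := by
    rw [Real.mul_rpow hc.le (hf.nonneg x), Real.mul_rpow hc.le (hf.nonneg y)]
    have : c ^ s * c ^ t = c := by rw [← Real.rpow_add hc, hst, Real.rpow_one]
    calc _ = (c ^ s * c ^ t) * (f x ^ s * f y ^ t) := by ring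
      _ ≤ _ := by rw [this]; exact mul_le_mul_of_nonneg_left (hf.lc x y s t hs ht hst) hc.le
end

theorem bm1 (A B C : Set ℝ) (s t : ℝ) (hs : 0 < s) (ht : 0 < t)
    (hA : A.Nonempty) (hB : B.Nonempty)
    (hAb : Bornology.IsBounded A) (hBb : Bornology.IsBounded B) (hC : Convex ℝ C)
    (h : ∀ x ∈ A, ∀ y ∈ B, s * x + t * y ∈ C) :
    ENNReal.ofReal s * volume A + ENNReal.ofReal t * volume B ≤ volume C := by
  have a1 := hAb.bddBelow
  have a2 := hAb.bddAbove
  have b1 := hBb.bddBelow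
  have b2 := hBb.bddAbove
  have vA : volume A ≤ ENNReal.ofReal (sSup A - sInf A) := by
    rw [← Real.volume_Icc]
    exact measure_mono (fun x hx => ⟨csInf_le a1 hx, le_csSup a2 hx⟩)
  have vB : volume B ≤ ENNReal.ofReal (sSup B - sInf B) := by
    rw [← Real.volume_Icc]
    exact measure_mono (fun x hx => ⟨csInf_le b1 hx, le_csSup b2 hx⟩)
  have hA' : 0 ≤ sSup A - sInf A := by
    obtain ⟨x, hx⟩ := hA
    linarith [csInf_le a1 hx, le_csSup a2 hx]
  have hB' : 0 ≤ sSup B - sInf B := by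
    obtain ⟨x, hx⟩ := hB
    linarith [csInf_le b1 hx, le_csSup b2 hx]
  have vC : ENNReal.ofReal ((s * sSup A + t * sSup B) - (s * sInf A + t * sInf B)) ≤ volume C := by
    rw [← Real.volume_Ioo]
    refine measure_mono ?_
    rintro z ⟨hz1, hz2⟩
    set d := (z - (s * sInf A + t * sInf B)) / (2 * (s + t)) with hd
    have hdpos : 0 < d := by apply div_pos <;> linarith
    obtain ⟨x1, hx1, hx1'⟩ := exists_lt_of_csInf_lt hA (show sInf A < sInf A + d by linarith)
    obtain ⟨y1, hy1, hy1'⟩ := exists_lt_of_csInf_lt hB (show sInf B < sInf B + d by linarith)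
    set e := ((s * sSup A + t * sSup B) - z) / (2 * (s + t)) with he
    have hepos : 0 < e := by apply div_pos <;> linarith
    obtain ⟨x2, hx2, hx2'⟩ := exists_lt_of_lt_csSup hA (show sSup A - e < sSup A by linarith)
    obtain ⟨y2, hy2, hy2'⟩ := exists_lt_of_lt_csSup hB (show sSup B - e < sSup B by linarith)
    have hd2 : d * (2 * (s + t)) = z - (s * sInf A + t * sInf B) := by
      rw [hd]; field_simp
    have he2 : e * (2 * (s + t)) = (s * sSup A + t * sSup B) - z := by
      rw [he]; field_simp
    refine hC.ordConnected.out (h x1 hx1 y1 hy1) (h x2 hx2 y2 hy2) ⟨?_, ?_⟩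
    · nlinarith
    · nlinarith
  refine le_trans ?_ vC
  calc _ ≤ ENNReal.ofReal s * ENNReal.ofReal (sSup A - sInf A)
        + ENNReal.ofReal t * ENNReal.ofReal (sSup B - sInf B) := by gcongr
    _ = _ := by
      rw [← ENNReal.ofReal_mul hs.le, ← ENNReal.ofReal_mul ht.le, ← ENNReal.ofReal_add
        (by positivity) (by positivity)]
      congr 1; ring

theorem pl1_aux (F G H : ℝ → ℝ) (hF : LC F) (hG : LC G) (hH : LC H) (s t : ℝ) (hs : 0 < s)
    (ht : 0 < t) (hst : s + t = 1) (h : ∀ x y, F x ^ s * G y ^ t ≤ H (s * x + t * y))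
    (hF1 : IsLUB (range F) 1) (hG1 : IsLUB (range G) 1) :
    s * (∫ x, F x) + t * (∫ x, G x) ≤ ∫ x, H x := by
  have key : ∀ F : ℝ → ℝ, LC F → ENNReal.ofReal (∫ x, F x)
      = ∫⁻ u in Ioi 0, volume {x | u < F x} := by
    intro F hF
    rw [ofReal_integral_eq_lintegral_ofReal (hF.integrable _) (Eventually.of_forall hF.nonneg)]
    exact lintegral_eq_lintegral_meas_lt _ (Eventually.of_forall hF.nonneg) hF.meas.aemeasurable
  have iF : 0 ≤ ∫ x, F x := integral_nonneg hF.nonneg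
  have iG : 0 ≤ ∫ x, G x := integral_nonneg hG.nonneg
  have iH : 0 ≤ ∫ x, H x := integral_nonneg hH.nonneg
  rw [← ENNReal.ofReal_le_ofReal_iff iH, ENNReal.ofReal_add (by positivity) (by positivity),
    ENNReal.ofReal_mul hs.le, ENNReal.ofReal_mul ht.le, key F hF, key G hG, key H hH,
    ← lintegral_const_mul' _ _ ENNReal.ofReal_ne_top,
    ← lintegral_const_mul' _ _ ENNReal.ofReal_ne_top]
  refine (le_lintegral_add _ _).trans (setLIntegral_mono' measurableSet_Ioi ?_)
  intro u hu
  have hu : 0 < u := hu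
  have bd : ∀ F : ℝ → ℝ, LC F → Bornology.IsBounded {x | u < F x} := by
    intro F hF
    obtain ⟨R, hR⟩ := hF.supp
    refine (Metric.isBounded_closedBall (x := (0:ℝ)) (r := R)).subset ?_
    intro x hx
    have : F x ≠ 0 := (lt_trans hu hx).ne'
    simpa using hR x this
  rcases lt_or_ge u 1 with h1 | h1
  · refine bm1 _ _ _ s t hs ht ?_ ?_ (bd F hF) (bd G hG) (hH.convex_gt u) ?_
    · obtain ⟨_, ⟨x, rfl⟩, hx⟩ := (lt_isLUB_iff hF1).1 h1
      exact ⟨x, hx⟩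
    · obtain ⟨_, ⟨x, rfl⟩, hx⟩ := (lt_isLUB_iff hG1).1 h1
      exact ⟨x, hx⟩
    · intro x hx y hy
      refine lt_of_lt_of_le ?_ (h x y)
      calc u = u ^ s * u ^ t := by rw [← Real.rpow_add hu, hst, Real.rpow_one]
        _ < F x ^ s * G y ^ t := by
          have e1 : u ^ s < F x ^ s := Real.rpow_lt_rpow hu.le hx hs
          have e2 : u ^ t < G y ^ t := Real.rpow_lt_rpow hu.le hy ht
          exact mul_lt_mul'' e1 e2 (Real.rpow_nonneg hu.le _) (Real.rpow_nonneg hu.le _)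
  · have e1 : {x | u < F x} = ∅ := by
      ext x; simp; exact (hF1.1 ⟨x, rfl⟩).trans h1
    have e2 : {x | u < G x} = ∅ := by
      ext x; simp; exact (hG1.1 ⟨x, rfl⟩).trans h1
    simp [e1, e2]

theorem LC.exists_norm {F : ℝ → ℝ} (hF : LC F) (h0 : (∫ x, F x) ≠ 0) :
    ∃ a, 0 < a ∧ IsLUB (range (fun x => a⁻¹ * F x)) 1 := by
  have hb : BddAbove (range F) := by
    obtain ⟨M, hM⟩ := hF.bdd
    exact ⟨M, by rintro _ ⟨x, rfl⟩; exact hM x⟩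
  have hl := isLUB_csSup (range_nonempty F) hb
  set a := sSup (range F)
  have ha : 0 < a := by
    by_contra hcon
    apply h0
    have : F = fun _ => 0 := by
      funext x
      exact le_antisymm ((hl.1 ⟨x, rfl⟩).trans (not_lt.1 hcon)) (hF.nonneg x)
    rw [this]; simp
  refine ⟨a, ha, ?_, ?_⟩
  · rintro _ ⟨x, rfl⟩
    have := hl.1 ⟨x, rfl⟩
    simp only
    rw [inv_mul_le_iff₀ ha, mul_one]; exact this
  · intro b hb
    have : a ≤ a * b := by
      apply hl.2
      rintro _ ⟨x, rfl⟩
      have := hb ⟨x, rfl⟩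
      simp only at this
      rwa [inv_mul_le_iff₀ ha] at this
    nlinarith

theorem pl1 (F G H : ℝ → ℝ) (hF : LC F) (hG : LC G) (hH : LC H) (s t : ℝ) (hs : 0 < s)
    (ht : 0 < t) (hst : s + t = 1) (h : ∀ x y, F x ^ s * G y ^ t ≤ H (s * x + t * y)) :
    (∫ x, F x) ^ s * (∫ x, G x) ^ t ≤ ∫ x, H x := by
  have iF : 0 ≤ ∫ x, F x := integral_nonneg hF.nonneg
  have iG : 0 ≤ ∫ x, G x := integral_nonneg hG.nonneg
  have iH : 0 ≤ ∫ x, H x := integral_nonneg hH.nonneg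
  by_cases h1 : (∫ x, F x) = 0
  · rw [h1, Real.zero_rpow hs.ne']; simpa using iH
  by_cases h2 : (∫ x, G x) = 0
  · rw [h2, Real.zero_rpow ht.ne']; simpa using iH
  obtain ⟨a, ha, ha'⟩ := hF.exists_norm h1
  obtain ⟨b, hb, hb'⟩ := hG.exists_norm h2
  have hc : 0 < a ^ s * b ^ t := by positivity
  have := pl1_aux (fun x => a⁻¹ * F x) (fun x => b⁻¹ * G x) (fun x => (a ^ s * b ^ t)⁻¹ * H x)
    (hF.smul (by positivity)) (hG.smul (by positivity)) (hH.smul (by positivity)) s t hs ht hst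
    (by
      intro x y
      rw [Real.mul_rpow (by positivity) (hF.nonneg x), Real.mul_rpow (by positivity) (hG.nonneg y),
        Real.inv_rpow ha.le, Real.inv_rpow hb.le]
      calc _ = (a ^ s * b ^ t)⁻¹ * (F x ^ s * G y ^ t) := by rw [mul_inv]; ring
        _ ≤ _ := by gcongr; exact h x y) ha' hb'
  rw [integral_const_mul, integral_const_mul, integral_const_mul] at this
  have am := Real.geom_mean_le_arith_mean2_weighted hs.le ht.le
    (show 0 ≤ a⁻¹ * ∫ x, F x by positivity) (show 0 ≤ b⁻¹ * ∫ x, G x by positivity) hst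
  have := am.trans this
  rw [Real.mul_rpow (by positivity) iF, Real.mul_rpow (by positivity) iG,
        Real.inv_rpow ha.le, Real.inv_rpow hb.le, le_inv_mul_iff₀ hc] at this
  refine le_trans (le_of_eq ?_) this
  field_simp

/-- marginal over the first coordinate -/
def marg {m : ℕ} (f : (Fin (m + 1) → ℝ) → ℝ) (y : Fin m → ℝ) : ℝ :=
  ∫ x : ℝ, f (Fin.cons x y)

theorem norm_cons_le {m : ℕ} (x : ℝ) (y : Fin m → ℝ) (R : ℝ) (hR : 0 ≤ R) :
    ‖(Fin.cons x y : Fin (m + 1) → ℝ)‖ ≤ R ↔ |x| ≤ R ∧ ‖y‖ ≤ R := by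
  rw [pi_norm_le_iff_of_nonneg hR, pi_norm_le_iff_of_nonneg hR, Fin.forall_fin_succ]
  simp

theorem measurable_cons {m : ℕ} :
    Measurable (fun p : ℝ × (Fin m → ℝ) => (Fin.cons p.1 p.2 : Fin (m + 1) → ℝ)) := by
  rw [measurable_pi_iff]
  intro i
  refine Fin.cases ?_ (fun j => ?_) i
  · simpa using measurable_fst
  · simp only [Fin.cons_succ]
    exact (measurable_pi_apply j).comp measurable_snd

theorem cons_comb {m : ℕ} (x y : ℝ) (u v : Fin m → ℝ) (s t : ℝ) :
    (Fin.cons (s * x + t * y) (s • u + t • v) : Fin (m + 1) → ℝ)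
      = s • (Fin.cons x u : Fin (m + 1) → ℝ) + t • (Fin.cons y v : Fin (m + 1) → ℝ) := by
  ext i
  refine Fin.cases ?_ (fun j => ?_) i <;> simp

theorem LC.sec {m : ℕ} {f : (Fin (m + 1) → ℝ) → ℝ} (hf : LC f) (y : Fin m → ℝ) :
    LC (fun x : ℝ => f (Fin.cons x y)) where
  meas := hf.meas.comp (measurable_cons.comp (measurable_id.prodMk measurable_const))
  nonneg x := hf.nonneg _
  bdd := by obtain ⟨M, hM⟩ := hf.bdd; exact ⟨M, fun x => hM _⟩
  supp := by
    obtain ⟨R, hR, h⟩ := hf.exists_rad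
    exact ⟨R, fun x hx => ((norm_cons_le x y R hR.le).1 (h _ hx)).1⟩
  lc a b s t hs ht hst := by
    refine (hf.lc (Fin.cons a y) (Fin.cons b y) s t hs ht hst).trans (le_of_eq ?_)
    rw [← cons_comb, ← add_smul, hst, one_smul]; simp

theorem LC.marg {m : ℕ} {f : (Fin (m + 1) → ℝ) → ℝ} (hf : LC f) : LC (marg f) where
  meas := by
    have : StronglyMeasurable (fun p : (Fin m → ℝ) × ℝ => f (Fin.cons p.2 p.1)) :=
      (hf.meas.comp (measurable_cons.comp measurable_swap)).stronglyMeasurable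
    exact this.integral_prod_right.measurable
  nonneg y := integral_nonneg (fun x => hf.nonneg _)
  bdd := by
    obtain ⟨M, hM0, hM⟩ := hf.exists_bound
    obtain ⟨R, hR0, hR⟩ := hf.exists_rad
    refine ⟨∫ x : ℝ, (Icc (-R) R).indicator (fun _ => M) x, fun y => ?_⟩
    refine integral_mono ((hf.sec y).integrable _) ?_ ?_
    · exact (integrable_indicator_iff measurableSet_Icc).2 (by simp)
    · intro x
      by_cases hx : f (Fin.cons x y) = 0
      · simp only [hx]; exact indicator_nonneg (fun _ _ => hM0.le) _
      · have := ((norm_cons_le x y R hR0.le).1 (hR _ hx)).1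
        simp only
        rw [indicator_of_mem (show x ∈ Icc (-R) R from abs_le.1 this)]
        exact hM _
  supp := by
    obtain ⟨R, hR, h⟩ := hf.exists_rad
    refine ⟨R, fun y hy => ?_⟩
    by_contra hcon
    apply hy
    have : (fun x : ℝ => f (Fin.cons x y)) = fun _ => 0 := by
      funext x
      by_contra hx
      exact hcon ((norm_cons_le x y R hR.le).1 (h _ hx)).2
    simp [Paper.marg, this]
  lc u v s t hs ht hst := by
    refine pl1 _ _ _ (hf.sec u) (hf.sec v) (hf.sec _) s t hs ht hst ?_
    intro x y
    rw [cons_comb]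
    exact hf.lc _ _ s t hs ht hst


/-- rounding to the shifted grid -/
def rd (k : ℕ) (c x : ℝ) : ℝ := (⌊(k : ℝ) * (x + c)⌋ : ℝ) / k - c

theorem rd_meas (k : ℕ) (c : ℝ) : Measurable (rd k c) := by
  unfold rd
  have : Measurable (fun x : ℝ => (k : ℝ) * (x + c)) := by fun_prop
  exact ((measurable_from_top.comp (Int.measurable_floor.comp this)).div_const _).sub_const _

theorem rd_le {k : ℕ} (hk : 0 < k) (c x : ℝ) : rd k c x ≤ x := by
  have hk' : (0:ℝ) < k := by exact_mod_cast hk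
  unfold rd
  have := Int.floor_le ((k : ℝ) * (x + c))
  rw [sub_le_iff_le_add, div_le_iff₀ hk']; linarith

theorem lt_rd {k : ℕ} (hk : 0 < k) (c x : ℝ) : x - 1 / k < rd k c x := by
  have hk' : (0:ℝ) < k := by exact_mod_cast hk
  unfold rd
  have := Int.lt_floor_add_one ((k : ℝ) * (x + c))
  rw [lt_sub_iff_add_lt, lt_div_iff₀ hk']; field_simp; linarith

theorem rd_eq {k : ℕ} (hk : 0 < k) (c x : ℝ) (z : ℤ) (h1 : (z:ℝ) / k - c ≤ x)
    (h2 : x < ((z:ℝ) + 1) / k - c) : rd k c x = z / k - c := by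
  have hk' : (0:ℝ) < k := by exact_mod_cast hk
  unfold rd
  have : ⌊(k : ℝ) * (x + c)⌋ = z := by
    rw [Int.floor_eq_iff]
    rw [sub_le_iff_le_add, div_le_iff₀ hk'] at h1
    rw [lt_sub_iff_add_lt, lt_div_iff₀ hk'] at h2
    constructor <;> linarith
  rw [this]

theorem pair_ineq {φ : ℝ → ℝ} (hφ : LC φ) {a b x : ℝ} (ha : a < x) (hb : x < b) :
    2 * (√(φ a) * √(φ b)) ≤ φ x + φ (a + b - x) := by
  set τ := (x - a) / (b - a) with hτ
  have hab : 0 < b - a := by linarith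
  have t1 : 0 < τ := div_pos (by linarith) hab
  have t2 : 0 < 1 - τ := by
    rw [hτ, sub_pos, div_lt_one hab]; linarith
  have e : τ * (b - a) = x - a := by rw [hτ]; field_simp
  have h1 := hφ.lc a b (1 - τ) τ t2 t1 (by ring)
  have h2 := hφ.lc a b τ (1 - τ) t1 t2 (by ring)
  have e1 : (1 - τ) • a + τ • b = x := by simp only [smul_eq_mul]; linarith
  have e2 : τ • a + (1 - τ) • b = a + b - x := by simp only [smul_eq_mul]; linarith
  rw [e1] at h1
  rw [e2] at h2
  have na := hφ.nonneg a
  have nb := hφ.nonneg b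
  have hprod : φ a * φ b ≤ φ x * φ (a + b - x) := by
    calc φ a * φ b = (φ a ^ (1 - τ) * φ b ^ τ) * (φ a ^ τ * φ b ^ (1 - τ)) := by
          have e3 : φ a ^ (1 - τ) * φ a ^ τ = φ a := by
            rw [← Real.rpow_add_of_nonneg na t2.le t1.le]; simp
          have e4 : φ b ^ τ * φ b ^ (1 - τ) = φ b := by
            rw [← Real.rpow_add_of_nonneg nb t1.le t2.le]; simp
          calc _ = (φ a ^ (1 - τ) * φ a ^ τ) * (φ b ^ τ * φ b ^ (1 - τ)) := by rw [e3, e4]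
            _ = _ := by ring
      _ ≤ _ := mul_le_mul h1 h2 (by positivity) (hφ.nonneg _)
  have n1 := hφ.nonneg x
  have n2 := hφ.nonneg (a + b - x)
  rw [← Real.sqrt_mul na]
  have : √(φ a * φ b) ≤ (φ x + φ (a + b - x)) / 2 := by
    apply Real.sqrt_le_iff.2
    constructor
    · positivity
    · nlinarith [sq_nonneg (φ x - φ (a + b - x))]
  linarith

theorem cell1 {φ : ℝ → ℝ} (hφ : LC φ) {a b : ℝ} (hab : a < b) :
    (b - a) * (√(φ a) * √(φ b)) ≤ ∫ x in a..b, φ x := by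
  have i1 : IntervalIntegrable φ volume a b := (hφ.integrable volume).intervalIntegrable
  have i2 : IntervalIntegrable (fun x => φ (a + b - x)) volume a b := by
    have := i1.comp_sub_left (a + b)
    simpa using this.symm
  have e : ∫ x in a..b, φ (a + b - x) = ∫ x in a..b, φ x := by
    rw [intervalIntegral.integral_comp_sub_left (fun x => φ x)]
    simp
  have h : ∫ x in a..b, (2 * (√(φ a) * √(φ b)) : ℝ) ≤ ∫ x in a..b, (φ x + φ (a + b - x)) := by
    refine intervalIntegral.integral_mono_on_of_le_Ioo hab.le (by simp) (i1.add i2) ?_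
    intro x hx
    exact pair_ineq hφ hx.1 hx.2
  rw [intervalIntegral.integral_add i1 i2, e, intervalIntegral.integral_const] at h
  simp only [smul_eq_mul] at h
  linarith

/-- grid points -/
def gp (k : ℕ) (c : ℝ) (z : ℤ) (j : ℕ) : ℝ := ((z:ℝ) + j) / k - c

theorem gp_succ {k : ℕ} (hk : 0 < k) (c : ℝ) (z : ℤ) (j : ℕ) :
    gp k c z (j + 1) = gp k c z j + 1 / k := by
  unfold gp; push_cast; ring

theorem gp_eq (k : ℕ) (c : ℝ) (z : ℤ) (j : ℕ) :
    gp k c z j = gp k c z 0 + j / k := by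
  unfold gp; push_cast; ring

theorem cell {φ : ℝ → ℝ} (hφ : LC φ) {k : ℕ} (hk : 0 < k) (c : ℝ) (z : ℤ) (L : ℕ)
    (hl : ∀ x ≤ gp k c z 0, φ x = 0) (hr : ∀ x, gp k c z L ≤ x → φ x = 0) :
    (k : ℝ) * ((∫ x, φ (rd k c x)) - ∫ x, φ x)
      ≤ 1 / 2 * ∑ j ∈ Finset.range L, (√(φ (gp k c z j)) - √(φ (gp k c z (j + 1)))) ^ 2 := by
  have hk' : (0:ℝ) < k := by exact_mod_cast hk
  set b := gp k c z with hb
  have hlt : ∀ j, b j < b (j + 1) := by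
    intro j; rw [hb, gp_succ hk]; have : 0 < 1 / (k:ℝ) := by positivity
    linarith
  have mono : StrictMono b := strictMono_nat_of_lt_succ hlt
  have I1 : ∫ x, φ x = ∑ j ∈ Finset.range L, ∫ x in (b j)..(b (j+1)), φ x := by
    rw [intervalIntegral.sum_integral_adjacent_intervals
      (fun j _ => (hφ.integrable volume).intervalIntegrable)]
    symm
    apply intervalIntegral.integral_eq_integral_of_support_subset
    intro x hx
    refine ⟨?_, ?_⟩
    · by_contra h; exact hx (hl x (not_lt.1 h))
    · by_contra h; exact hx (hr x (not_le.1 h).le)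
  have cellc : ∀ j, ∀ x ∈ Ico (b j) (b (j+1)), φ (rd k c x) = φ (b j) := by
    intro j x hx
    have := rd_eq hk c x (z + j) (by push_cast; exact hx.1)
      (by push_cast; have := hx.2; rw [hb] at this; unfold gp at this; push_cast at this
          rw [add_assoc]; exact this)
    rw [this, hb]; unfold gp; push_cast; rfl
  have ae : ∀ j, (∀ᵐ x, x ∈ uIoc (b j) (b (j+1)) → φ (b j) = φ (rd k c x)) := by
    intro j
    have : ∀ᵐ x : ℝ, x ≠ b (j+1) := by
      simp [ae_iff, measure_singleton]
    filter_upwards [this] with x hx hx2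
    rw [uIoc_of_le (hlt j).le] at hx2
    exact (cellc j x ⟨hx2.1.le, lt_of_le_of_ne hx2.2 hx⟩).symm
  have ii : ∀ j, IntervalIntegrable (fun x => φ (rd k c x)) volume (b j) (b (j+1)) := by
    intro j
    refine (intervalIntegrable_const (c := φ (b j))).congr_ae ?_
    rw [Filter.EventuallyEq, ae_restrict_iff' measurableSet_uIoc]
    exact ae j
  have I2 : ∫ x, φ (rd k c x) = ∑ j ∈ Finset.range L, (1 / (k:ℝ)) * φ (b j) := by
    have : ∫ x, φ (rd k c x)
        = ∑ j ∈ Finset.range L, ∫ x in (b j)..(b (j+1)), φ (rd k c x) := by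
      rw [intervalIntegral.sum_integral_adjacent_intervals (fun j _ => ii j)]
      symm
      apply intervalIntegral.integral_eq_integral_of_support_subset
      intro x hx
      refine ⟨?_, ?_⟩
      · by_contra h; exact hx (hl _ ((rd_le hk c x).trans (not_lt.1 h)))
      · by_contra h
        apply hx
        have h := (not_le.1 h).le
        refine hr _ ?_
        rw [hb] at h ⊢
        unfold gp at h ⊢
        unfold rd
        gcongr
        have : (z:ℝ) + L = ((z + L : ℤ) : ℝ) := by push_cast; rfl
        rw [this]
        norm_cast
        rw [Int.le_floor, ← this]
        rw [sub_le_iff_le_add, div_le_iff₀ hk'] at h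
        linarith
    rw [this]
    refine Finset.sum_congr rfl (fun j _ => ?_)
    rw [← intervalIntegral.integral_congr_ae (ae j)]
    rw [intervalIntegral.integral_const, hb, gp_succ hk]; simp
  have I3 : ∑ j ∈ Finset.range L, φ (b j)
      = ∑ j ∈ Finset.range L, (φ (b j) + φ (b (j+1))) / 2 := by
    have h0 : φ (b 0) = 0 := hl _ le_rfl
    have hL : φ (b L) = 0 := hr _ le_rfl
    have := Finset.sum_range_succ' (fun j => φ (b j)) L
    have h2 := Finset.sum_range_succ (fun j => φ (b j)) L
    rw [← Finset.sum_div, Finset.sum_add_distrib]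
    linarith
  have I4 : ∀ j ∈ Finset.range L, (φ (b j) + φ (b (j+1))) / 2 - k * ∫ x in (b j)..(b (j+1)), φ x
      ≤ 1 / 2 * (√(φ (b j)) - √(φ (b (j + 1)))) ^ 2 := by
    intro j _
    have h := cell1 hφ (hlt j)
    have e : b (j+1) - b j = 1 / k := by rw [hb, gp_succ hk]; ring
    rw [e] at h
    have h' : √(φ (b j)) * √(φ (b (j+1))) ≤ k * ∫ x in (b j)..(b (j+1)), φ x := by
      have := mul_le_mul_of_nonneg_left h hk'.le
      field_simp at this
      linarith
    have s1 := Real.sq_sqrt (hφ.nonneg (b j))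
    have s2 := Real.sq_sqrt (hφ.nonneg (b (j+1)))
    nlinarith
  calc (k : ℝ) * ((∫ x, φ (rd k c x)) - ∫ x, φ x)
      = ∑ j ∈ Finset.range L, ((φ (b j) + φ (b (j+1))) / 2
          - k * ∫ x in (b j)..(b (j+1)), φ x) := by
        rw [Finset.sum_sub_distrib, ← I3, I1, I2, ← Finset.mul_sum, ← Finset.mul_sum, mul_sub]
        field_simp
    _ ≤ _ := by rw [Finset.mul_sum]; exact Finset.sum_le_sum I4

theorem seq_sum (q : ℕ → ℝ) (S : ℝ) (l : ℕ) : ∀ i j, j = i + l →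
    (∀ x y z, i ≤ x → x ≤ y → y ≤ z → z ≤ j → min (q x) (q z) ≤ q y) →
    (∀ x, i ≤ x → x ≤ j → q x ≤ S) →
    ∑ x ∈ Finset.Ico i j, (q x - q (x+1)) ^ 2 ≤ (S - q i) ^ 2 + (S - q j) ^ 2 := by
  induction l with
  | zero =>
    intro i j h _ _
    subst h; simp; positivity
  | succ l ih =>
    intro i j hj hq hS
    have hm := hq i (i+1) j le_rfl (by omega) (by omega) le_rfl
    have hm2 := hq i (j-1) j le_rfl (by omega) (by omega) le_rfl
    rcases le_total (q i) (q j) with h | h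
    · rw [min_eq_left h] at hm
      rw [Finset.sum_eq_sum_Ico_succ_bot (by omega)]
      have := ih (i+1) j (by omega) (fun x y z h1 h2 h3 h4 => hq x y z (by omega) h2 h3 h4)
        (fun x h1 h2 => hS x (by omega) h2)
      have := hS (i+1) (by omega) (by omega)
      nlinarith
    · rw [min_eq_right h] at hm2
      obtain ⟨j', rfl⟩ : ∃ j', j = j' + 1 := ⟨i + l, by omega⟩
      rw [Finset.sum_Ico_succ_top (by omega)]
      simp only [Nat.add_sub_cancel] at hm2
      have := ih i j' (by omega) (fun x y z h1 h2 h3 h4 => hq x y z (by omega) h2 h3 (by omega))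
        (fun x h1 h2 => hS x (by omega) (by omega))
      have := hS j' (by omega) (by omega)
      nlinarith

theorem LC.quasi {φ : ℝ → ℝ} (hφ : LC φ) {x y z : ℝ} (h1 : x ≤ y) (h2 : y ≤ z) :
    min (φ x) (φ z) ≤ φ y := by
  rcases h1.eq_or_lt with rfl | h1
  · exact min_le_left _ _
  have hxz : 0 < z - x := by linarith
  have := hφ.min_le x z ((z - y) / (z - x)) ((y - x) / (z - x)) (div_nonneg (by linarith) hxz.le)
    (div_nonneg (by linarith) hxz.le) (by field_simp; ring)
  have e : ((z - y) / (z - x)) • x + ((y - x) / (z - x)) • z = y := by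
    simp only [smul_eq_mul]; field_simp; ring
  rwa [e] at this

theorem sqrt_quasi {φ : ℝ → ℝ} (hφ : LC φ) {b : ℕ → ℝ} (hb : Monotone b) {x y z : ℕ}
    (h1 : x ≤ y) (h2 : y ≤ z) :
    min (√(φ (b x))) (√(φ (b z))) ≤ √(φ (b y)) := by
  have := hφ.quasi (hb h1) (hb h2)
  rw [← Real.sqrt_monotone.map_min]
  exact Real.sqrt_le_sqrt this

theorem gp_mono {k : ℕ} (c : ℝ) (z : ℤ) : Monotone (gp k c z) := by
  intro i j h; unfold gp; gcongr

theorem exists_gp {k : ℕ} (hk : 0 < k) (c p0 p1 : ℝ) :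
    ∃ (z : ℤ) (L : ℕ), gp k c z 0 ≤ p0 ∧ p1 ≤ gp k c z L := by
  have hk' : (0:ℝ) < k := by exact_mod_cast hk
  refine ⟨⌊k * (p0 + c)⌋, ⌈k * (p1 + c) - ⌊k * (p0 + c)⌋⌉₊, ?_, ?_⟩
  · unfold gp
    have := Int.floor_le (k * (p0 + c))
    simp only [Nat.cast_zero, add_zero]
    rw [sub_le_iff_le_add, div_le_iff₀ hk']; linarith
  · unfold gp
    rw [le_sub_iff_add_le, le_div_iff₀ hk']
    have := Nat.le_ceil (k * (p1 + c) - ⌊k * (p0 + c)⌋)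
    linarith

/-- uniform bound -/
theorem cell_bound {φ : ℝ → ℝ} (hφ : LC φ) {k : ℕ} (hk : 0 < k) (c M : ℝ) (hM : ∀ x, φ x ≤ M) :
    (k : ℝ) * ((∫ x, φ (rd k c x)) - ∫ x, φ x) ≤ M := by
  obtain ⟨R, hR0, hR⟩ := hφ.exists_rad
  obtain ⟨z, L, h1, h2⟩ := exists_gp hk c (-R-1) (R+1)
  have hM0 : 0 ≤ M := (hφ.nonneg 0).trans (hM 0)
  have hl : ∀ x ≤ gp k c z 0, φ x = 0 := by
    intro x hx; by_contra h
    have := abs_le.1 (hR x h); linarith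
  have hr : ∀ x, gp k c z L ≤ x → φ x = 0 := by
    intro x hx; by_contra h
    have := abs_le.1 (hR x h); linarith
  refine (cell hφ hk c z L hl hr).trans ?_
  have := seq_sum (fun j => √(φ (gp k c z j))) (√M) L 0 L (by simp)
    (fun x y w _ h2 h3 _ => sqrt_quasi hφ (gp_mono c z) h2 h3)
    (fun x _ _ => Real.sqrt_le_sqrt (hM _))
  simp only [hl _ le_rfl, hr _ le_rfl, Real.sqrt_zero, sub_zero, Real.sq_sqrt hM0,
    Nat.Ico_zero_eq_range] at this
  linarith

theorem LC.step {φ : ℝ → ℝ} (hφ : LC φ) {M m w x y : ℝ} (hM : ∀ x, φ x ≤ M) (hm : 0 < m)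
    (hw : m ≤ φ w) (h1 : w < x) (h2 : x ≤ y) :
    φ y - φ x ≤ M * Real.log (M / m) * ((y - x) / (y - w)) := by
  have hM0 : 0 < M := hm.trans_le (hw.trans (hM w))
  have hmM : m ≤ M := hw.trans (hM w)
  have hlog : 0 ≤ Real.log (M / m) := Real.log_nonneg (by rw [le_div_iff₀ hm]; linarith)
  have hyw : 0 < y - w := by linarith
  have hτ0 : 0 ≤ (y - x) / (y - w) := div_nonneg (by linarith) hyw.le
  set τ := (y - x) / (y - w) with hτ
  have hrhs : 0 ≤ M * Real.log (M / m) * τ := by positivity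
  rcases le_or_gt (φ y) (φ x) with h | h
  · linarith
  have hy : 0 < φ y := (hφ.nonneg x).trans_lt h
  rcases hτ0.eq_or_lt with h0 | h0
  · have : y = x := by
      have : y - x = 0 := by
        have : (y - w) * τ = y - x := by rw [hτ]; field_simp
        rw [← h0] at this; linarith
      linarith
    subst this; linarith
  have e : τ * (y - w) = y - x := by rw [hτ]; field_simp
  have h1τ : 0 < 1 - τ := by rw [hτ, sub_pos, div_lt_one hyw]; linarith
  have hl := hφ.lc y w (1 - τ) τ h1τ h0 (by ring)
  have e2 : (1 - τ) • y + τ • w = x := by simp only [smul_eq_mul]; linarith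
  rw [e2] at hl
  have h3 : φ y * (m / M) ^ τ ≤ φ y ^ (1 - τ) * φ w ^ τ := by
    have e3 : φ y ^ (1 - τ) = φ y / φ y ^ τ := by rw [Real.rpow_sub hy, Real.rpow_one]
    rw [e3, div_mul_eq_mul_div, mul_div_assoc, ← Real.div_rpow (by linarith) hy.le]
    gcongr
    · exact hφ.nonneg w
    · exact hM y
  have h4 : 1 - τ * Real.log (M / m) ≤ (m / M) ^ τ := by
    rw [Real.rpow_def_of_pos (by positivity)]
    have : Real.log (m / M) = - Real.log (M / m) := by rw [← Real.log_inv, inv_div]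
    rw [this]
    have := Real.add_one_le_exp (-Real.log (M / m) * τ)
    linarith
  have h5 : φ y * (1 - τ * Real.log (M / m)) ≤ φ x :=
    (mul_le_mul_of_nonneg_left h4 hy.le).trans (h3.trans hl)
  have h6 : φ y * (τ * Real.log (M / m)) ≤ M * (τ * Real.log (M / m)) :=
    mul_le_mul_of_nonneg_right (hM y) (by positivity)
  linarith

theorem LC.neg {φ : ℝ → ℝ} (hφ : LC φ) : LC (fun x => φ (-x)) where
  meas := hφ.meas.comp measurable_neg
  nonneg x := hφ.nonneg _
  bdd := by obtain ⟨M, h⟩ := hφ.bdd; exact ⟨M, fun x => h _⟩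
  supp := by obtain ⟨M, h⟩ := hφ.supp; exact ⟨M, fun x hx => by simpa using h _ hx⟩
  lc x y s t hs ht hst := by
    refine (hφ.lc (-x) (-y) s t hs ht hst).trans (le_of_eq ?_)
    congr 1; simp only [smul_eq_mul]; ring

theorem LC.step' {φ : ℝ → ℝ} (hφ : LC φ) {M m w x y : ℝ} (hM : ∀ x, φ x ≤ M) (hm : 0 < m)
    (hw : m ≤ φ w) (h1 : x < w) (h2 : y ≤ x) :
    φ y - φ x ≤ M * Real.log (M / m) * ((x - y) / (w - y)) := by
  have := hφ.neg.step (w := -w) (x := -x) (y := -y) (fun x => hM _) hm (by simpa using hw)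
    (by linarith) (by linarith)
  simp only [neg_neg] at this
  convert this using 3 <;> ring


theorem sub_sq_le {a b : ℝ} (hb : 0 ≤ b) (h : b ≤ a) : (a - b) ^ 2 ≤ a ^ 2 - b ^ 2 := by nlinarith

theorem sqrt_diff {m u v : ℝ} (hm : 0 < m) (hu : m ≤ u) (hv : m ≤ v) :
    (√u - √v) ^ 2 * m ≤ (u - v) ^ 2 := by
  have s1 := Real.sq_sqrt (hm.le.trans hu)
  have s2 := Real.sq_sqrt (hm.le.trans hv)
  have n1 := Real.sqrt_nonneg u
  have n2 := Real.sqrt_nonneg v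
  have e5 : u - v = (√u - √v) * (√u + √v) := by nlinarith
  rw [e5, mul_pow]
  apply mul_le_mul_of_nonneg_left _ (sq_nonneg _)
  nlinarith

set_option maxHeartbeats 2000000 in
theorem Cfin {φ : ℝ → ℝ} (hφ : LC φ) {k : ℕ} (hk : 0 < k) (c M m0 m1 p0 l x0 xm x1 r p1 η d : ℝ)
    (hM : ∀ x, φ x ≤ M) (hm0 : 0 < m0) (hm1 : 0 < m1) (o1 : p0 < l) (o2 : l < x0) (o3 : x0 < xm)
    (o4 : xm < x1) (o5 : x1 < r) (o6 : r < p1) (hp0 : φ p0 = 0) (hp1 : φ p1 = 0)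
    (hxm : m0 ≤ φ xm) (hl : m1 ≤ φ l) (hr : m1 ≤ φ r)
    (hη0 : M * Real.log (M / m0) * ((x0 - p0) / (xm - x0)) ≤ η)
    (hη1 : M * Real.log (M / m0) * ((p1 - x1) / (x1 - xm)) ≤ η)
    (hd : 0 < d) (hd0 : d ≤ x0 - l) (hd1 : d ≤ r - x1) (hkd : 1 / (k:ℝ) < d) :
    (k : ℝ) * ((∫ x, φ (rd k c x)) - ∫ x, φ x) ≤ 1 / 2 * (φ x0 + φ x1 + 4 * η
      + 2 * (M * Real.log (M / m1) * ((1 / k) / d))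
      + (M * Real.log (M / m1) * ((1 / k) / d)) ^ 2 / m1 * ((x1 - x0 + 2 * (1 / k)) * k)) := by
  have hk' : (0:ℝ) < k := by exact_mod_cast hk
  obtain ⟨z, L, hb0, hbL⟩ := exists_gp hk c p0 p1
  have hM0 : 0 < M := hm0.trans_le (hxm.trans (hM xm))
  have hlog1 : 0 ≤ Real.log (M / m1) :=
    Real.log_nonneg (by rw [le_div_iff₀ hm1]; linarith [hM l])
  have hlog0 : 0 ≤ Real.log (M / m0) :=
    Real.log_nonneg (by rw [le_div_iff₀ hm0]; linarith [hM xm])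
  have zl : ∀ x ≤ p0, φ x = 0 := by
    intro x hx
    have := hφ.quasi hx (show p0 ≤ xm by linarith)
    rw [hp0] at this
    by_contra h
    have := hφ.pos_of h
    have := lt_min this (hm0.trans_le hxm)
    linarith
  have zr : ∀ x, p1 ≤ x → φ x = 0 := by
    intro x hx
    have := hφ.quasi (show xm ≤ p1 by linarith) hx
    rw [hp1] at this
    by_contra h
    have := hφ.pos_of h
    have := lt_min (hm0.trans_le hxm) this
    linarith
  have hcell := cell hφ hk c z L (fun x hx => zl x (hx.trans hb0)) (fun x hx => zr x (hbL.trans hx))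
  have hsucc : ∀ j, gp k c z (j+1) = gp k c z j + 1 / k := gp_succ hk c z
  have hgp : ∀ j, gp k c z j = gp k c z 0 + j / k := gp_eq k c z
  have hmono : Monotone (gp k c z) := gp_mono c z
  set b := gp k c z with hb
  set h := 1 / (k:ℝ) with hh
  have hhpos : 0 < h := by positivity
  have hkh : (k:ℝ) * h = 1 := by rw [hh]; field_simp
  -- indices
  obtain ⟨i0, hi0, hi0'⟩ : ∃ i0, b i0 ≤ x0 ∧ x0 < b (i0 + 1) := by
    refine ⟨⌊(x0 - b 0) * k⌋₊, ?_, ?_⟩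
    · have := Nat.floor_le (show 0 ≤ (x0 - b 0) * k from mul_nonneg (by linarith) hk'.le)
      rw [hgp]
      have : (⌊(x0 - b 0) * k⌋₊ : ℝ) / k ≤ x0 - b 0 := by rwa [div_le_iff₀ hk']
      linarith
    · have := Nat.lt_floor_add_one ((x0 - b 0) * k)
      rw [hgp]
      push_cast
      have : x0 - b 0 < ((⌊(x0 - b 0) * k⌋₊ : ℝ) + 1) / k := by rwa [lt_div_iff₀ hk']
      linarith
  obtain ⟨i1, hi1, hi1'⟩ : ∃ i1, b i1 < x1 ∧ x1 ≤ b (i1 + 1) := by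
    have hpos : 0 < ⌈(x1 - b 0) * k⌉₊ := Nat.ceil_pos.2 (mul_pos (by linarith) hk')
    obtain ⟨i1, hi⟩ : ∃ i1, ⌈(x1 - b 0) * k⌉₊ = i1 + 1 := ⟨_, (Nat.succ_pred_eq_of_pos hpos).symm⟩
    refine ⟨i1, ?_, ?_⟩
    · have := Nat.lt_of_lt_of_eq (Nat.lt_succ_self i1) hi.symm
      rw [Nat.lt_ceil] at this
      rw [hgp]
      have : (i1:ℝ) / k < x1 - b 0 := by rwa [div_lt_iff₀ hk']
      linarith
    · have := Nat.le_ceil ((x1 - b 0) * k)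
      rw [hi] at this
      rw [hgp]
      have : x1 - b 0 ≤ ((i1 + 1 : ℕ):ℝ) / k := by rwa [le_div_iff₀ hk']
      linarith
  have hsi0 := hsucc i0
  have hsi1 := hsucc i1
  have h01 : i0 ≤ i1 + 1 := by
    by_contra hc
    have := hmono (show i1 + 1 ≤ i0 by omega)
    linarith
  have h1L : i1 + 1 ≤ L := by
    by_contra hc
    have := hmono (show L ≤ i1 + 1 by omega)
    linarith
  have hq : ∀ x y z : ℕ, x ≤ y → y ≤ z → min (√(φ (b x))) (√(φ (b z))) ≤ √(φ (b y)) :=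
    fun x y z h2 h3 => sqrt_quasi hφ hmono h2 h3
  -- left tail
  have supL : ∀ x ≤ x0, φ x ≤ φ x0 + η := by
    intro x hx
    have hη : 0 ≤ η := le_trans (mul_nonneg (by positivity) (div_nonneg (by linarith) (by linarith))) hη0
    rcases le_or_gt x p0 with h' | h'
    · rw [zl x h']; linarith [hφ.nonneg x0]
    · have := hφ.step' hM hm0 hxm o3 hx
      have e : (x0 - x) / (xm - x) ≤ (x0 - p0) / (xm - x0) := by
        apply div_le_div₀ <;> linarith
      have := mul_le_mul_of_nonneg_left e (show 0 ≤ M * Real.log (M / m0) by positivity)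
      linarith
  have supR : ∀ x, x1 ≤ x → φ x ≤ φ x1 + η := by
    intro x hx
    have hη : 0 ≤ η := le_trans (mul_nonneg (by positivity) (div_nonneg (by linarith) (by linarith))) hη1
    rcases le_or_gt p1 x with h' | h'
    · rw [zr x h']; linarith [hφ.nonneg x1]
    · have := hφ.step hM hm0 hxm o4 hx
      have e : (x - x1) / (x - xm) ≤ (p1 - x1) / (x1 - xm) := by
        apply div_le_div₀ <;> linarith
      have := mul_le_mul_of_nonneg_left e (show 0 ≤ M * Real.log (M / m0) by positivity)
      linarith
  set C1 := M * Real.log (M / m1) with hC1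
  have hC1n : 0 ≤ C1 := by positivity
  have TL : ∑ j ∈ Finset.Ico 0 i0, (√(φ (b j)) - √(φ (b (j+1)))) ^ 2
      ≤ φ x0 + 2 * η + C1 * (h / d) := by
    have := seq_sum (fun j => √(φ (b j))) (√(φ x0 + η)) i0 0 i0 (by simp)
      (fun x y w _ h2 h3 _ => hq x y w h2 h3)
      (fun x _ hx => Real.sqrt_le_sqrt (supL _ ((hmono hx).trans hi0)))
    refine this.trans ?_
    rw [zl (b 0) hb0, Real.sqrt_zero, sub_zero]
    have s0 := supL _ hi0
    have n0 := hφ.nonneg (b i0)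
    have e1 := sub_sq_le (Real.sqrt_nonneg _) (Real.sqrt_le_sqrt s0)
    rw [Real.sq_sqrt n0, Real.sq_sqrt (by linarith)] at e1
    rw [Real.sq_sqrt (by linarith)]
    have st := hφ.step hM hm1 hl (show l < b i0 by linarith) hi0
    have e : (x0 - b i0) / (x0 - l) ≤ h / d := by
      apply div_le_div₀ <;> linarith
    have := mul_le_mul_of_nonneg_left e hC1n
    linarith
  have TR : ∑ j ∈ Finset.Ico (i1+1) L, (√(φ (b j)) - √(φ (b (j+1)))) ^ 2
      ≤ φ x1 + 2 * η + C1 * (h / d) := by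
    have := seq_sum (fun j => √(φ (b j))) (√(φ x1 + η)) (L - (i1+1)) (i1+1) L (by omega)
      (fun x y w _ h2 h3 _ => hq x y w h2 h3)
      (fun x hx _ => Real.sqrt_le_sqrt (supR _ (hi1'.trans (hmono hx))))
    refine this.trans ?_
    rw [zr (b L) hbL, Real.sqrt_zero, sub_zero]
    have s0 := supR _ hi1'
    have n0 := hφ.nonneg (b (i1+1))
    have e1 := sub_sq_le (Real.sqrt_nonneg _) (Real.sqrt_le_sqrt s0)
    rw [Real.sq_sqrt n0, Real.sq_sqrt (by linarith)] at e1
    rw [Real.sq_sqrt (by linarith)]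
    have st := hφ.step' hM hm1 hr (show b (i1+1) < r by linarith) hi1'
    have e : (b (i1+1) - x1) / (r - x1) ≤ h / d := by
      apply div_le_div₀ <;> linarith
    have := mul_le_mul_of_nonneg_left e hC1n
    linarith
  have TM : ∑ j ∈ Finset.Ico i0 (i1+1), (√(φ (b j)) - √(φ (b (j+1)))) ^ 2
      ≤ (C1 * (h / d)) ^ 2 / m1 * ((x1 - x0 + 2 * h) * k) := by
    have hterm : ∀ j ∈ Finset.Ico i0 (i1+1), (√(φ (b j)) - √(φ (b (j+1)))) ^ 2
        ≤ (C1 * (h / d)) ^ 2 / m1 := by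
      intro j hj
      rw [Finset.mem_Ico] at hj
      have g1 : b i0 ≤ b j := hmono hj.1
      have g2 : b j ≤ b i1 := hmono (by omega)
      have g3 := hsucc j
      have mj : m1 ≤ φ (b j) := (le_min hl hr).trans (hφ.quasi (by linarith) (by linarith))
      have mj' : m1 ≤ φ (b (j+1)) := (le_min hl hr).trans (hφ.quasi (by linarith) (by linarith))
      have st1 := hφ.step hM hm1 hl (show l < b j by linarith) (show b j ≤ b (j+1) by linarith)
      have st2 := hφ.step' hM hm1 hr (show b (j+1) < r by linarith) (show b j ≤ b (j+1) by linarith)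
      have e1 : (b (j+1) - b j) / (b (j+1) - l) ≤ h / d := by
        apply div_le_div₀ <;> linarith
      have e2 : (b (j+1) - b j) / (r - b j) ≤ h / d := by
        apply div_le_div₀ <;> linarith
      have f1 := mul_le_mul_of_nonneg_left e1 hC1n
      have f2 := mul_le_mul_of_nonneg_left e2 hC1n
      have ab : |φ (b j) - φ (b (j+1))| ≤ C1 * (h / d) := abs_le.2 ⟨by linarith, by linarith⟩
      have ab2 : (φ (b j) - φ (b (j+1))) ^ 2 ≤ (C1 * (h / d)) ^ 2 := by
        rw [← sq_abs]; gcongr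
      rw [le_div_iff₀ hm1]
      exact (sqrt_diff hm1 mj mj').trans ab2
    have := Finset.sum_le_sum hterm
    refine this.trans ?_
    rw [Finset.sum_const, nsmul_eq_mul, Nat.card_Ico, Nat.cast_sub h01, mul_comm]
    have hnn : 0 ≤ (C1 * (h / d)) ^ 2 / m1 := by positivity
    apply mul_le_mul_of_nonneg_left _ hnn
    have e1 := hgp (i1+1)
    have e2 := hgp i0
    have e3 : ((i1 + 1 : ℕ) : ℝ) - i0 = (b (i1+1) - b i0) * k := by
      rw [e1, e2]; field_simp; ring
    rw [e3]
    apply mul_le_mul_of_nonneg_right _ hk'.le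
    linarith
  have split : ∑ j ∈ Finset.range L, (√(φ (b j)) - √(φ (b (j + 1)))) ^ 2
      = ∑ j ∈ Finset.Ico 0 i0, (√(φ (b j)) - √(φ (b (j+1)))) ^ 2
      + ∑ j ∈ Finset.Ico i0 (i1+1), (√(φ (b j)) - √(φ (b (j+1)))) ^ 2
      + ∑ j ∈ Finset.Ico (i1+1) L, (√(φ (b j)) - √(φ (b (j+1)))) ^ 2 := by
    rw [Finset.sum_Ico_consecutive _ (by omega) h01, Finset.sum_Ico_consecutive _ (by omega) h1L,
      Nat.Ico_zero_eq_range]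
  refine hcell.trans ?_
  rw [split]
  linarith

theorem Clim (φ : ℕ → ℝ → ℝ) (g : ℝ → ℝ) (hφ : ∀ k, LC (φ k)) (M a b cL cR c : ℝ)
    (hM : ∀ k x, φ k x ≤ M) (hab : a < b)
    (hlim : ∀ x ∈ Ioo a b, Tendsto (fun k => φ k x) atTop (nhds (g x)))
    (hg : ∀ x ∈ Ioo a b, 0 < g x)
    (ha : ∀ x < a, ∀ᶠ k in atTop, φ k x = 0) (hb : ∀ x, b < x → ∀ᶠ k in atTop, φ k x = 0)
    (hcL : ∀ η > 0, ∀ᶠ s in nhdsWithin (0:ℝ) (Ioi 0), g (a + s) ≤ cL + η)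
    (hcR : ∀ η > 0, ∀ᶠ s in nhdsWithin (0:ℝ) (Ioi 0), g (b - s) ≤ cR + η)
    (η : ℝ) (hη : 0 < η) :
    ∀ᶠ k : ℕ in atTop, (k : ℝ) * ((∫ x, φ k (rd k c x)) - ∫ x, φ k x) ≤ (cL + cR) / 2 + η := by
  set xm := (a + b) / 2 with hxm
  have gxm := hg xm ⟨by linarith, by linarith⟩
  set m0 := g xm / 2 with hm0
  have hm0p : 0 < m0 := by linarith
  set C0 := M * Real.log (M / m0) with hC0
  set D := (b - a) / 4 with hD
  have hDp : 0 < D := by linarith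
  set e := η / 8 with he
  -- choose s
  have ev1 : ∀ᶠ s in nhdsWithin (0:ℝ) (Ioi 0), |C0| * (2 * s / D) < e := by
    have : Tendsto (fun s : ℝ => |C0| * (2 * s / D)) (nhdsWithin 0 (Ioi 0)) (nhds 0) := by
      have : Continuous (fun s : ℝ => |C0| * (2 * s / D)) := by fun_prop
      have := this.tendsto 0
      simp only [mul_zero, zero_div] at this
      exact this.mono_left nhdsWithin_le_nhds
    exact this.eventually_lt_const (by linarith)
  have ev2 : ∀ᶠ s in nhdsWithin (0:ℝ) (Ioi 0), s ∈ Ioo 0 D := Ioo_mem_nhdsGT hDp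
  obtain ⟨s, ⟨⟨⟨hs1, hs0, hsD⟩, hsL⟩, hsR⟩⟩ := (((ev1.and ev2).and (hcL e (by linarith))).and
    (hcR e (by linarith))).exists
  set m1 := min (g (a + s/2)) (g (b - s/2)) / 2 with hm1
  have g1 := hg (a + s/2) ⟨by linarith, by linarith⟩
  have g2 := hg (b - s/2) ⟨by linarith, by linarith⟩
  have hm1p : 0 < m1 := by have := lt_min g1 g2; linarith
  have l1 := hlim xm ⟨by linarith, by linarith⟩
  have l2 := hlim (a + s/2) ⟨by linarith, by linarith⟩
  have l3 := hlim (b - s/2) ⟨by linarith, by linarith⟩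
  have l4 := hlim (a + s) ⟨by linarith, by linarith⟩
  have l5 := hlim (b - s) ⟨by linarith, by linarith⟩
  have tk : Tendsto (fun k : ℕ => 1 / (k:ℝ)) atTop (nhds 0) := tendsto_one_div_atTop_nhds_zero_nat
  set C1 := M * Real.log (M / m1) with hC1
  have lr : Tendsto (fun k : ℕ => 2 * (C1 * ((1 / (k:ℝ)) / (s/2)))
      + (C1 / (s/2)) ^ 2 / m1 * ((b - s - (a + s) + 2 * (1 / (k:ℝ)))) * (1 / (k:ℝ))) atTop
      (nhds (2 * (C1 * (0 / (s/2)))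
      + (C1 / (s/2)) ^ 2 / m1 * ((b - s - (a + s) + 2 * 0)) * 0)) := by
    refine Tendsto.add ?_ ?_
    · exact ((tk.div_const _).const_mul _).const_mul _
    · exact ((((tk.const_mul 2).const_add _).const_mul _)).mul tk
  simp only [zero_div, mul_zero, add_zero] at lr
  filter_upwards [l1.eventually_const_lt (show m0 < g xm by linarith),
    l2.eventually_const_lt (show m1 < g (a + s/2) by
      have := min_le_left (g (a + s/2)) (g (b - s/2)); linarith),
    l3.eventually_const_lt (show m1 < g (b - s/2) by
      have := min_le_right (g (a + s/2)) (g (b - s/2)); linarith),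
    l4.eventually_lt_const (show g (a + s) < g (a + s) + e by linarith),
    l5.eventually_lt_const (show g (b - s) < g (b - s) + e by linarith),
    tk.eventually_lt_const (show (0:ℝ) < s/2 by linarith),
    lr.eventually_lt_const (show (0:ℝ) < e by linarith),
    ha (a - s) (by linarith), hb (b + s) (by linarith), eventually_gt_atTop 0]
    with k k1 k2 k3 k4 k5 k6 k7 k8 k9 k10
  have hk' : (0:ℝ) < k := by exact_mod_cast k10
  have hMm : m0 ≤ M := k1.le.trans (hM k xm)
  have hC0n : 0 ≤ C0 := mul_nonneg (by linarith)
    (Real.log_nonneg (by rw [le_div_iff₀ hm0p]; linarith))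
  rw [abs_of_nonneg hC0n] at hs1
  have fin := Cfin (hφ k) k10 c M m0 m1 (a - s) (a + s/2) (a + s) xm (b - s) (b - s/2) (b + s) e
    (s/2) (hM k) hm0p hm1p (by linarith) (by linarith) (by linarith) (by linarith) (by linarith)
    (by linarith) k8 k9 k1.le k2.le k3.le
    (by
      refine le_trans (mul_le_mul_of_nonneg_left ?_ hC0n) hs1.le
      apply div_le_div₀ <;> linarith)
    (by
      refine le_trans (mul_le_mul_of_nonneg_left ?_ hC0n) hs1.le
      apply div_le_div₀ <;> linarith)
    (by linarith) (by linarith) (by linarith) k6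
  refine fin.trans ?_
  have e1 : (C1 * (1 / (k:ℝ) / (s / 2))) ^ 2 / m1 * ((b - s - (a + s) + 2 * (1 / (k:ℝ))) * k)
      = (C1 / (s/2)) ^ 2 / m1 * ((b - s - (a + s) + 2 * (1 / (k:ℝ)))) * (1 / (k:ℝ)) := by
    field_simp
  rw [← hC1, e1]
  linarith


theorem psym {m : ℕ} (p : ℝ × (Fin m → ℝ)) :
    (MeasurableEquiv.piFinSuccAbove (fun _ : Fin (m+1) => ℝ) 0).symm p
      = (Fin.cons p.1 p.2 : Fin (m+1) → ℝ) := by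
  change Fin.insertNth (α := fun _ : Fin (m+1) => ℝ) 0 p.1 p.2 = _
  rw [Fin.insertNth_zero']

theorem integral_cons {m : ℕ} (F : (Fin (m + 1) → ℝ) → ℝ) (hF : Integrable F) :
    ∫ z, F z = ∫ y : Fin m → ℝ, ∫ x : ℝ, F (Fin.cons x y) := by
  have mp := volume_preserving_piFinSuccAbove (fun _ : Fin (m+1) => ℝ) 0
  have mps := mp.symm
  rw [← mps.integral_comp' F]
  have hint : Integrable (fun p : ℝ × (Fin m → ℝ) => F ((MeasurableEquiv.piFinSuccAbove (fun _ : Fin (m+1) => ℝ) 0).symm p)) (volume.prod volume) := by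
    have := (mps.integrable_comp_emb (MeasurableEquiv.measurableEmbedding _) (g := F)).2 hF
    exact this
  have := integral_prod_symm _ hint
  simp only [psym] at this ⊢
  exact this

theorem integrable_cons {m : ℕ} (F : (Fin (m + 1) → ℝ) → ℝ) (hF : Integrable F) :
    Integrable (fun y : Fin m → ℝ => ∫ x : ℝ, F (Fin.cons x y)) := by
  have mp := volume_preserving_piFinSuccAbove (fun _ : Fin (m+1) => ℝ) 0
  have mps := mp.symm
  have hint : Integrable (fun p : ℝ × (Fin m → ℝ) => F ((MeasurableEquiv.piFinSuccAbove (fun _ : Fin (m+1) => ℝ) 0).symm p)) (volume.prod volume) := by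
    have := (mps.integrable_comp_emb (MeasurableEquiv.measurableEmbedding _) (g := F)).2 hF
    exact this
  have := hint.integral_prod_right
  simp only [psym] at this
  exact this

theorem LC.integral_marg {m : ℕ} {f : (Fin (m + 1) → ℝ) → ℝ} (hf : LC f) :
    ∫ y, Paper.marg f y = ∫ z, f z := (integral_cons f (hf.integrable _)).symm

theorem continuous_cons {m : ℕ} :
    Continuous (fun p : ℝ × (Fin m → ℝ) => (Fin.cons p.1 p.2 : Fin (m + 1) → ℝ)) := by
  apply continuous_pi
  intro i
  refine Fin.cases ?_ (fun j => ?_) i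
  · simpa using continuous_fst
  · simp only [Fin.cons_succ]
    exact (continuous_apply j).comp continuous_snd

theorem continuous_tail {m : ℕ} : Continuous (fun z : Fin (m+1) → ℝ => (Fin.tail z : Fin m → ℝ)) := by
  apply continuous_pi
  intro j
  exact continuous_apply j.succ

theorem LC.continuousOn {E : Type*} [NormedAddCommGroup E] [NormedSpace ℝ E] [FiniteDimensional ℝ E]
    [MeasurableSpace E] {f : E → ℝ} (hf : LC f) : ContinuousOn f (interior {y | f y ≠ 0}) := by
  have hc : ConcaveOn ℝ {y | f y ≠ 0} (fun y => Real.log (f y)) := by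
    refine ⟨hf.convex, ?_⟩
    intro x hx y hy s t hs ht hst
    have hx' := hf.pos_of hx
    have hy' := hf.pos_of hy
    rcases hs.eq_or_lt with rfl | hs
    · have : t = 1 := by linarith
      subst this; simp
    rcases ht.eq_or_lt with rfl | ht
    · have : s = 1 := by linarith
      subst this; simp
    have := Real.log_le_log (by positivity) (hf.lc x y s t hs ht hst)
    rw [Real.log_mul (by positivity) (by positivity), Real.log_rpow hx', Real.log_rpow hy'] at this
    exact this
  have h1 := hc.continuousOn_interior
  have h2 : ContinuousOn (fun y => Real.exp (Real.log (f y))) (interior {y | f y ≠ 0}) :=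
    Real.continuous_exp.comp_continuousOn h1
  refine h2.congr ?_
  intro y hy
  exact (Real.exp_log (hf.pos_of (interior_subset hy))).symm

theorem LC.continuousAt {E : Type*} [NormedAddCommGroup E] [NormedSpace ℝ E] [FiniteDimensional ℝ E]
    [MeasurableSpace E] {f : E → ℝ} (hf : LC f) {y : E} (hy : y ∈ interior {y | f y ≠ 0}) :
    ContinuousAt f y := hf.continuousOn.continuousAt (isOpen_interior.mem_nhds hy)

/-- vector rounding -/
def rdv {m : ℕ} (k : ℕ) (c y : Fin m → ℝ) : Fin m → ℝ := fun i => rd k (c i) (y i)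

theorem rdv_meas {m : ℕ} (k : ℕ) (c : Fin m → ℝ) : Measurable (rdv k c) := by
  rw [measurable_pi_iff]
  intro i
  exact (rd_meas k (c i)).comp (measurable_pi_apply i)

theorem rd_dist {k : ℕ} (hk : 0 < k) (c x : ℝ) : |rd k c x - x| ≤ 1 / k := by
  have h1 := rd_le hk c x
  have h2 := lt_rd hk c x
  rw [abs_le]; constructor <;> [linarith; skip]
  have : 0 ≤ 1 / (k:ℝ) := by positivity
  linarith

theorem rdv_dist {m : ℕ} {k : ℕ} (hk : 0 < k) (c y : Fin m → ℝ) : ‖rdv k c y - y‖ ≤ 1 / k := by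
  rw [pi_norm_le_iff_of_nonneg (by positivity)]
  intro i
  exact rd_dist hk _ _

theorem rdv_tendsto {m : ℕ} (c y : Fin m → ℝ) : Tendsto (fun k => rdv k c y) atTop (nhds y) := by
  rw [tendsto_iff_norm_sub_tendsto_zero]
  refine squeeze_zero' (Eventually.of_forall fun _ => norm_nonneg _) ?_
    tendsto_one_div_atTop_nhds_zero_nat
  filter_upwards [eventually_gt_atTop 0] with k hk
  exact rdv_dist hk c y

theorem rdv_cons {m : ℕ} (k : ℕ) (c : Fin (m+1) → ℝ) (x : ℝ) (y : Fin m → ℝ) :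
    rdv k c (Fin.cons x y) = Fin.cons (rd k (c 0) x) (rdv k (Fin.tail c) y) := by
  ext i
  refine Fin.cases ?_ (fun j => ?_) i <;> simp [rdv, Fin.tail]

theorem rdv_supp {m : ℕ} {k : ℕ} (hk : 0 < k) (c y : Fin m → ℝ) (R : ℝ) (h : ‖rdv k c y‖ ≤ R) :
    ‖y‖ ≤ R + 1 := by
  have h1 := rdv_dist hk c y
  have h2 : 1 / (k:ℝ) ≤ 1 := by
    rw [div_le_one (by exact_mod_cast hk)]; exact_mod_cast hk
  have := norm_sub_norm_le y (rdv k c y)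
  rw [norm_sub_rev] at this
  linarith

theorem LC.integrable_rdv {m : ℕ} {f : (Fin m → ℝ) → ℝ} (hf : LC f) {k : ℕ} (hk : 0 < k)
    (c : Fin m → ℝ) : Integrable (fun y => f (rdv k c y)) := by
  obtain ⟨M, hM0, hM⟩ := hf.exists_bound
  obtain ⟨R, hR0, hR⟩ := hf.exists_rad
  refine integ_of _ (hf.meas.comp (rdv_meas k c)) M (R+1)
    (fun y => by rw [abs_of_nonneg (hf.nonneg _)]; exact hM _) ?_
  intro y hy
  exact rdv_supp hk c y R (hR _ hy)

/-- the lattice-sum of `f`. -/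
def Ak {m : ℕ} (k : ℕ) (c : Fin m → ℝ) (f : (Fin m → ℝ) → ℝ) : ℝ := ∫ y, f (rdv k c y)

/-- layer integrand -/
def tauI {m : ℕ} (f : (Fin (m+1) → ℝ) → ℝ) (θ : ℝ) (y : Fin m → ℝ) : ℝ :=
  ∫ x : ℝ, if f (Fin.cons x y) = 0 then f (θ⁻¹ • (Fin.cons x y : Fin (m+1) → ℝ)) else 0

/-- layer integral -/
def Tf {m : ℕ} (f : (Fin (m+1) → ℝ) → ℝ) (θ : ℝ) : ℝ :=
  ∫ y : Fin m → ℝ, if marg f y = 0 then 0 else tauI f θ y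

/-- the outer part of the dilated function -/
def Wf {m : ℕ} (f : (Fin m → ℝ) → ℝ) (θ : ℝ) : ℝ :=
  ∫ y : Fin m → ℝ, if f y = 0 then f (θ⁻¹ • y) else 0

theorem wI_meas {m : ℕ} {f : (Fin m → ℝ) → ℝ} (hf : LC f) (θ : ℝ) :
    Measurable (fun y : Fin m → ℝ => if f y = 0 then f (θ⁻¹ • y) else 0) :=
  Measurable.ite (hf.meas (measurableSet_singleton 0)) (hf.meas.comp (measurable_const_smul _))
    measurable_const

theorem wI_supp {m : ℕ} {f : (Fin m → ℝ) → ℝ} {θ : ℝ} (hθ : 0 < θ) {R : ℝ}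
    (hR : ∀ y, f y ≠ 0 → ‖y‖ ≤ R) (y : Fin m → ℝ)
    (hy : (if f y = 0 then f (θ⁻¹ • y) else 0) ≠ 0) : ‖y‖ ≤ θ * R := by
  have h1 : f (θ⁻¹ • y) ≠ 0 := by
    intro h; apply hy; simp [h]
  have := hR _ h1
  rw [norm_smul, norm_inv, Real.norm_of_nonneg hθ.le, inv_mul_le_iff₀ hθ] at this
  exact this

theorem wI_bd {m : ℕ} {f : (Fin m → ℝ) → ℝ} (hf : LC f) {θ M : ℝ} (hM0 : 0 ≤ M)
    (hM : ∀ y, f y ≤ M) (y : Fin m → ℝ) :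
    0 ≤ (if f y = 0 then f (θ⁻¹ • y) else 0) ∧ (if f y = 0 then f (θ⁻¹ • y) else 0) ≤ M := by
  split_ifs
  · exact ⟨hf.nonneg _, hM _⟩
  · exact ⟨le_rfl, hM0⟩

theorem wI_int {m : ℕ} {f : (Fin m → ℝ) → ℝ} (hf : LC f) {θ : ℝ} (hθ : 0 < θ) :
    Integrable (fun y : Fin m → ℝ => if f y = 0 then f (θ⁻¹ • y) else 0) := by
  obtain ⟨M, hM0, hM⟩ := hf.exists_bound
  obtain ⟨R, hR0, hR⟩ := hf.exists_rad
  refine integ_of _ (wI_meas hf θ) M (θ * R) (fun y => ?_) (wI_supp hθ hR)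
  have := wI_bd hf hM0.le hM y (θ := θ)
  rw [abs_of_nonneg this.1]; exact this.2

theorem tauI_nonneg {m : ℕ} {f : (Fin (m+1) → ℝ) → ℝ} (hf : LC f) (θ : ℝ) (y : Fin m → ℝ) :
    0 ≤ tauI f θ y := by
  apply integral_nonneg
  intro x
  dsimp
  split_ifs
  · exact hf.nonneg _
  · exact le_rfl

theorem Tf_int {m : ℕ} {f : (Fin (m+1) → ℝ) → ℝ} (hf : LC f) {θ : ℝ} (hθ : 0 < θ) :
    Integrable (fun y : Fin m → ℝ => if marg f y = 0 then 0 else tauI f θ y) := by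
  have h := integrable_cons _ (wI_int hf hθ)
  have hs : MeasurableSet {y | marg f y ≠ 0} := (hf.marg.meas (measurableSet_singleton 0)).compl
  have := h.indicator hs
  refine this.congr (Eventually.of_forall ?_)
  intro y
  by_cases hy : marg f y = 0
  · simp [hy]
  · simp [hy, tauI]

/-- recursion for `Wf`. -/
theorem W_rec {m : ℕ} {f : (Fin (m+1) → ℝ) → ℝ} (hf : LC f) {θ : ℝ} (hθ : 1 ≤ θ) :
    Tf f θ ≤ Wf f θ - Wf (marg f) θ := by
  have hθ0 : 0 < θ := by linarith
  have e : Wf f θ = ∫ y : Fin m → ℝ, tauI f θ y := integral_cons _ (wI_int hf hθ0)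
  have hi : Integrable (fun y : Fin m → ℝ => tauI f θ y) := integrable_cons _ (wI_int hf hθ0)
  rw [e]
  unfold Tf Wf
  rw [← integral_sub hi (wI_int hf.marg hθ0)]
  refine integral_mono (Tf_int hf hθ0) (hi.sub (wI_int hf.marg hθ0)) ?_
  intro y
  simp only
  by_cases hy : marg f y = 0
  · simp only [hy, if_true]
    -- tauI y = θ * marg f (θ⁻¹ y)
    have hz : (fun x : ℝ => f (Fin.cons x y)) =ᵐ[volume] 0 :=
      (integral_eq_zero_iff_of_nonneg (fun x => hf.nonneg _) ((hf.sec y).integrable _)).1 hy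
    have e1 : tauI f θ y = ∫ x : ℝ, f (Fin.cons (θ⁻¹ * x) (θ⁻¹ • y)) := by
      unfold tauI
      refine integral_congr_ae ?_
      filter_upwards [hz] with x hx
      simp only [Pi.zero_apply] at hx
      rw [if_pos hx]
      congr 1
      ext i
      refine Fin.cases ?_ (fun j => ?_) i <;> simp
    have e2 : tauI f θ y = θ * marg f (θ⁻¹ • y) := by
      rw [e1, Measure.integral_comp_mul_left (fun x => f (Fin.cons x (θ⁻¹ • y))) θ⁻¹]
      simp [marg, abs_of_pos hθ0]
    rw [e2]
    have := hf.marg.nonneg (θ⁻¹ • y)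
    nlinarith
  · simp [hy]


theorem layer {m : ℕ} {f : (Fin (m+1) → ℝ) → ℝ} (hf : LC f) {M δ μ ε : ℝ}
    (hM : ∀ y, f y ≤ M) (hδ : 0 < δ) (hμ : 0 < μ) (hε : 0 < ε)
    (hp : δ ≤ f (Fin.cons (1 / (2 * μ)) 0)) (hn : δ ≤ f (Fin.cons (-(1 / (2 * μ))) 0))
    (x0 s : ℝ) (y : Fin m → ℝ) (hs : |s| ≤ ε / (2 * μ)) :
    f (Fin.cons x0 y) * ((M / δ) ^ ε)⁻¹
      ≤ f ((1 + ε)⁻¹ • (Fin.cons (x0 + s) y : Fin (m+1) → ℝ)) := by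
  have hM0 : 0 < M := hδ.trans_le (hp.trans (hM _))
  have hQ1 : 1 ≤ M / δ := by rw [le_div_iff₀ hδ]; linarith [hM (Fin.cons (1 / (2 * μ)) 0)]
  have hs' := abs_le.1 hs
  have e0 : ε / (2 * μ) = ε * (1 / (2 * μ)) := by ring
  rw [e0] at hs'
  have h1 : δ ≤ f (Fin.cons (s / ε) 0) := by
    refine (le_min hn hp).trans ((hf.sec 0).quasi (x := -(1 / (2 * μ))) (z := 1 / (2 * μ)) ?_ ?_)
    · rw [le_div_iff₀ hε]; linarith
    · rw [div_le_iff₀ hε]; linarith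
  set z := (Fin.cons x0 y : Fin (m+1) → ℝ) with hz
  have hθ : 0 < 1 + ε := by linarith
  rcases (hf.nonneg z).eq_or_lt with h0 | h0
  · rw [← h0, zero_mul]; exact hf.nonneg _
  have hl := hf.lc z (Fin.cons (s / ε) 0) ((1 + ε)⁻¹) (ε / (1 + ε)) (by positivity) (by positivity)
    (by field_simp)
  have e1 : ((1 + ε)⁻¹) • z + (ε / (1 + ε)) • (Fin.cons (s / ε) 0 : Fin (m+1) → ℝ)
      = (1 + ε)⁻¹ • (Fin.cons (x0 + s) y : Fin (m+1) → ℝ) := by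
    ext i
    refine Fin.cases ?_ (fun j => ?_) i
    · simp [hz]; field_simp
    · simp [hz]
  rw [e1] at hl
  refine le_trans ?_ hl
  set κ := ε / (1 + ε) with hκ
  have hκ0 : 0 < κ := by positivity
  have hκε : κ ≤ ε := by rw [hκ, div_le_iff₀ hθ]; nlinarith
  have e2 : (1 + ε)⁻¹ = 1 - κ := by rw [hκ]; field_simp; ring
  rw [e2, Real.rpow_sub h0, Real.rpow_one, div_mul_eq_mul_div, mul_div_assoc]
  apply mul_le_mul_of_nonneg_left _ h0.le
  calc ((M / δ) ^ ε)⁻¹ ≤ ((M / δ) ^ κ)⁻¹ := by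
        apply inv_anti₀ (by positivity)
        exact Real.rpow_le_rpow_of_exponent_le hQ1 hκε
    _ = δ ^ κ / M ^ κ := by
        rw [Real.div_rpow hM0.le hδ.le, inv_div]
    _ ≤ _ := by
        apply div_le_div₀ (by have := hf.nonneg (Fin.cons (s / ε) 0); positivity) _ (by positivity)
        · exact Real.rpow_le_rpow h0.le (hM _) hκ0.le
        · exact Real.rpow_le_rpow hδ.le h1 hκ0.le

theorem Ioo_of_open (I : Set ℝ) (ho : IsOpen I) (hc : Convex ℝ I) (hne : I.Nonempty)
    (hb : Bornology.IsBounded I) : ∃ a b, a < b ∧ I = Ioo a b := by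
  have b1 := hb.bddBelow
  have b2 := hb.bddAbove
  have key : I = Ioo (sInf I) (sSup I) := by
    ext x
    constructor
    · intro hx
      obtain ⟨e, he, hball⟩ := Metric.isOpen_iff.1 ho x hx
      constructor
      · have : x - e/2 ∈ I := hball (by simp [abs_of_pos he]; linarith)
        have := csInf_le b1 this
        linarith
      · have : x + e/2 ∈ I := hball (by simp [abs_of_pos he]; linarith)
        have := le_csSup b2 this
        linarith
    · rintro ⟨h1, h2⟩
      obtain ⟨u, hu, hu'⟩ := exists_lt_of_csInf_lt hne h1
      obtain ⟨v, hv, hv'⟩ := exists_lt_of_lt_csSup hne h2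
      exact hc.ordConnected.out hu hv ⟨hu'.le, hv'.le⟩
  refine ⟨_, _, ?_, key⟩
  obtain ⟨x, hx⟩ := hne
  rw [key] at hx
  exact hx.1.trans hx.2

theorem layer_int {m : ℕ} {f : (Fin (m+1) → ℝ) → ℝ} (hf : LC f) {M δ μ ε : ℝ}
    (hM : ∀ y, f y ≤ M) (hδ : 0 < δ) (hμ : 0 < μ) (hε : 0 < ε)
    (hp : δ ≤ f (Fin.cons (1 / (2 * μ)) 0)) (hn : δ ≤ f (Fin.cons (-(1 / (2 * μ))) 0))
    (x0 : ℝ) (y : Fin m → ℝ) (I : Set ℝ) (hI : MeasurableSet I) (hv : volume I = ENNReal.ofReal (ε / (2 * μ)))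
    (hI2 : ∀ x ∈ I, |x - x0| ≤ ε / (2 * μ)) (J K : Set ℝ) (hK : MeasurableSet K)
    (hJ : MeasurableSet J) (hIJ : I ⊆ J ∪ K) (s : ℝ) (hs : 0 ≤ s) (hvK : volume K = ENNReal.ofReal s) :
    f (Fin.cons x0 y) ≤ 2 * μ / ε * (M / δ) ^ ε *
      ((∫ x in J, f ((1 + ε)⁻¹ • (Fin.cons x y : Fin (m+1) → ℝ))) + s * M) := by
  have hM0 : 0 < M := hδ.trans_le (hp.trans (hM _))
  set F : ℝ → ℝ := fun x => f ((1 + ε)⁻¹ • (Fin.cons x y : Fin (m+1) → ℝ)) with hF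
  have hθ : 0 < 1 + ε := by linarith
  have hFm : Measurable F := hf.meas.comp ((measurable_const_smul _).comp
    (measurable_cons.comp (measurable_id.prodMk measurable_const)))
  have hFi : Integrable F := by
    obtain ⟨R, hR0, hR⟩ := hf.exists_rad
    refine integ_of _ hFm M ((1 + ε) * R) (fun y => by rw [abs_of_nonneg (hf.nonneg _)]; exact hM _) ?_
    intro x hx
    have := hR _ hx
    rw [norm_smul, norm_inv, Real.norm_of_nonneg hθ.le, inv_mul_le_iff₀ hθ] at this
    exact ((norm_cons_le x y _ (by positivity)).1 this).1
  have h1 : f (Fin.cons x0 y) * ((M / δ) ^ ε)⁻¹ * (ε / (2 * μ)) ≤ ∫ x in I, F x := by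
    have : ∫ x in I, (f (Fin.cons x0 y) * ((M / δ) ^ ε)⁻¹) ≤ ∫ x in I, F x := by
      refine setIntegral_mono_on ?_ hFi.integrableOn hI ?_
      · exact integrableOn_const (by rw [hv]; exact ENNReal.ofReal_ne_top)
      · intro x hx
        have := layer hf hM hδ hμ hε hp hn x0 (x - x0) y (hI2 x hx)
        simpa [hF] using this
    rw [setIntegral_const] at this
    simp only [Measure.real, hv, smul_eq_mul] at this
    rw [ENNReal.toReal_ofReal (by positivity)] at this
    linarith
  have h2 : ∫ x in I, F x ≤ (∫ x in J, F x) + s * M := by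
    have e1 : ∫ x in I, F x ≤ ∫ x in J ∪ K, F x :=
      setIntegral_mono_set hFi.integrableOn (Eventually.of_forall fun x => hf.nonneg _)
        (LE.le.eventuallyLE hIJ)
    have e2 : ∫ x in J ∪ K, F x ≤ (∫ x in J, F x) + ∫ x in K, F x := by
      have hd : J ∪ K = J ∪ (K \ J) := by simp
      rw [hd, setIntegral_union disjoint_sdiff_right (hK.diff hJ) hFi.integrableOn hFi.integrableOn]
      refine add_le_add le_rfl (setIntegral_mono_set hFi.integrableOn
        (Eventually.of_forall fun x => hf.nonneg _) (LE.le.eventuallyLE sdiff_subset))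
    have e3 : ∫ x in K, F x ≤ s * M := by
      have : ∫ x in K, F x ≤ ∫ x in K, M := by
        refine setIntegral_mono hFi.integrableOn ?_ (fun x => hM _)
        simp [hvK]
      rw [setIntegral_const] at this
      simp only [Measure.real, hvK, smul_eq_mul] at this
      rwa [ENNReal.toReal_ofReal hs] at this
    linarith
  have h3 := h1.trans h2
  have hQ : 0 < (M / δ) ^ ε := by positivity
  have e : f (Fin.cons x0 y) = 2 * μ / ε * (M / δ) ^ ε * (f (Fin.cons x0 y) * ((M / δ) ^ ε)⁻¹ * (ε / (2 * μ))) := by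
    field_simp
  rw [e]
  apply mul_le_mul_of_nonneg_left h3 (by positivity)

theorem point_lim {m : ℕ} {f : (Fin (m+1) → ℝ) → ℝ} (hf : LC f) {M δ μ ε : ℝ}
    (hM : ∀ y, f y ≤ M) (hδ : 0 < δ) (hμ : 0 < μ) (hε : 0 < ε)
    (hp : δ ≤ f (Fin.cons (1 / (2 * μ)) 0)) (hn : δ ≤ f (Fin.cons (-(1 / (2 * μ))) 0))
    (c : Fin (m+1) → ℝ) (y : Fin m → ℝ)
    (hy : ∃ x, (Fin.cons x y : Fin (m+1) → ℝ) ∈ interior {z | f z ≠ 0}) (η : ℝ) (hη : 0 < η) :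
    marg f y ≠ 0 ∧ ∀ᶠ k : ℕ in atTop, (k:ℝ) * ((∫ x, f (Fin.cons (rd k (c 0) x) (rdv k (Fin.tail c) y)))
        - ∫ x, f (Fin.cons x (rdv k (Fin.tail c) y)))
      ≤ μ / ε * (M / δ) ^ ε * tauI f (1 + ε) y + η := by
  have hM0 : 0 < M := hδ.trans_le (hp.trans (hM _))
  have ccons : Continuous (fun x : ℝ => (Fin.cons x y : Fin (m+1) → ℝ)) :=
    continuous_cons.comp (continuous_id.prodMk continuous_const)
  set I : Set ℝ := {x | (Fin.cons x y : Fin (m+1) → ℝ) ∈ interior {z | f z ≠ 0}} with hI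
  have Io : IsOpen I := isOpen_interior.preimage ccons
  have Ic : Convex ℝ I := by
    intro u hu v hv s t hs ht hst
    have := hf.convex.interior hu hv hs ht hst
    rw [← cons_comb, ← add_smul, hst, one_smul] at this
    exact this
  have Ib : Bornology.IsBounded I := by
    obtain ⟨R, hR0, hR⟩ := (hf.sec y).exists_rad
    refine (Metric.isBounded_closedBall (x := (0:ℝ)) (r := R)).subset ?_
    intro x hx
    have hx : f (Fin.cons x y) ≠ 0 := interior_subset hx
    simpa using hR x hx
  obtain ⟨a, b, hab, hIab⟩ := Ioo_of_open I Io Ic hy Ib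
  have hmem : ∀ x ∈ Ioo a b, (Fin.cons x y : Fin (m+1) → ℝ) ∈ interior {z | f z ≠ 0} := by
    intro x hx; rw [← hIab] at hx; exact hx
  have hmem' : ∀ x, (Fin.cons x y : Fin (m+1) → ℝ) ∈ interior {z | f z ≠ 0} → x ∈ Ioo a b := by
    intro x hx; rw [← hIab]; exact hx
  have hcomb : ∀ x x' s t : ℝ, s + t = 1 → s • (Fin.cons x y : Fin (m+1) → ℝ)
      + t • (Fin.cons x' y : Fin (m+1) → ℝ) = Fin.cons (s * x + t * x') y := by
    intro x x' s t hst
    rw [← cons_comb, ← add_smul, hst, one_smul]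
  have nclos : ∀ x, x ∉ Icc a b → (Fin.cons x y : Fin (m+1) → ℝ) ∉ closure {z | f z ≠ 0} := by
    intro x hx hcl
    have hmid := hmem ((a+b)/2) ⟨by linarith, by linarith⟩
    have hseg := hf.convex.openSegment_closure_interior_subset_interior hcl hmid
    have hall : ∀ t, 0 < t → t < 1 → ((1 - t) * x + t * ((a+b)/2)) ∈ Ioo a b := by
      intro t h0 h1
      apply hmem'
      apply hseg
      exact ⟨1 - t, t, by linarith, h0, by ring, hcomb _ _ _ _ (by ring)⟩
    have tend : Tendsto (fun t : ℝ => (1 - t) * x + t * ((a+b)/2)) (nhdsWithin 0 (Ioi 0)) (nhds x) := by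
      have : Continuous (fun t : ℝ => (1 - t) * x + t * ((a+b)/2)) := by fun_prop
      have := this.tendsto 0
      simp only [sub_zero, one_mul, zero_mul, add_zero] at this
      exact this.mono_left nhdsWithin_le_nhds
    apply hx
    refine isClosed_Icc.mem_of_tendsto tend ?_
    filter_upwards [Ioo_mem_nhdsGT (show (0:ℝ) < 1 by norm_num)] with t ht
    exact Ioo_subset_Icc_self (hall t ht.1 ht.2)
  have limc : ∀ x : ℝ, Tendsto (fun k => (Fin.cons x (rdv k (Fin.tail c) y) : Fin (m+1) → ℝ)) atTop
      (nhds (Fin.cons x y)) := by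
    intro x
    have := (continuous_cons (m := m)).tendsto (x, y)
    exact this.comp (tendsto_const_nhds.prodMk_nhds (rdv_tendsto _ y))
  have zev : ∀ x, x ∉ Icc a b → ∀ᶠ k in atTop, f (Fin.cons x (rdv k (Fin.tail c) y)) = 0 := by
    intro x hx
    have hop : IsOpen (closure {z | f z ≠ 0})ᶜ := isClosed_closure.isOpen_compl
    filter_upwards [(limc x).eventually (hop.mem_nhds (nclos x hx))] with k hk
    by_contra h
    exact hk (subset_closure h)
  have zpt : ∀ x, x ∉ Icc a b → f (Fin.cons x y) = 0 := by
    intro x hx; by_contra h; exact nclos x hx (subset_closure h)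
  constructor
  · intro h0
    have hz : (fun x : ℝ => f (Fin.cons x y)) =ᵐ[volume] 0 :=
      (integral_eq_zero_iff_of_nonneg (fun x => hf.nonneg _) ((hf.sec y).integrable _)).1 h0
    rw [Filter.EventuallyEq, ae_iff] at hz
    have : volume (Ioo a b) ≤ 0 := by
      rw [← hz]
      apply measure_mono
      intro x hx
      have : f (Fin.cons x y) ≠ 0 := interior_subset (hmem x hx)
      exact this
    rw [Real.volume_Ioo] at this
    simp at this; linarith
  set F : ℝ → ℝ := fun x => f ((1 + ε)⁻¹ • (Fin.cons x y : Fin (m+1) → ℝ)) with hF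
  set Cc := 2 * μ / ε * (M / δ) ^ ε with hCc
  have hCp : 0 < Cc := by positivity
  have small : ∀ η' > 0, ∀ᶠ s in nhdsWithin (0:ℝ) (Ioi 0), Cc * (s * M) ≤ η' := by
    intro η' h'
    have : Continuous (fun s : ℝ => Cc * (s * M)) := by fun_prop
    have := (this.tendsto 0).mono_left (nhdsWithin_le_nhds (s := Ioi 0))
    simp only [zero_mul, mul_zero] at this
    filter_upwards [this.eventually_lt_const h'] with s hs using hs.le
  have lim := Clim (fun k x => f (Fin.cons x (rdv k (Fin.tail c) y))) (fun x => f (Fin.cons x y))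
    (fun k => hf.sec _) M a b (Cc * ∫ x in Iio a, F x) (Cc * ∫ x in Ioi b, F x) (c 0)
    (fun k x => hM _) hab
    (fun x hx => ((hf.continuousAt (hmem x hx)).tendsto).comp (limc x))
    (fun x hx => hf.pos_of (interior_subset (hmem x hx)))
    (fun x hx => zev x (by simp [hx])) (fun x hx => zev x (by simp [hx]))
    (by
      intro η' h'
      filter_upwards [small η' h', self_mem_nhdsWithin] with s hs hs0
      have hs0 : 0 < s := hs0
      have := layer_int hf hM hδ hμ hε hp hn (a + s) y (Icc (a + s - ε / (2 * μ)) (a + s))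
        measurableSet_Icc (by rw [Real.volume_Icc]; congr 1; ring)
        (by rintro x ⟨h1, h2⟩; rw [abs_le]; constructor <;> [linarith; skip]
            have : 0 < ε / (2 * μ) := by positivity
            linarith)
        (Iio a) (Icc a (a + s)) measurableSet_Icc measurableSet_Iio
        (by rintro x ⟨h1, h2⟩
            rcases lt_or_ge x a with h | h
            · exact Or.inl h
            · exact Or.inr ⟨h, h2⟩) s hs0.le (by rw [Real.volume_Icc]; congr 1; ring)
      rw [mul_add] at this
      linarith)
    (by
      intro η' h'
      filter_upwards [small η' h', self_mem_nhdsWithin] with s hs hs0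
      have hs0 : 0 < s := hs0
      have := layer_int hf hM hδ hμ hε hp hn (b - s) y (Icc (b - s) (b - s + ε / (2 * μ)))
        measurableSet_Icc (by rw [Real.volume_Icc]; congr 1; ring)
        (by rintro x ⟨h1, h2⟩; rw [abs_le]; constructor <;> [skip; linarith]
            have : 0 < ε / (2 * μ) := by positivity
            linarith)
        (Ioi b) (Icc (b - s) b) measurableSet_Icc measurableSet_Ioi
        (by rintro x ⟨h1, h2⟩
            rcases lt_or_ge b x with h | h
            · exact Or.inl h
            · exact Or.inr ⟨h1, h⟩) s hs0.le (by rw [Real.volume_Icc]; congr 1; ring)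
      rw [mul_add] at this
      linarith)
    η hη
  filter_upwards [lim] with k hk
  refine hk.trans ?_
  have hθ : 0 < 1 + ε := by linarith
  have htau : (∫ x in Iio a, F x) + (∫ x in Ioi b, F x) ≤ tauI f (1 + ε) y := by
    have hFm : Measurable F := hf.meas.comp ((measurable_const_smul _).comp
      (measurable_cons.comp (measurable_id.prodMk measurable_const)))
    obtain ⟨R, hR0, hR⟩ := hf.exists_rad
    have hFs : ∀ x, F x ≠ 0 → ‖x‖ ≤ (1 + ε) * R := by
      intro x hx
      have := hR _ hx
      rw [norm_smul, norm_inv, Real.norm_of_nonneg hθ.le, inv_mul_le_iff₀ hθ] at this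
      exact ((norm_cons_le x y _ (by positivity)).1 this).1
    have hFi : Integrable F :=
      integ_of _ hFm M _ (fun y => by rw [abs_of_nonneg (hf.nonneg _)]; exact hM _) hFs
    rw [← setIntegral_union (by
        rw [Set.disjoint_left]; intro x h1 h2
        simp only [mem_Iio, mem_Ioi] at h1 h2; linarith) measurableSet_Ioi hFi.integrableOn
        hFi.integrableOn,
      ← integral_indicator (measurableSet_Iio.union measurableSet_Ioi)]
    unfold tauI
    refine integral_mono (hFi.indicator (measurableSet_Iio.union measurableSet_Ioi)) ?_ ?_
    · refine integ_of _ (Measurable.ite ((hf.sec y).meas (measurableSet_singleton 0)) hFm measurable_const)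
        M ((1 + ε) * R) ?_ ?_
      · intro x
        split_ifs
        · rw [abs_of_nonneg (hf.nonneg _)]; exact hM _
        · simp [hM0.le]
      · intro x hx
        apply hFs
        intro h; apply hx; simp only [hF] at h; simp [h]
    · intro x
      by_cases hx : x ∈ Iio a ∪ Ioi b
      · rw [indicator_of_mem hx]
        have : f (Fin.cons x y) = 0 := zpt x (by
          rintro ⟨h1, h2⟩
          rcases hx with h | h
          · exact absurd h (not_lt.2 h1)
          · exact absurd h (not_lt.2 h2))
        simp [this, hF]
      · rw [indicator_of_notMem hx]
        dsimp
        split_ifs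
        · exact hf.nonneg _
        · exact le_rfl
  have := mul_le_mul_of_nonneg_left htau hCp.le
  have e : μ / ε * (M / δ) ^ ε = Cc / 2 := by rw [hCc]; ring
  rw [e]
  linarith


theorem stepD {m : ℕ} {f : (Fin (m+1) → ℝ) → ℝ} (hf : LC f) {M δ μ ε : ℝ}
    (hM : ∀ y, f y ≤ M) (hδ : 0 < δ) (hμ : 0 < μ) (hε : 0 < ε)
    (hp : δ ≤ f (Fin.cons (1 / (2 * μ)) 0)) (hn : δ ≤ f (Fin.cons (-(1 / (2 * μ))) 0))
    (hint : (interior {z | f z ≠ 0}).Nonempty)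
    (c : Fin (m+1) → ℝ) (η : ℝ) (hη : 0 < η) :
    ∀ᶠ k : ℕ in atTop, (k:ℝ) * (Ak k c f - Ak k (Fin.tail c) (marg f))
      ≤ μ / ε * (M / δ) ^ ε * Tf f (1 + ε) + η := by
  have hM0 : 0 < M := hδ.trans_le (hp.trans (hM _))
  have hθ : 0 < 1 + ε := by linarith
  obtain ⟨R, hR0, hR⟩ := hf.exists_rad
  set e : ℕ → (Fin m → ℝ) → ℝ := fun k y =>
    (k:ℝ) * ((∫ x, f (Fin.cons (rd k (c 0) x) (rdv k (Fin.tail c) y)))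
        - ∫ x, f (Fin.cons x (rdv k (Fin.tail c) y))) with he
  set C := μ / ε * (M / δ) ^ ε with hC
  have hC0 : 0 ≤ C := by positivity
  set g : (Fin m → ℝ) → ℝ := fun y => C * (if marg f y = 0 then 0 else tauI f (1 + ε) y) with hg
  have gi : Integrable g := (Tf_int hf hθ).const_mul C
  have gn : ∀ y, 0 ≤ g y := by
    intro y
    apply mul_nonneg hC0
    split_ifs
    · exact le_rfl
    · exact tauI_nonneg hf _ _
  have i1 : ∀ k : ℕ, 0 < k → Integrable (fun y : Fin m → ℝ =>
      ∫ x, f (Fin.cons (rd k (c 0) x) (rdv k (Fin.tail c) y))) := by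
    intro k hk
    have := integrable_cons _ (hf.integrable_rdv hk c)
    simpa only [rdv_cons] using this
  have i2 : ∀ k : ℕ, 0 < k → Integrable (fun y : Fin m → ℝ =>
      ∫ x, f (Fin.cons x (rdv k (Fin.tail c) y))) := by
    intro k hk
    exact hf.marg.integrable_rdv hk (Fin.tail c)
  have ei : ∀ k : ℕ, 0 < k → Integrable (e k) := by
    intro k hk
    exact ((i1 k hk).sub (i2 k hk)).const_mul _
  have eint : ∀ k : ℕ, 0 < k → ∫ y, e k y = (k:ℝ) * (Ak k c f - Ak k (Fin.tail c) (marg f)) := by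
    intro k hk
    simp only [he]
    rw [integral_const_mul, integral_sub (i1 k hk) (i2 k hk)]
    congr 2
    unfold Ak
    rw [integral_cons _ (hf.integrable_rdv hk c)]
    simp only [rdv_cons]
  have eM : ∀ k : ℕ, 0 < k → ∀ y, e k y ≤ M := by
    intro k hk y
    exact cell_bound (hf.sec (rdv k (Fin.tail c) y)) hk (c 0) M (fun x => hM _)
  have e0 : ∀ k : ℕ, ∀ y, (∀ x, f (Fin.cons x (rdv k (Fin.tail c) y)) = 0) → e k y = 0 := by
    intro k y h
    simp only [he, h]; simp
  have e0' : ∀ k : ℕ, 0 < k → ∀ y, ¬ ‖y‖ ≤ R + 1 → e k y = 0 := by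
    intro k hk y hy
    apply e0
    intro x
    by_contra h
    exact hy (rdv_supp hk _ y R ((norm_cons_le _ _ _ hR0.le).1 (hR _ h)).2)
  -- a.e. limit
  set O : Set (Fin m → ℝ) := {y | ∃ x, (Fin.cons x y : Fin (m+1) → ℝ) ∈ interior {z | f z ≠ 0}} with hO
  have Oc : Convex ℝ O := by
    rintro y ⟨x, hx⟩ y' ⟨x', hx'⟩ s t hs ht hst
    refine ⟨s * x + t * x', ?_⟩
    rw [cons_comb]
    exact hf.convex.interior hx hx' hs ht hst
  have Oo : IsOpen O := by
    have : O = ⋃ x : ℝ, (fun y => (Fin.cons x y : Fin (m+1) → ℝ)) ⁻¹' interior {z | f z ≠ 0} := by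
      ext y; simp [hO]
    rw [this]
    refine isOpen_iUnion (fun x => isOpen_interior.preimage ?_)
    exact continuous_cons.comp (continuous_const.prodMk continuous_id)
  have Ofr : ∀ᵐ y : Fin m → ℝ, y ∉ frontier O := by
    have := Oc.addHaar_frontier volume
    exact measure_eq_zero_iff_ae_notMem.1 this
  have tailO : ∀ x y, f (Fin.cons x y) ≠ 0 → y ∈ closure O := by
    intro x y h
    have h1 : (Fin.cons x y : Fin (m+1) → ℝ) ∈ closure (interior {z | f z ≠ 0}) := by
      rw [hf.convex.closure_interior_eq_closure_of_nonempty_interior hint]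
      exact subset_closure h
    have := map_mem_closure continuous_tail h1 (t := O) (by
      intro z hz
      refine ⟨z 0, ?_⟩
      simpa [Fin.cons_self_tail] using hz)
    simpa using this
  have lim : ∀ᵐ y : Fin m → ℝ, Tendsto (fun k => max (e k y) (g y)) atTop (nhds (g y)) := by
    filter_upwards [Ofr] with y hy
    rw [tendsto_order]
    constructor
    · intro a' ha'
      exact Eventually.of_forall fun k => lt_max_of_lt_right ha'
    · intro a' ha'
      by_cases hyO : y ∈ O
      · have hpl := point_lim hf hM hδ hμ hε hp hn c y hyO ((a' - g y) / 2) (by linarith)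
        filter_upwards [hpl.2] with k hk
        refine max_lt ?_ ha'
        have e2 : g y = C * tauI f (1 + ε) y := by simp [hg, hpl.1]
        rw [← e2] at hk
        have : e k y ≤ g y + (a' - g y) / 2 := hk
        linarith
      · have hcl : y ∉ closure O := by
          intro h; apply hy; rw [frontier, Oo.interior_eq]; exact ⟨h, hyO⟩
        have hop : IsOpen (closure O)ᶜ := isClosed_closure.isOpen_compl
        filter_upwards [(rdv_tendsto (Fin.tail c) y).eventually (hop.mem_nhds hcl)] with k hk
        refine max_lt ?_ ha'
        rw [e0 k y]
        · exact (gn y).trans_lt ha'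
        · intro x; by_contra h; exact hk (tailO _ _ h)
  have hball : Integrable (fun y : Fin m → ℝ => (Metric.closedBall 0 (R+1)).indicator (fun _ => M) y) := by
    refine (integrable_indicator_iff Metric.isClosed_closedBall.measurableSet).2 ?_
    exact integrableOn_const (isCompact_closedBall _ _).measure_lt_top.ne
  have DC := tendsto_integral_filter_of_dominated_convergence (μ := volume) (l := atTop)
    (F := fun k y => max (e k y) (g y)) (f := g)
    (fun y => g y + (Metric.closedBall 0 (R+1)).indicator (fun _ => M) y)
    (by
      filter_upwards [eventually_gt_atTop 0] with k hk
      exact ((ei k hk).sup gi).aestronglyMeasurable)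
    (by
      filter_upwards [eventually_gt_atTop 0] with k hk
      refine Eventually.of_forall fun y => ?_
      rw [Real.norm_of_nonneg (le_max_of_le_right (gn y))]
      have n := indicator_nonneg (s := Metric.closedBall (0 : Fin m → ℝ) (R+1)) (f := fun _ => M)
        (fun _ _ => hM0.le) y
      refine max_le ?_ (by linarith)
      by_cases hy : ‖y‖ ≤ R + 1
      · rw [indicator_of_mem (by simpa using hy)]
        linarith [eM k hk y, gn y]
      · rw [e0' k hk y hy]
        linarith [gn y])
    (gi.add hball) lim
  have hgT : ∫ y, g y = C * Tf f (1 + ε) := by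
    simp only [hg]; rw [integral_const_mul]; rfl
  rw [hgT] at DC
  filter_upwards [DC.eventually_lt_const (show C * Tf f (1 + ε) < C * Tf f (1 + ε) + η by linarith),
    eventually_gt_atTop 0] with k hk hk0
  rw [← eint k hk0]
  refine le_trans (integral_mono (ei k hk0) ((ei k hk0).sup gi) fun y => ?_) hk.le
  exact le_max_left _ _


/-- centered -/
def Cen {m : ℕ} (f : (Fin m → ℝ) → ℝ) : Prop := ∀ i, ∫ y, y i * f y = 0

theorem coord_int {m : ℕ} {f : (Fin m → ℝ) → ℝ} (hf : LC f) (i : Fin m) :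
    Integrable (fun y => y i * f y) := by
  obtain ⟨M, hM0, hM⟩ := hf.exists_bound
  obtain ⟨R, hR0, hR⟩ := hf.exists_rad
  refine integ_of _ ((measurable_pi_apply i).mul hf.meas) (R * M) R ?_ ?_
  · intro y
    by_cases hy : f y = 0
    · simp [hy]; positivity
    · rw [abs_mul, abs_of_nonneg (hf.nonneg y)]
      have : |y i| ≤ R := (norm_le_pi_norm y i).trans (hR y hy)
      exact mul_le_mul this (hM y) (hf.nonneg y) hR0.le
  · intro y hy
    exact hR y (right_ne_zero_of_mul hy)

theorem Cen.marg {m : ℕ} {f : (Fin (m+1) → ℝ) → ℝ} (hf : LC f) (hc : Cen f) : Cen (marg f) := by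
  intro j
  have h := hc j.succ
  rw [integral_cons _ (coord_int hf _)] at h
  rw [← h]
  refine integral_congr_ae (Eventually.of_forall fun y => ?_)
  simp only [Fin.cons_succ]
  rw [integral_const_mul]; rfl

theorem supergrad {m : ℕ} {f : (Fin m → ℝ) → ℝ} (hf : LC f) (h0 : 0 ∈ interior {z | f z ≠ 0}) :
    ∃ q : (Fin m → ℝ) →L[ℝ] ℝ, ∀ y ∈ interior {z | f z ≠ 0}, f y ≤ f 0 * Real.exp (q y) := by
  set U := interior {z | f z ≠ 0} with hU
  have hpos : ∀ y ∈ U, 0 < f y := fun y hy => hf.pos_of (interior_subset hy)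
  set A : Set ((Fin m → ℝ) × ℝ) := {p | p.1 ∈ U ∧ Real.exp p.2 < f p.1} with hA
  have Ao : IsOpen A := by
    rw [isOpen_iff_mem_nhds]
    rintro ⟨y, t⟩ ⟨hy, ht⟩
    have c1 : ContinuousAt (fun p : (Fin m → ℝ) × ℝ => f p.1) (y, t) :=
      ContinuousAt.comp (hf.continuousAt hy) continuousAt_fst
    have c2 : ContinuousAt (fun p : (Fin m → ℝ) × ℝ => Real.exp p.2) (y, t) := by fun_prop
    have c3 : ∀ᶠ p : (Fin m → ℝ) × ℝ in nhds (y, t), p.1 ∈ U :=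
      continuousAt_fst.eventually (isOpen_interior.mem_nhds hy)
    filter_upwards [c3, c2.tendsto.eventually_lt c1.tendsto ht] with p h1 h2
    exact ⟨h1, h2⟩
  have Ac : Convex ℝ A := by
    rintro ⟨y, t⟩ ⟨hy, ht⟩ ⟨y', t'⟩ ⟨hy', ht'⟩ s r hs hr hsr
    refine ⟨hf.convex.interior hy hy' hs hr hsr, ?_⟩
    simp only [Prod.smul_mk, Prod.mk_add_mk, smul_eq_mul] at *
    rcases hs.eq_or_lt with rfl | hs
    · have : r = 1 := by linarith
      subst this; simpa using ht'
    rcases hr.eq_or_lt with rfl | hr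
    · have : s = 1 := by linarith
      subst this; simpa using ht
    refine lt_of_lt_of_le ?_ (hf.lc y y' s r hs hr hsr)
    have e : Real.exp (s * t + r * t') = Real.exp t ^ s * Real.exp t' ^ r := by
      rw [← Real.exp_mul, ← Real.exp_mul, ← Real.exp_add]; ring_nf
    rw [e]
    apply mul_lt_mul'' (Real.rpow_lt_rpow (Real.exp_pos _).le ht hs)
      (Real.rpow_lt_rpow (Real.exp_pos _).le ht' hr) (by positivity) (by positivity)
  have hf0 := hpos 0 h0
  have hx : ((0 : Fin m → ℝ), Real.log (f 0)) ∉ A := by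
    rintro ⟨_, h⟩
    simp only at h
    rw [Real.exp_log hf0] at h; exact lt_irrefl _ h
  obtain ⟨F, hF⟩ := geometric_hahn_banach_open_point Ac Ao hx
  set β := F (0, 1) with hβ
  have dec : ∀ y t, F (y, t) = F (y, 0) + t * β := by
    intro y t
    have : ((y, t) : (Fin m → ℝ) × ℝ) = (y, 0) + t • ((0 : Fin m → ℝ), (1:ℝ)) := by simp
    rw [this, map_add, map_smul, smul_eq_mul]
  have hβp : 0 < β := by
    have := hF (0, Real.log (f 0) - 1) ⟨h0, by
      simp only; rw [Real.exp_sub, Real.exp_log hf0]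
      apply div_lt_self hf0
      have := Real.add_one_lt_exp (x := 1) one_ne_zero
      linarith⟩
    rw [dec, dec 0 (Real.log (f 0))] at this
    nlinarith
  refine ⟨(-β⁻¹) • (F.comp (ContinuousLinearMap.inl ℝ _ _)), ?_⟩
  intro y hy
  have hfy := hpos y hy
  have key : Real.log (f y) ≤ Real.log (f 0) - β⁻¹ * F (y, 0) := by
    apply le_of_forall_lt
    intro t ht
    have := hF (y, t) ⟨hy, by simp only; rw [← Real.lt_log_iff_exp_lt hfy]; exact ht⟩
    rw [dec, dec 0 (Real.log (f 0))] at this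
    have z : F ((0 : Fin m → ℝ), (0:ℝ)) = 0 := by
      have : ((0 : Fin m → ℝ), (0:ℝ)) = 0 := rfl
      rw [this, map_zero]
    rw [z] at this
    have e : β⁻¹ * (F (y, 0) + t * β) < β⁻¹ * (0 + Real.log (f 0) * β) :=
      mul_lt_mul_of_pos_left this (by positivity)
    have e1 : β⁻¹ * (F (y, 0) + t * β) = β⁻¹ * F (y, 0) + t := by field_simp
    have e2 : β⁻¹ * (0 + Real.log (f 0) * β) = Real.log (f 0) := by field_simp; ring
    linarith
  have : f y = Real.exp (Real.log (f y)) := (Real.exp_log hfy).symm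
  rw [this]
  conv_rhs => rw [← Real.exp_log hf0]
  rw [← Real.exp_add]
  apply Real.exp_le_exp.2
  simp
  linarith

theorem SCC {m : ℕ} {f : (Fin m → ℝ) → ℝ} (hf : LC f) (hc : Cen f)
    (h0 : 0 ∈ interior {z | f z ≠ 0}) {ε : ℝ} (hε : 0 < ε) :
    Wf f (1 + ε) ≤ ((1 + ε) ^ m - 1) * ∫ y, f y := by
  obtain ⟨q, hq⟩ := supergrad hf h0
  have hθ : 0 < 1 + ε := by linarith
  set κ := ε / (1 + ε) with hκ
  have hκ0 : 0 < κ := by positivity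
  have e2 : (1 + ε)⁻¹ = 1 - κ := by rw [hκ]; field_simp; ring
  have i1 : Integrable (fun y : Fin m → ℝ => f ((1 + ε)⁻¹ • y)) :=
    (hf.integrable volume).comp_smul (by positivity)
  have I1 : ∫ y : Fin m → ℝ, f ((1 + ε)⁻¹ • y) = (1 + ε) ^ m * ∫ y, f y := by
    rw [Measure.integral_comp_smul]
    simp only [Module.finrank_fintype_fun_eq_card, Fintype.card_fin, inv_pow, inv_inv, smul_eq_mul]
    rw [abs_of_pos (by positivity)]
  have qexp : ∀ y, q y = ∑ i, y i * q (Pi.single i 1) := by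
    intro y
    conv_lhs => rw [pi_eq_sum_univ' y]
    rw [map_sum]
    refine Finset.sum_congr rfl fun i _ => ?_
    rw [map_smul, smul_eq_mul]
  have iq : Integrable (fun y => q y * f y) := by
    have : (fun y => q y * f y) = fun y => ∑ i, q (Pi.single i 1) * (y i * f y) := by
      funext y; rw [qexp, Finset.sum_mul]
      refine Finset.sum_congr rfl fun i _ => by ring
    rw [this]
    exact integrable_finsetSum _ fun i _ => (coord_int hf i).const_mul _
  have Iq : ∫ y, q y * f y = 0 := by
    have : (fun y => q y * f y) = fun y => ∑ i, q (Pi.single i 1) * (y i * f y) := by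
      funext y; rw [qexp, Finset.sum_mul]
      refine Finset.sum_congr rfl fun i _ => by ring
    rw [this, integral_finsetSum _ fun i _ => (coord_int hf i).const_mul _]
    refine Finset.sum_eq_zero fun i _ => ?_
    rw [integral_const_mul, hc i, mul_zero]
  have hfr : ∀ᵐ y : Fin m → ℝ, y ∉ frontier {z | f z ≠ 0} :=
    measure_eq_zero_iff_ae_notMem.1 (hf.convex.addHaar_frontier volume)
  have key : ∫ y, (f y - κ * (q y * f y)) ≤
      ∫ y, (f ((1 + ε)⁻¹ • y) - if f y = 0 then f ((1 + ε)⁻¹ • y) else 0) := by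
    refine integral_mono_ae ((hf.integrable volume).sub (iq.const_mul κ)) (i1.sub (wI_int hf hθ)) ?_
    filter_upwards [hfr] with y hy
    by_cases hz : f y = 0
    · simp [hz]
    · simp only [hz, if_false, sub_zero]
      have hyU : y ∈ interior {z | f z ≠ 0} := by
        by_contra h
        exact hy ⟨subset_closure hz, h⟩
      have hfy := hf.pos_of hz
      have hl := hf.lc y 0 ((1 + ε)⁻¹) κ (by positivity) hκ0 (by rw [e2]; ring)
      rw [smul_zero, add_zero] at hl
      refine le_trans ?_ hl
      have hf0 : f y * Real.exp (-q y) ≤ f 0 := by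
        rw [Real.exp_neg, ← div_eq_mul_inv, div_le_iff₀ (Real.exp_pos _)]; exact hq y hyU
      have h5 : f y * Real.exp (-(κ * q y)) ≤ f y ^ (1 + ε)⁻¹ * f 0 ^ κ := by
        calc f y * Real.exp (-(κ * q y)) = f y ^ (1 + ε)⁻¹ * (f y * Real.exp (-q y)) ^ κ := by
              rw [Real.mul_rpow hfy.le (Real.exp_pos _).le, ← mul_assoc, ← Real.rpow_add hfy, e2,
                ← Real.exp_mul]
              simp; left; ring
          _ ≤ _ := by gcongr
      refine le_trans ?_ h5
      have := Real.add_one_le_exp (-(κ * q y))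
      nlinarith
  rw [integral_sub (hf.integrable volume) (iq.const_mul κ), integral_const_mul, Iq,
    integral_sub i1 (wI_int hf hθ), I1] at key
  unfold Wf
  linarith

theorem tail_int {m : ℕ} {f : (Fin (m+1) → ℝ) → ℝ} (hf : LC f) {z : Fin (m+1) → ℝ}
    (hz : z ∈ interior {z | f z ≠ 0}) : Fin.tail z ∈ interior {y | marg f y ≠ 0} := by
  set U := interior {z | f z ≠ 0} with hU
  rw [mem_interior]
  refine ⟨⋃ x : ℝ, (fun y => (Fin.cons x y : Fin (m+1) → ℝ)) ⁻¹' U, ?_, ?_, ?_⟩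
  · intro y hy
    obtain ⟨x, hx⟩ := mem_iUnion.1 hy
    intro h0
    have hzz : (fun x : ℝ => f (Fin.cons x y)) =ᵐ[volume] 0 :=
      (integral_eq_zero_iff_of_nonneg (fun x => hf.nonneg _) ((hf.sec y).integrable _)).1 h0
    rw [Filter.EventuallyEq, ae_iff] at hzz
    have ho : IsOpen ((fun x : ℝ => (Fin.cons x y : Fin (m+1) → ℝ)) ⁻¹' U) :=
      isOpen_interior.preimage (continuous_cons.comp (continuous_id.prodMk continuous_const))
    have hpos := ho.measure_pos volume ⟨x, hx⟩
    have : volume ((fun x : ℝ => (Fin.cons x y : Fin (m+1) → ℝ)) ⁻¹' U) ≤ 0 := by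
      rw [← hzz]
      apply measure_mono
      intro w hw
      have : f (Fin.cons w y) ≠ 0 := interior_subset hw
      exact this
    exact absurd hpos (not_lt.2 this)
  · refine isOpen_iUnion (fun x => isOpen_interior.preimage ?_)
    exact continuous_cons.comp (continuous_const.prodMk continuous_id)
  · refine mem_iUnion.2 ⟨z 0, ?_⟩
    simpa [Fin.cons_self_tail] using hz

/-- triangular points condition -/
def Cond {m : ℕ} (f : (Fin m → ℝ) → ℝ) (μ : ℕ → ℝ) : Prop :=
  ∀ j : Fin m, (∃ p ∈ interior {z | f z ≠ 0}, p j = 1 / (2 * μ j) ∧ ∀ i, j < i → p i = 0) ∧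
    (∃ p ∈ interior {z | f z ≠ 0}, p j = -(1 / (2 * μ j)) ∧ ∀ i, j < i → p i = 0)

theorem Cond.marg {m : ℕ} {f : (Fin (m+1) → ℝ) → ℝ} (hf : LC f) {μ : ℕ → ℝ} (h : Cond f μ) :
    Cond (marg f) (fun j => μ (j + 1)) := by
  intro j
  obtain ⟨⟨p, hp, hp1, hp2⟩, ⟨r, hr, hr1, hr2⟩⟩ := h j.succ
  refine ⟨⟨Fin.tail p, tail_int hf hp, ?_, ?_⟩, ⟨Fin.tail r, tail_int hf hr, ?_, ?_⟩⟩
  · simpa [Fin.tail] using hp1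
  · intro i hi; exact hp2 i.succ (by simpa using hi)
  · simpa [Fin.tail] using hr1
  · intro i hi; exact hr2 i.succ (by simpa using hi)

theorem mainG (m : ℕ) : ∀ (f : (Fin m → ℝ) → ℝ), LC f → Cen f → 0 ∈ interior {z | f z ≠ 0} →
    ∀ (μ : ℕ → ℝ), (∀ j, 0 < μ j) → Monotone μ → Cond f μ → ∀ c : Fin m → ℝ,
    ∃ Q : ℝ, 1 ≤ Q ∧ ∀ ε : ℝ, 0 < ε → ∃ X : ℝ, 0 ≤ X ∧
      X ≤ μ 0 * (Wf f (1 + ε) - ((1 + ε) ^ m - 1) * ∫ y, f y)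
        + ∑ j ∈ Finset.range m, μ j * ((((1 + ε) ^ (m - j) - 1) * ∫ y, f y)
            - (((1 + ε) ^ (m - j - 1) - 1) * ∫ y, f y)) ∧
      ∀ η > 0, ∀ᶠ k : ℕ in atTop, (k:ℝ) * (Ak k c f - ∫ y, f y) ≤ Q ^ ε / ε * X + η := by
  induction m with
  | zero =>
    intro f hf hc h0 μ hμ hmono hcond c
    refine ⟨1, le_rfl, fun ε hε => ⟨0, le_rfl, ?_, ?_⟩⟩
    · have : Wf f (1 + ε) = 0 := by
        unfold Wf
        have : (fun y : Fin 0 → ℝ => if f y = 0 then f ((1 + ε)⁻¹ • y) else 0) = fun _ => 0 := by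
          funext y
          rw [Subsingleton.elim ((1 + ε)⁻¹ • y) y]
          split_ifs with h
          · exact h
          · rfl
        rw [this]; simp
      simp [this]
    · intro η hη
      refine Eventually.of_forall fun k => ?_
      have : Ak k c f = ∫ y, f y := by
        unfold Ak
        congr 1; funext y
        rw [Subsingleton.elim (rdv k c y) y]
      rw [this]; simp; exact hη.le
  | succ m ih =>
    intro f hf hc h0 μ hμ hmono hcond c
    obtain ⟨Q', hQ', H⟩ := ih (marg f) hf.marg (hc.marg hf) (tail_int hf h0) (fun j => μ (j+1))
      (fun j => hμ _) (fun i j h => hmono (by omega)) (hcond.marg hf) (Fin.tail c)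
    obtain ⟨M, hM0, hM⟩ := hf.exists_bound
    obtain ⟨⟨p, hp, hp1, hp2⟩, ⟨r, hr, hr1, hr2⟩⟩ := hcond 0
    have ep : p = Fin.cons (1 / (2 * μ 0)) 0 := by
      ext i
      refine Fin.cases ?_ (fun j => ?_) i
      · simpa using hp1
      · simpa using hp2 j.succ (Fin.succ_pos j)
    have er : r = Fin.cons (-(1 / (2 * μ 0))) 0 := by
      ext i
      refine Fin.cases ?_ (fun j => ?_) i
      · simpa using hr1
      · simpa using hr2 j.succ (Fin.succ_pos j)
    rw [ep] at hp
    rw [er] at hr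
    have fp := hf.pos_of (interior_subset hp)
    have fr := hf.pos_of (interior_subset hr)
    set δ := min (f (Fin.cons (1 / (2 * μ 0)) 0)) (f (Fin.cons (-(1 / (2 * μ 0))) 0)) with hδ
    have hδ0 : 0 < δ := lt_min fp fr
    have hQ0 : 1 ≤ M / δ := by
      rw [le_div_iff₀ hδ0, one_mul]
      exact (min_le_left _ _).trans (hM _)
    refine ⟨max (M / δ) Q', le_max_of_le_left hQ0, fun ε hε => ?_⟩
    obtain ⟨X', hX0, hXle, hX⟩ := H ε hε
    have hT0 : 0 ≤ Tf f (1 + ε) := by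
      apply integral_nonneg
      intro y
      dsimp
      split_ifs
      · exact le_rfl
      · exact tauI_nonneg hf _ _
    have hTW := W_rec hf (show 1 ≤ 1 + ε by linarith)
    have hscc := SCC hf.marg (hc.marg hf) (tail_int hf h0) hε
    have hμ0 := hμ 0
    have hμ01 : μ 0 ≤ μ (0 + 1) := hmono (by omega)
    rw [hf.integral_marg] at hXle hscc hX
    refine ⟨μ 0 * Tf f (1 + ε) + X', by positivity, ?_, ?_⟩
    · rw [Finset.sum_range_succ']
      simp only [Nat.add_sub_add_right, Nat.sub_zero, Nat.add_sub_cancel]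
      have t1 : μ 0 * Tf f (1 + ε) ≤ μ 0 * (Wf f (1 + ε) - Wf (marg f) (1 + ε)) :=
        mul_le_mul_of_nonneg_left hTW hμ0.le
      have t2 : μ (0 + 1) * (Wf (marg f) (1 + ε) - ((1 + ε) ^ m - 1) * ∫ y, f y)
          ≤ μ 0 * (Wf (marg f) (1 + ε) - ((1 + ε) ^ m - 1) * ∫ y, f y) :=
        mul_le_mul_of_nonpos_right hμ01 (by linarith)
      linarith
    · intro η hη
      have s1 := stepD hf hM hδ0 hμ0 hε (min_le_left _ _) (min_le_right _ _) ⟨0, h0⟩ c (η/2)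
        (by linarith)
      filter_upwards [s1, hX (η/2) (by linarith)] with k k1 k2
      set Q := max (M / δ) Q' with hQ
      have q1 : (M / δ) ^ ε ≤ Q ^ ε := Real.rpow_le_rpow (by positivity) (le_max_left _ _) hε.le
      have q2 : Q' ^ ε ≤ Q ^ ε := Real.rpow_le_rpow (by linarith) (le_max_right _ _) hε.le
      have r1 : μ 0 / ε * (M / δ) ^ ε * Tf f (1 + ε) ≤ μ 0 / ε * Q ^ ε * Tf f (1 + ε) := by
        gcongr
      have r2 : Q' ^ ε / ε * X' ≤ Q ^ ε / ε * X' := by gcongr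
      have e : Q ^ ε / ε * (μ 0 * Tf f (1 + ε) + X')
          = μ 0 / ε * Q ^ ε * Tf f (1 + ε) + Q ^ ε / ε * X' := by ring
      rw [e]
      linarith

theorem mainG' {m : ℕ} {f : (Fin m → ℝ) → ℝ} (hf : LC f) (hc : Cen f)
    (h0 : 0 ∈ interior {z | f z ≠ 0}) {μ : ℕ → ℝ} (hμ : ∀ j, 0 < μ j) (hmono : Monotone μ)
    (hcond : Cond f μ) (c : Fin m → ℝ) (η : ℝ) (hη : 0 < η) :
    ∀ᶠ k : ℕ in atTop, (k:ℝ) * (Ak k c f - ∫ y, f y)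
      ≤ (∑ j ∈ Finset.range m, μ j) * (∫ y, f y) + η := by
  obtain ⟨Q, hQ, H⟩ := mainG m f hf hc h0 μ hμ hmono hcond c
  set V := ∫ y, f y with hV
  have hV0 : 0 ≤ V := integral_nonneg hf.nonneg
  set S := ∑ j ∈ Finset.range m, μ j with hS
  have hS0 : 0 ≤ S := Finset.sum_nonneg fun j _ => (hμ j).le
  have tend : Tendsto (fun ε : ℝ => Q ^ ε * ((1 + ε) ^ m * (S * V))) (nhdsWithin 0 (Ioi 0))
      (nhds (S * V)) := by
    have hcont : Continuous (fun ε : ℝ => Q ^ ε * ((1 + ε) ^ m * (S * V))) := by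
      have : Continuous (fun ε : ℝ => Q ^ ε) := Real.continuous_const_rpow (by linarith)
      fun_prop
    have := (hcont.tendsto 0).mono_left (nhdsWithin_le_nhds (s := Ioi 0))
    simpa using this
  obtain ⟨ε, h1, hε⟩ := ((tend.eventually_lt_const (show S * V < S * V + η / 2 by linarith)).and
    self_mem_nhdsWithin).exists
  have hε : 0 < ε := hε
  obtain ⟨X, hX0, hXle, hX⟩ := H ε hε
  filter_upwards [hX (η/2) (by linarith)] with k hk
  refine hk.trans ?_
  have hscc := SCC hf hc h0 hε
  have hX2 : X ≤ ε * ((1 + ε) ^ m * (S * V)) := by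
    have t1 : μ 0 * (Wf f (1 + ε) - ((1 + ε) ^ m - 1) * V) ≤ 0 :=
      mul_nonpos_of_nonneg_of_nonpos (hμ 0).le (by linarith)
    have t2 : ∑ j ∈ Finset.range m, μ j * ((((1 + ε) ^ (m - j) - 1) * V)
            - (((1 + ε) ^ (m - j - 1) - 1) * V)) ≤ ∑ j ∈ Finset.range m, μ j * (ε * (1 + ε) ^ m * V) := by
      refine Finset.sum_le_sum fun j hj => ?_
      rw [Finset.mem_range] at hj
      apply mul_le_mul_of_nonneg_left _ (hμ j).le
      obtain ⟨l, hl⟩ : ∃ l, m - j = l + 1 := ⟨m - j - 1, by omega⟩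
      rw [hl, Nat.add_sub_cancel, ← sub_mul]
      apply mul_le_mul_of_nonneg_right _ hV0
      have e : (1 + ε) ^ (l + 1) - 1 - ((1 + ε) ^ l - 1) = ε * (1 + ε) ^ l := by ring
      rw [e]
      apply mul_le_mul_of_nonneg_left _ hε.le
      exact pow_le_pow_right₀ (by linarith) (by omega)
    rw [← Finset.sum_mul] at t2
    have e : S * (ε * (1 + ε) ^ m * V) = ε * ((1 + ε) ^ m * (S * V)) := by ring
    linarith
  have : Q ^ ε / ε * X ≤ Q ^ ε / ε * (ε * ((1 + ε) ^ m * (S * V))) := by gcongr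
  have e : Q ^ ε / ε * (ε * ((1 + ε) ^ m * (S * V))) = Q ^ ε * ((1 + ε) ^ m * (S * V)) := by
    field_simp
  linarith


/-- indicator function of a set -/
def ind {E : Type*} (K : Set E) : E → ℝ := K.indicator (fun _ => 1)

theorem ind_supp {E : Type*} (K : Set E) : {z | ind K z ≠ 0} = K := by
  ext z; simp [ind]

theorem ind_LC {m : ℕ} {K : Set (Fin m → ℝ)} (hc : Convex ℝ K) (hk : IsCompact K) : LC (ind K) where
  meas := measurable_const.indicator hk.isClosed.measurableSet
  nonneg := fun y => by unfold ind; exact indicator_nonneg (fun _ _ => zero_le_one) _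
  bdd := ⟨1, fun y => by classical unfold ind; rw [indicator_apply]; split_ifs <;> norm_num⟩
  supp := by
    obtain ⟨R, hR⟩ := hk.isBounded.exists_norm_le
    refine ⟨R, fun y hy => hR y ?_⟩
    have : y ∈ {z | ind K z ≠ 0} := hy
    rwa [ind_supp] at this
  lc := by
    classical
    intro x y s t hs ht hst
    unfold ind
    simp only [indicator_apply]
    by_cases hx : x ∈ K
    · by_cases hy : y ∈ K
      · have := hc hx hy hs.le ht.le hst
        simp [hx, hy, this]
      · simp only [hx, hy, if_true, if_false, Real.zero_rpow ht.ne', mul_zero]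
        split_ifs <;> norm_num
    · simp only [hx, if_false, Real.zero_rpow hs.ne', zero_mul]
      split_ifs <;> norm_num

theorem ind_pos {m : ℕ} {K : Set (Fin m → ℝ)} (hc : Convex ℝ K) (hk : IsCompact K)
    (hi : (interior K).Nonempty) : 0 < ∫ y, ind K y := by
  have : ∫ y, ind K y = (volume K).toReal := by
    unfold ind
    rw [integral_indicator hk.isClosed.measurableSet]
    simp [Measure.real]
  rw [this]
  apply ENNReal.toReal_pos
  · have := (isOpen_interior (s := K)).measure_pos (μ := volume) hi
    exact (this.trans_le (measure_mono interior_subset)).ne'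
  · exact hk.measure_lt_top.ne

theorem Cen.lin {m : ℕ} {f : (Fin m → ℝ) → ℝ} (hf : LC f) (hc : Cen f)
    (q : (Fin m → ℝ) →L[ℝ] ℝ) : Integrable (fun y => q y * f y) ∧ ∫ y, q y * f y = 0 := by
  have qexp : ∀ y, q y = ∑ i, y i * q (Pi.single i 1) := by
    intro y
    conv_lhs => rw [pi_eq_sum_univ' y]
    rw [map_sum]
    refine Finset.sum_congr rfl fun i _ => ?_
    rw [map_smul, smul_eq_mul]
  have : (fun y => q y * f y) = fun y => ∑ i, q (Pi.single i 1) * (y i * f y) := by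
    funext y; rw [qexp, Finset.sum_mul]
    refine Finset.sum_congr rfl fun i _ => by ring
  rw [this]
  constructor
  · exact integrable_finsetSum _ fun i _ => (coord_int hf i).const_mul _
  · rw [integral_finsetSum _ fun i _ => (coord_int hf i).const_mul _]
    refine Finset.sum_eq_zero fun i _ => ?_
    rw [integral_const_mul, hc i, mul_zero]

theorem cen_lin {m : ℕ} {K : Set (Fin m → ℝ)} (hc : Convex ℝ K) (hk : IsCompact K)
    (hi : (interior K).Nonempty) (hcen : Cen (ind K)) (q : (Fin m → ℝ) →L[ℝ] ℝ) {M : ℝ}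
    (hM : ∀ x ∈ K, q x ≤ M) {p : Fin m → ℝ} (hp : p ∈ K) : -q p ≤ m * M := by
  have hLC := ind_LC hc hk
  have hV := ind_pos hc hk hi
  set V := ∫ y, ind K y with hVd
  obtain ⟨iq, Iq⟩ := hcen.lin hLC q
  have i0 : Integrable (fun y => ind K y) := hLC.integrable volume
  have key : ∀ s : ℝ, 0 < s → s < 1 → (1 - s) ^ m * (M - s * q p) ≤ M := by
    intro s hs hs1
    set r := 1 - s with hr
    have hr0 : 0 < r := by linarith
    set h : (Fin m → ℝ) → ℝ := fun x => (M - q (p + r • (x - p))) * ind K x with hh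
    have hexp : h = fun x => (M - s * q p) * ind K x - r * (q x * ind K x) := by
      funext x; simp only [hh, map_add, map_smul, map_sub, smul_eq_mul, hr]; ring
    have ih : Integrable h := by
      rw [hexp]; exact (i0.const_mul _).sub (iq.const_mul _)
    have Ih : ∫ x, h x = (M - s * q p) * V := by
      rw [hexp, integral_sub (i0.const_mul _) (iq.const_mul _), integral_const_mul,
        integral_const_mul, Iq]; ring
    have e1 : ∫ y, h (r⁻¹ • y + (p - r⁻¹ • p)) = r ^ m * ((M - s * q p) * V) := by
      rw [Measure.integral_comp_smul (μ := volume) (f := fun y => h (y + (p - r⁻¹ • p))),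
        integral_add_right_eq_self (f := h), Ih]
      simp only [Module.finrank_fintype_fun_eq_card, Fintype.card_fin, inv_pow, inv_inv,
        smul_eq_mul]
      rw [abs_of_pos (by positivity)]
    have i1 : Integrable (fun y => h (r⁻¹ • y + (p - r⁻¹ • p))) :=
      (ih.comp_add_right (p - r⁻¹ • p)).comp_smul (R := r⁻¹) (by positivity)
    have e2 : ∫ y, (M - q y) * ind K y = M * V := by
      have : (fun y => (M - q y) * ind K y) = fun y => M * ind K y - q y * ind K y := by
        funext y; ring
      rw [this, integral_sub (i0.const_mul _) iq, integral_const_mul, Iq]; ring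
    have i2 : Integrable (fun y => (M - q y) * ind K y) := by
      have : (fun y => (M - q y) * ind K y) = fun y => M * ind K y - q y * ind K y := by
        funext y; ring
      rw [this]; exact (i0.const_mul _).sub iq
    have le : ∫ y, h (r⁻¹ • y + (p - r⁻¹ • p)) ≤ ∫ y, (M - q y) * ind K y := by
      refine integral_mono i1 i2 fun y => ?_
      have ey : p + r • (r⁻¹ • y + (p - r⁻¹ • p) - p) = y := by
        have e3 : r * r⁻¹ = 1 := mul_inv_cancel₀ hr0.ne'
        rw [smul_sub, smul_add, smul_sub, smul_smul, smul_smul, e3]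
        module
      simp only [hh, ey]
      by_cases hx : r⁻¹ • y + (p - r⁻¹ • p) ∈ K
      · have hy : y ∈ K := by
          have := hc hp hx hs.le hr0.le (by simp [hr])
          convert this using 1
          have e4 : s = 1 - r := by rw [hr]; ring
          conv_lhs => rw [← ey]
          rw [e4]; module
        have a1 : ind K (r⁻¹ • y + (p - r⁻¹ • p)) = 1 := by simp [ind, hx]
        have a2 : ind K y = 1 := by simp [ind, hy]
        rw [a1, a2]
      · have a1 : ind K (r⁻¹ • y + (p - r⁻¹ • p)) = 0 := by simp [ind, hx]
        rw [a1, mul_zero]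
        by_cases hy : y ∈ K
        · exact mul_nonneg (by linarith [hM y hy]) (hLC.nonneg y)
        · simp [ind, hy]
    rw [e1, e2, ← mul_assoc] at le
    exact le_of_mul_le_mul_right le hV
  have hM0 : ∀ s : ℝ, 0 < s → s < 1 → 0 ≤ M - s * q p := by
    have h0 : 0 ≤ M := by
      have : 0 ≤ ∫ y, (M - q y) * ind K y := integral_nonneg fun y => by
        by_cases hy : y ∈ K
        · exact mul_nonneg (by linarith [hM y hy]) (hLC.nonneg y)
        · simp [ind, hy]
      have e : (fun y => (M - q y) * ind K y) = fun y => M * ind K y - q y * ind K y := by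
        funext y; ring
      rw [e, integral_sub (i0.const_mul _) iq, integral_const_mul, Iq, sub_zero] at this
      exact nonneg_of_mul_nonneg_left this hV
    intro s hs hs1
    have := hM p hp
    nlinarith
  have key2 : ∀ s : ℝ, 0 < s → s < 1 → -q p + m * s * q p ≤ m * M := by
    intro s hs hs1
    have b := one_add_mul_le_pow (a := -s) (by linarith) m
    have c := mul_le_mul_of_nonneg_right b (hM0 s hs hs1)
    have d := key s hs hs1
    rw [sub_eq_add_neg] at d
    have e := c.trans d
    have : s * (-q p + m * s * q p) ≤ s * (m * M) := by linarith
    exact le_of_mul_le_mul_left this hs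
  have T : Tendsto (fun s : ℝ => -q p + m * s * q p) (nhdsWithin 0 (Ioi 0)) (nhds (-q p)) := by
    have : Continuous (fun s : ℝ => -q p + m * s * q p) := by fun_prop
    have := this.tendsto 0
    simp only [mul_zero, zero_mul, add_zero] at this
    exact this.mono_left nhdsWithin_le_nhds
  refine le_of_tendsto T ?_
  have : Ioo (0:ℝ) 1 ∈ nhdsWithin (0:ℝ) (Ioi 0) := Ioo_mem_nhdsGT zero_lt_one
  filter_upwards [this] with s hs using key2 s hs.1 hs.2

theorem cen_neg {m : ℕ} {K : Set (Fin m → ℝ)} (hm : 0 < m) (hc : Convex ℝ K) (hk : IsCompact K)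
    (hi : (interior K).Nonempty) (hcen : Cen (ind K)) {p : Fin m → ℝ} (hp : p ∈ K) :
    -((m:ℝ)⁻¹ • p) ∈ K := by
  have hm' : (0:ℝ) < m := by exact_mod_cast hm
  by_contra hn
  obtain ⟨q, u, h1, h2⟩ := geometric_hahn_banach_closed_point hc hk.isClosed hn
  have := cen_lin hc hk hi hcen q (M := u) (fun x hx => (h1 x hx).le) hp
  rw [map_neg, map_smul, smul_eq_mul] at h2
  have h3 := mul_lt_mul_of_pos_left h2 hm'
  have : (m:ℝ) * -((m:ℝ)⁻¹ * q p) = - q p := by field_simp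
  linarith

theorem cen_zero {m : ℕ} {K : Set (Fin m → ℝ)} (hm : 0 < m) (hc : Convex ℝ K) (hk : IsCompact K)
    (hi : (interior K).Nonempty) (hcen : Cen (ind K)) : 0 ∈ interior K := by
  have hm' : (0:ℝ) < m := by exact_mod_cast hm
  obtain ⟨x, hx⟩ := hi
  have h := cen_neg hm hc hk ⟨x, hx⟩ hcen (interior_subset hx)
  have := hc.combo_interior_self_mem_interior hx h (a := 1 / (m + 1)) (b := m / (m + 1))
    (by positivity) (by positivity) (by field_simp; ring)
  convert this using 1
  rw [smul_neg, smul_smul, ← sub_eq_add_neg, ← sub_smul]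
  have : (1 / ((m:ℝ) + 1) - m / (m + 1) * (m:ℝ)⁻¹) = 0 := by field_simp; ring
  rw [this, zero_smul]

theorem cen_diff {m : ℕ} {K : Set (Fin m → ℝ)} (hm : 0 < m) (hc : Convex ℝ K) (hk : IsCompact K)
    (hi : (interior K).Nonempty) (hcen : Cen (ind K)) {a b : Fin m → ℝ} (ha : a ∈ K) (hb : b ∈ K)
    {σ : ℝ} (hσ : |σ| * (m + 1) < 1) : σ • (a - b) ∈ interior K := by
  have hm' : (0:ℝ) < m := by exact_mod_cast hm
  have h0 := cen_zero hm hc hk hi hcen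
  have pos : ∀ a ∈ K, ∀ b ∈ K, ∀ σ : ℝ, 0 ≤ σ → σ * (m + 1) < 1 → σ • (a - b) ∈ interior K := by
    intro a ha b hb σ h1 h2
    have hx := hc ha (cen_neg hm hc hk hi hcen hb) (a := 1 / (m + 1)) (b := m / (m + 1))
      (by positivity) (by positivity) (by field_simp; ring)
    have := hc.combo_interior_self_mem_interior h0 hx (a := 1 - σ * (m + 1)) (b := σ * (m + 1))
      (by linarith) (by positivity) (by ring)
    convert this using 1
    rw [smul_zero, zero_add, smul_add, smul_neg, smul_smul, smul_smul, smul_neg, smul_smul,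
      ← sub_eq_add_neg, smul_sub]
    congr 2 <;> field_simp
  rcases le_total 0 σ with h | h
  · rw [abs_of_nonneg h] at hσ; exact pos a ha b hb σ h hσ
  · rw [abs_of_nonpos h] at hσ
    have := pos b hb a ha (-σ) (by linarith) hσ
    convert this using 1
    module

theorem cond_of {m : ℕ} {K : Set (Fin m → ℝ)} (hm : 0 < m) (hc : Convex ℝ K) (hk : IsCompact K)
    (hi : (interior K).Nonempty) (hcen : Cen (ind K)) (w : Fin m → Fin m → ℝ) (t : Fin m → ℝ)
    (ht : ∀ j, 0 < t j) (hw : ∀ j, w j ∈ t j • (K - K)) (hw1 : ∀ j, 1 ≤ |w j j|)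
    (hw2 : ∀ j i, j < i → w j i = 0) (μ : ℕ → ℝ) (hμ : ∀ j : Fin m, (m + 1) * t j < 2 * μ j) :
    Cond (ind K) μ := by
  have main : ∀ (j : Fin m) (e : ℝ), |e| = 1 → ∃ p ∈ interior {z | ind K z ≠ 0},
      p j = e * (1 / (2 * μ j)) ∧ ∀ i, j < i → p i = 0 := by
    intro j e he
    rw [ind_supp]
    have hμ0 : 0 < 2 * μ j := lt_of_le_of_lt (by have := ht j; positivity) (hμ j)
    have hwj : w j j ≠ 0 := by
      intro h; have := hw1 j; rw [h] at this; norm_num at this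
    obtain ⟨d, hd, hdw⟩ := hw j
    obtain ⟨a, ha, b, hb, rfl⟩ := hd
    simp only at hdw
    refine ⟨(e * (1 / (2 * μ j)) / w j j) • w j, ?_, ?_, ?_⟩
    · rw [← hdw, smul_smul, hdw]
      apply cen_diff hm hc hk hi hcen ha hb
      rw [abs_mul, abs_div, abs_mul, he, abs_of_pos (ht j), abs_of_pos (by positivity)]
      have h1 := hw1 j
      have : 1 * (1 / (2 * μ j)) / |w j j| ≤ 1 / (2 * μ j) := by
        rw [one_mul]; exact div_le_self (by positivity) h1
      calc _ ≤ 1 / (2 * μ j) * t j * (m + 1) := by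
            have := ht j
            gcongr
        _ = ((m + 1) * t j) / (2 * μ j) := by ring
        _ < 1 := by rw [div_lt_one hμ0]; exact hμ j
    · simp only [Pi.smul_apply, smul_eq_mul]; field_simp
    · intro i hi'; simp [hw2 j i hi']
  intro j
  constructor
  · obtain ⟨p, h1, h2, h3⟩ := main j 1 (by simp)
    exact ⟨p, h1, by rw [h2]; ring, h3⟩
  · obtain ⟨p, h1, h2, h3⟩ := main j (-1) (by simp)
    exact ⟨p, h1, by rw [h2]; ring, h3⟩


theorem greedy {E : Type*} [AddCommGroup E] [Module ℝ E] (L : ℕ → Set E) (n : ℕ)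
    (h : ∀ i < n, ∃ u : Fin (i+1) → E, LinearIndependent ℝ u ∧ ∀ j, u j ∈ L i) :
    ∀ m ≤ n, ∃ v : Fin m → E, LinearIndependent ℝ v ∧ ∀ j : Fin m, v j ∈ L j := by
  intro m
  induction m with
  | zero => intro _; exact ⟨Fin.elim0, linearIndependent_empty_type, fun j => j.elim0⟩
  | succ m ih =>
    intro hm
    obtain ⟨v, hv, hv2⟩ := ih (by omega)
    obtain ⟨u, hu, hu2⟩ := h m hm
    obtain ⟨j, hj⟩ : ∃ j, u j ∉ Submodule.span ℝ (range v) := by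
      by_contra hcon
      push Not at hcon
      have h1 : Submodule.span ℝ (range u) ≤ Submodule.span ℝ (range v) :=
        Submodule.span_le.2 (by rintro _ ⟨j, rfl⟩; exact hcon j)
      have : FiniteDimensional ℝ (Submodule.span ℝ (range v)) :=
        FiniteDimensional.span_of_finite ℝ (finite_range v)
      have h2 := Submodule.finrank_mono h1
      rw [finrank_span_eq_card hu, finrank_span_eq_card hv] at h2
      simp at h2
    refine ⟨Fin.snoc v (u j), linearIndependent_finSnoc.2 ⟨hv, hj⟩, fun i => ?_⟩
    refine Fin.lastCases ?_ (fun i => ?_) i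
    · simpa using hu2 j
    · simpa using hv2 i


theorem sm_bdd (K Λ : Set (Euc n)) (i : ℕ) : BddBelow {t : ℝ | 0 < t ∧ ∃ v : Fin i → Euc n,
    LinearIndependent ℝ v ∧ ∀ j, v j ∈ Λ ∧ v j ∈ t • K} := ⟨0, fun _ h => h.1.le⟩

theorem sm_nonneg (K Λ : Set (Euc n)) (i : ℕ) : 0 ≤ succMin K Λ i :=
  Real.sInf_nonneg fun _ h => h.1.le

theorem sm_ne {K : Set (Euc n)} (h0 : K ∈ nhds (0 : Euc n)) (i : ℕ) (hi : i ≤ n) :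
    {t : ℝ | 0 < t ∧ ∃ v : Fin i → Euc n,
      LinearIndependent ℝ v ∧ ∀ j, v j ∈ stdLattice n ∧ v j ∈ t • K}.Nonempty := by
  let v : Fin i → Euc n := fun j => EuclideanSpace.single (Fin.castLE hi j) 1
  have hv : LinearIndependent ℝ v := by
    have := (EuclideanSpace.basisFun (Fin n) ℝ).toBasis.linearIndependent.comp
      (Fin.castLE hi) (Fin.castLE_injective hi)
    have e : v = (EuclideanSpace.basisFun (Fin n) ℝ).toBasis ∘ Fin.castLE hi := by
      ext j; simp [v]
    rw [e]; exact this
  have h1 : ∀ j, ∀ᶠ t : ℝ in atTop, v j ∈ t • K := by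
    intro j
    have : Tendsto (fun t : ℝ => t⁻¹ • v j) atTop (nhds ((0:ℝ) • v j)) :=
      tendsto_inv_atTop_zero.smul_const _
    rw [zero_smul] at this
    filter_upwards [this.eventually h0, eventually_gt_atTop 0] with t ht ht0
    rwa [Set.mem_smul_set_iff_inv_smul_mem₀ ht0.ne']
  obtain ⟨t, ht, ht0⟩ := ((eventually_all.2 h1).and (eventually_gt_atTop 0)).exists
  refine ⟨t, ht0, v, hv, fun j => ⟨fun k => ?_, ht j⟩⟩
  by_cases hk : k = Fin.castLE hi j
  · exact ⟨1, by simp [v, hk]⟩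
  · exact ⟨0, by simp [v, hk]⟩

theorem sm_mono {K : Set (Euc n)} (h0 : K ∈ nhds (0 : Euc n)) {i j : ℕ} (hij : i ≤ j) (hj : j ≤ n) :
    succMin K (stdLattice n) i ≤ succMin K (stdLattice n) j := by
  refine csInf_le_csInf (sm_bdd _ _ _) (sm_ne h0 j hj) ?_
  rintro t ⟨ht, v, hv, hv2⟩
  exact ⟨ht, v ∘ Fin.castLE hij, hv.comp _ (Fin.castLE_injective hij), fun k => hv2 _⟩

theorem sm_vecs {K : Set (Euc n)} (hc : Convex ℝ K) (h0 : K ∈ nhds (0 : Euc n)) {δ : ℝ}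
    (hδ : 0 < δ) : ∃ v : Fin n → Euc n, LinearIndependent ℝ v ∧ ∀ j : Fin n, v j ∈ stdLattice n ∧
      v j ∈ (succMin K (stdLattice n) (j + 1) + δ) • K := by
  refine greedy (fun i => {x | x ∈ stdLattice n ∧
    x ∈ (succMin K (stdLattice n) (i + 1) + δ) • K}) n ?_ n le_rfl
  intro i hi
  obtain ⟨t, ⟨ht, v, hv, hv2⟩, hlt⟩ := exists_lt_of_csInf_lt (sm_ne h0 (i+1) hi)
    (lt_add_of_pos_right (succMin K (stdLattice n) (i + 1)) hδ)
  refine ⟨v, hv, fun j => ⟨(hv2 j).1, ?_⟩⟩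
  set T := succMin K (stdLattice n) (i + 1) + δ
  have hT : 0 < T := ht.trans hlt
  obtain ⟨x, hx, hxv⟩ := (hv2 j).2
  refine ⟨(t / T) • x, hc.smul_mem_of_zero_mem (mem_of_mem_nhds h0) hx
    ⟨by positivity, (div_le_one hT).2 hlt.le⟩, ?_⟩
  rw [← hxv]
  simp only [smul_smul]
  congr 1; field_simp


theorem transv_mulVec {n : ℕ} (i j : Fin n) (hij : i ≠ j) (c : ℤ) (x : Fin n → ℤ) :
    (Matrix.transvection i j c).mulVec x = Function.update x i (x i + c * x j) := by
  unfold Matrix.transvection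
  rw [Matrix.add_mulVec, Matrix.one_mulVec, Matrix.single_mulVec]
  ext k
  by_cases h : k = i
  · subst h; simp
  · simp [h]

theorem col_red {n : ℕ} : ∀ (N : ℕ) (x : Fin (n+1) → ℤ), ∑ i, (x i).natAbs = N →
    ∃ U : Matrix (Fin (n+1)) (Fin (n+1)) ℤ, IsUnit U.det ∧ ∀ i, i ≠ 0 → U.mulVec x i = 0 := by
  intro N
  induction N using Nat.strong_induction_on with
  | _ N ih =>
  intro x hx
  by_cases h : ∃ i j, i ≠ j ∧ x i ≠ 0 ∧ x j ≠ 0 ∧ |x j| ≤ |x i|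
  · obtain ⟨i, j, hij, hi, hj, hle⟩ := h
    obtain ⟨c, hc⟩ : ∃ c : ℤ, |x i + c * x j| < |x i| := by
      rcases lt_or_gt_of_ne hi with h1 | h1 <;> rcases lt_or_gt_of_ne hj with h2 | h2
      · refine ⟨-1, ?_⟩
        rw [abs_of_neg h1, abs_of_neg h2] at *; rw [abs_lt]; constructor <;> linarith
      · refine ⟨1, ?_⟩
        rw [abs_of_neg h1, abs_of_pos h2] at *; rw [abs_lt]; constructor <;> linarith
      · refine ⟨1, ?_⟩
        rw [abs_of_pos h1, abs_of_neg h2] at *; rw [abs_lt]; constructor <;> linarith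
      · refine ⟨-1, ?_⟩
        rw [abs_of_pos h1, abs_of_pos h2] at *; rw [abs_lt]; constructor <;> linarith
    have hc2 : (x i + c * x j).natAbs < (x i).natAbs := by
      rw [Int.abs_eq_natAbs, Int.abs_eq_natAbs] at hc; exact_mod_cast hc
    have hlt : ∑ k, (Function.update x i (x i + c * x j) k).natAbs < N := by
      rw [← hx]
      apply Finset.sum_lt_sum
      · intro k _
        by_cases hk : k = i
        · subst hk; simpa using hc2.le
        · simp [hk]
      · exact ⟨i, Finset.mem_univ _, by simpa using hc2⟩
    obtain ⟨U, hU, hU2⟩ := ih _ hlt _ rfl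
    refine ⟨U * Matrix.transvection i j c, ?_, ?_⟩
    · rw [Matrix.det_mul, Matrix.det_transvection_of_ne i j hij, mul_one]; exact hU
    · intro k hk
      rw [← Matrix.mulVec_mulVec, transv_mulVec i j hij]
      exact hU2 k hk
  · push Not at h
    obtain ⟨i0, hi0⟩ : ∃ i0, ∀ i, i ≠ i0 → x i = 0 := by
      by_cases hz : ∀ i, x i = 0
      · exact ⟨0, fun i _ => hz i⟩
      · push Not at hz
        obtain ⟨i0, h0⟩ := hz
        refine ⟨i0, fun i hi => ?_⟩
        by_contra hne
        have a := h i i0 hi hne h0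
        have b := h i0 i hi.symm h0 hne
        linarith
    refine ⟨(Equiv.swap 0 i0).permMatrix ℤ, ?_, ?_⟩
    · rw [Matrix.det_permutation]; simp
    · intro i hi
      rw [Matrix.permMatrix_mulVec]
      simp only [Function.comp]
      apply hi0
      intro e
      apply hi
      have := (Equiv.swap 0 i0).injective (e.trans (Equiv.swap_apply_left 0 i0).symm)
      exact this

theorem triang (n : ℕ) : ∀ M : Matrix (Fin n) (Fin n) ℤ,
    ∃ U : Matrix (Fin n) (Fin n) ℤ, IsUnit U.det ∧ ∀ i j, j < i → (U * M) i j = 0 := by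
  induction n with
  | zero => intro M; exact ⟨1, by simp, fun i => i.elim0⟩
  | succ n ih =>
    intro M
    obtain ⟨U1, h1, h1'⟩ := col_red _ (fun i => M i 0) rfl
    set N := U1 * M with hN
    have hN0 : ∀ i, i ≠ 0 → N i 0 = 0 := by
      intro i hi
      have := h1' i hi
      rw [hN, Matrix.mul_apply]
      simpa [Matrix.mulVec, dotProduct] using this
    obtain ⟨U', h2, h2'⟩ := ih (N.submatrix Fin.succ Fin.succ)
    let U2 : Matrix (Fin (n+1)) (Fin (n+1)) ℤ :=
      Matrix.of (Fin.cons (Pi.single 0 1) fun i => Fin.cons 0 (U' i))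
    have hd : U2.det = U'.det := by
      rw [Matrix.det_succ_column_zero, Fin.sum_univ_succ]
      simp [U2]
      congr 1
    refine ⟨U2 * U1, ?_, ?_⟩
    · rw [Matrix.det_mul, hd]; exact h2.mul h1
    · intro i j hij
      rw [Matrix.mul_assoc, ← hN]
      obtain ⟨i, rfl⟩ := Fin.exists_succ_eq_of_ne_zero (Fin.ne_zero_of_lt hij)
      rw [Matrix.mul_apply, Fin.sum_univ_succ]
      simp only [U2, Matrix.of_apply, Fin.cons_succ, Fin.cons_zero, zero_mul, zero_add]
      refine Fin.cases ?_ ?_ j hij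
      · intro _
        exact Finset.sum_eq_zero fun k _ => by rw [hN0 _ (Fin.succ_ne_zero k), mul_zero]
      · intro j hj
        have := h2' i j (by simpa using hj)
        simpa [Matrix.mul_apply] using this


theorem roots_lim {n : ℕ} (γ : Fin n → ℂ) (N : ℕ → ℕ) (V : ℝ) (hV : V ≠ 0)
    (hE : ∀ k : ℕ, 0 < k → (N k : ℂ) = ∏ i, (1 + (k : ℂ) / γ i))
    (hN : Tendsto (fun k : ℕ => (N k : ℝ) / (k:ℝ) ^ n) atTop (nhds V)) :
    ∃ s : ℝ, ∑ i, γ i = (s : ℂ) ∧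
      Tendsto (fun k : ℕ => (k:ℝ) * ((N k : ℝ) / (k:ℝ) ^ n - V)) atTop (nhds (V * s)) := by
  have hk : Tendsto (fun k : ℕ => ((k : ℂ))⁻¹) atTop (nhds 0) :=
    tendsto_inv_atTop_nhds_zero_nat
  have hNC : Tendsto (fun k : ℕ => (N k : ℂ) / (k:ℂ) ^ n) atTop (nhds (V : ℂ)) := by
    have := (Complex.continuous_ofReal.tendsto V).comp hN
    refine this.congr fun k => ?_
    simp
  have e1 : ∀ k : ℕ, 0 < k → (N k : ℂ) / (k:ℂ) ^ n = ∏ i, ((k:ℂ)⁻¹ + (γ i)⁻¹) := by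
    intro k h
    have hk0 : (k:ℂ) ≠ 0 := by exact_mod_cast h.ne'
    rw [hE k h]
    have : (k:ℂ) ^ n = ∏ i : Fin n, (k:ℂ) := by simp
    rw [this, ← Finset.prod_div_distrib]
    refine Finset.prod_congr rfl fun i _ => ?_
    rw [div_eq_mul_inv, add_mul, div_eq_mul_inv, one_mul, mul_comm (k:ℂ), mul_assoc,
      mul_inv_cancel₀ hk0, mul_one]
  have e2 : Tendsto (fun k : ℕ => ∏ i, ((k:ℂ)⁻¹ + (γ i)⁻¹)) atTop (nhds (∏ i, (γ i)⁻¹)) := by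
    refine tendsto_finsetProd _ fun i _ => ?_
    simpa using hk.add_const (γ i)⁻¹
  have e3 : ∏ i, (γ i)⁻¹ = (V:ℂ) := by
    refine tendsto_nhds_unique e2 (hNC.congr' ?_)
    filter_upwards [eventually_gt_atTop 0] with k h using e1 k h
  have hγ : ∀ i, γ i ≠ 0 := by
    intro i hi
    have : ∏ i, (γ i)⁻¹ = 0 := Finset.prod_eq_zero (Finset.mem_univ i) (by simp [hi])
    rw [this] at e3
    exact hV (by exact_mod_cast e3.symm)
  have hd : HasDerivAt (fun h : ℂ => ∏ i, (1 + γ i * h)) (∑ i, γ i) 0 := by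
    have := HasDerivAt.fun_finsetProd (u := Finset.univ) (f := fun (i : Fin n) (h : ℂ) => 1 + γ i * h)
      (f' := γ) (x := 0) (fun i _ => by
        simpa using ((hasDerivAt_id (0:ℂ)).const_mul (γ i)).const_add 1)
    simpa using this
  have e4 : Tendsto (fun k : ℕ => (k:ℂ) * ((N k : ℂ) / (k:ℂ) ^ n - V)) atTop
      (nhds (V * ∑ i, γ i)) := by
    have h1 := hasDerivAt_iff_tendsto_slope_zero.1 hd
    have h2 : Tendsto (fun k : ℕ => ((k : ℂ))⁻¹) atTop (nhdsWithin 0 {0}ᶜ) := by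
      refine tendsto_nhdsWithin_iff.2 ⟨hk, ?_⟩
      filter_upwards [eventually_gt_atTop 0] with k h
      simp; omega
    have h3 := (h1.comp h2).const_mul (V:ℂ)
    refine h3.congr' ?_
    filter_upwards [eventually_gt_atTop 0] with k h
    rw [e1 k h]
    have : ∏ i, ((k:ℂ)⁻¹ + (γ i)⁻¹) = V * ∏ i, (1 + γ i * (k:ℂ)⁻¹) := by
      rw [← e3, ← Finset.prod_mul_distrib]
      refine Finset.prod_congr rfl fun i _ => ?_
      rw [mul_add, ← mul_assoc, inv_mul_cancel₀ (hγ i)]; ring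
    rw [this]
    simp
    ring
  set r : ℕ → ℝ := fun k => (k:ℝ) * ((N k : ℝ) / (k:ℝ) ^ n - V) with hr
  have e5 : Tendsto (fun k => ((r k : ℝ) : ℂ)) atTop (nhds (V * ∑ i, γ i)) := by
    refine e4.congr fun k => ?_
    simp [hr]
  have him : (V * ∑ i, γ i : ℂ).im = 0 := by
    have := (Complex.continuous_im.tendsto _).comp e5
    refine tendsto_nhds_unique this ?_
    simp [Function.comp_def]
  have hre : Tendsto r atTop (nhds (V * ∑ i, γ i : ℂ).re) := by
    have := (Complex.continuous_re.tendsto _).comp e5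
    simpa [Function.comp_def] using this
  have i0 : (∑ i, γ i).im = 0 := by
    rw [Complex.im_ofReal_mul] at him
    exact (mul_eq_zero.1 him).resolve_left hV
  refine ⟨(∑ i, γ i).re, ?_, ?_⟩
  · apply Complex.ext
    · simp
    · rw [i0]; simp
  · rw [Complex.re_ofReal_mul] at hre; exact hre


/-- integer vector as a real vector -/
def zr {m : ℕ} (z : Fin m → ℤ) : Fin m → ℝ := fun i => (z i : ℝ)

/-- integer points of a dilate -/
def NQ {m : ℕ} (Q : Set (Fin m → ℝ)) (k : ℕ) : ℕ := Nat.card {z : Fin m → ℤ // zr z ∈ (k:ℝ) • Q}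

theorem fin_pts {m : ℕ} {Q : Set (Fin m → ℝ)} (hQ : Bornology.IsBounded Q) (k : ℕ) :
    {z : Fin m → ℤ | zr z ∈ (k:ℝ) • Q}.Finite := by
  obtain ⟨R, hR⟩ := (hQ.smul₀ (k:ℝ)).exists_norm_le
  refine (Set.finite_Icc (fun _ : Fin m => -⌈R⌉) (fun _ => ⌈R⌉)).subset ?_
  intro z hz
  have h1 := hR _ hz
  have h2 : ∀ i, |(z i : ℝ)| ≤ ⌈R⌉ := fun i =>
    ((norm_le_pi_norm (zr z) i).trans h1).trans (Int.le_ceil R)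
  constructor
  · intro i
    have := (abs_le.1 (h2 i)).1
    exact_mod_cast this
  · intro i
    have := (abs_le.1 (h2 i)).2
    exact_mod_cast this

theorem box_int {m : ℕ} (z : Fin m → ℤ) :
    volume (Set.pi univ fun i => Ico (z i : ℝ) (z i + 1)) = 1 := by
  rw [Real.volume_pi_Ico]; simp

theorem count_int {m : ℕ} {Q : Set (Fin m → ℝ)} (hQ : Bornology.IsBounded Q) {k : ℕ} (hk : 0 < k) :
    ∫ y : Fin m → ℝ, ind Q (fun i => (⌊(k:ℝ) * y i⌋ : ℝ) / k) = (NQ Q k : ℝ) / (k:ℝ) ^ m := by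
  classical
  have hk' : (0:ℝ) < k := by exact_mod_cast hk
  set g : (Fin m → ℝ) → ℝ := fun y => ind Q (fun i => (⌊y i⌋ : ℝ) / k) with hg
  have h1 : ∫ y : Fin m → ℝ, ind Q (fun i => (⌊(k:ℝ) * y i⌋ : ℝ) / k) = ∫ y, g ((k:ℝ) • y) := by
    simp [hg]
  rw [h1, Measure.integral_comp_smul]
  set A := (fin_pts hQ k).toFinset with hA
  have hcard : NQ Q k = A.card := by
    unfold NQ
    rw [hA, ← Nat.card_eq_card_finite_toFinset]; rfl
  have h2 : g = fun y => ∑ z ∈ A, (Set.pi univ fun i => Ico (z i : ℝ) (z i + 1)).indicator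
      (fun _ => (1:ℝ)) y := by
    funext y
    have hbox : ∀ z : Fin m → ℤ, y ∈ (Set.pi univ fun i => Ico (z i : ℝ) (z i + 1)) ↔
        z = fun i => ⌊y i⌋ := by
      intro z
      simp only [Set.mem_pi, mem_univ, true_implies, mem_Ico]
      constructor
      · intro h; funext i; exact (Int.floor_eq_iff.2 (h i)).symm
      · intro h i; exact Int.floor_eq_iff.1 (congrFun h i).symm
    simp only [indicator_apply, hbox]
    rw [Finset.sum_ite_eq']
    have hmem : ((fun i => ⌊y i⌋) ∈ A) ↔ (fun i => (⌊y i⌋ : ℝ) / k) ∈ Q := by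
      rw [hA, Set.Finite.mem_toFinset, mem_ofPred_eq, Set.mem_smul_set_iff_inv_smul_mem₀ hk'.ne']
      have : (k:ℝ)⁻¹ • zr (fun i => ⌊y i⌋) = fun i => (⌊y i⌋ : ℝ) / k := by
        funext i; simp [zr]; ring
      rw [this]
    simp only [hg, ind, indicator_apply, hmem]
  have h3 : ∫ y, g y = A.card := by
    rw [h2, integral_finsetSum]
    · have : ∀ z ∈ A, ∫ y, (Set.pi univ fun i => Ico (z i : ℝ) (z i + 1)).indicator
          (fun _ => (1:ℝ)) y = 1 := by
        intro z _
        rw [integral_indicator (MeasurableSet.univ_pi fun i => measurableSet_Ico)]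
        simp [Measure.real, box_int]
      rw [Finset.sum_congr rfl this]; simp
    · intro z _
      refine (integrable_indicator_iff (MeasurableSet.univ_pi fun i => measurableSet_Ico)).2 ?_
      refine integrableOn_const ?_
      rw [box_int]; simp
  rw [h3, hcard]
  simp
  ring

theorem Ak_lim {m : ℕ} {K : Set (Fin m → ℝ)} (hc : Convex ℝ K) (hk : IsCompact K) (c : Fin m → ℝ) :
    Tendsto (fun k => Ak k c (ind K)) atTop (nhds (∫ y, ind K y)) := by
  have hLC := ind_LC hc hk
  obtain ⟨R, hR0, hR⟩ := hLC.exists_rad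
  unfold Ak
  refine tendsto_integral_filter_of_dominated_convergence
    ((Metric.closedBall (0 : Fin m → ℝ) (R + 1)).indicator fun _ => (1:ℝ)) ?_ ?_ ?_ ?_
  · exact Eventually.of_forall fun k => (hLC.meas.comp (rdv_meas k c)).aestronglyMeasurable
  · filter_upwards [eventually_gt_atTop 0] with k hk0
    refine Eventually.of_forall fun y => ?_
    by_cases h : ind K (rdv k c y) = 0
    · rw [h, norm_zero]; exact indicator_nonneg (fun _ _ => zero_le_one) _
    · have h1 := hR _ h
      have h2 := rdv_dist hk0 c y
      have h3 : (1:ℝ) / k ≤ 1 := by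
        rw [div_le_one (by exact_mod_cast hk0)]; exact_mod_cast hk0
      have h4 : y ∈ Metric.closedBall (0 : Fin m → ℝ) (R + 1) := by
        rw [mem_closedBall_zero_iff]
        calc ‖y‖ = ‖rdv k c y - (rdv k c y - y)‖ := by congr 1; abel
          _ ≤ ‖rdv k c y‖ + ‖rdv k c y - y‖ := norm_sub_le _ _
          _ ≤ R + 1 := by linarith
      rw [indicator_of_mem h4]
      rw [Real.norm_of_nonneg (hLC.nonneg _)]
      exact indicator_le_self' (fun _ _ => zero_le_one) _
  · refine (integrable_indicator_iff measurableSet_closedBall).2 ?_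
    exact integrableOn_const (isCompact_closedBall _ _).measure_lt_top.ne
  · have : ∀ᵐ y : Fin m → ℝ, y ∉ frontier K :=
      measure_eq_zero_iff_ae_notMem.1 (hc.addHaar_frontier volume)
    filter_upwards [this] with y hy
    have hT := rdv_tendsto c y
    have : y ∈ interior K ∨ y ∈ Kᶜ := by
      by_contra hcon
      push Not at hcon
      apply hy
      rw [frontier, hk.isClosed.closure_eq]
      exact ⟨not_not.1 hcon.2, hcon.1⟩
    rcases this with h | h
    · refine Tendsto.congr' ?_ tendsto_const_nhds
      filter_upwards [hT (isOpen_interior.mem_nhds h)] with k hk1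
      have a : rdv k c y ∈ K := interior_subset hk1
      have b : y ∈ K := interior_subset h
      simp [ind, a, b]
    · refine Tendsto.congr' ?_ tendsto_const_nhds
      filter_upwards [hT (hk.isClosed.isOpen_compl.mem_nhds h)] with k hk1
      have a : rdv k c y ∉ K := hk1
      have b : y ∉ K := h
      simp [ind, a, b]

/-- translate of a set -/
def tr {m : ℕ} (Q : Set (Fin m → ℝ)) (c : Fin m → ℝ) : Set (Fin m → ℝ) := (fun y => y + c) ⁻¹' Q

theorem ind_tr {m : ℕ} (Q : Set (Fin m → ℝ)) (c y : Fin m → ℝ) : ind (tr Q c) y = ind Q (y + c) := by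
  rfl

theorem tr_img {m : ℕ} (Q : Set (Fin m → ℝ)) (c : Fin m → ℝ) : tr Q c = (Homeomorph.addRight c) ⁻¹' Q :=
  rfl

theorem tr_diff {m : ℕ} (Q : Set (Fin m → ℝ)) (c : Fin m → ℝ) : tr Q c - tr Q c = Q - Q := by
  ext x
  constructor
  · rintro ⟨a, ha, b, hb, rfl⟩
    exact ⟨a + c, ha, b + c, hb, by simp⟩
  · rintro ⟨a, ha, b, hb, rfl⟩
    exact ⟨a - c, by simpa [tr] using ha, b - c, by simpa [tr] using hb, by simp⟩

theorem Ak_tr {m : ℕ} {Q : Set (Fin m → ℝ)} (hQ : Bornology.IsBounded Q) (c : Fin m → ℝ) {k : ℕ}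
    (hk : 0 < k) : Ak k c (ind (tr Q c)) = (NQ Q k : ℝ) / (k:ℝ) ^ m := by
  rw [← count_int hQ hk, Ak]
  rw [← integral_add_right_eq_self (fun y : Fin m → ℝ => ind Q (fun i => (⌊(k:ℝ) * y i⌋ : ℝ) / k)) c]
  congr 1
  funext y
  rw [ind_tr]
  congr 1
  funext i
  simp [rdv, rd]

theorem tr_vol {m : ℕ} (Q : Set (Fin m → ℝ)) (c : Fin m → ℝ) :
    ∫ y, ind (tr Q c) y = ∫ y, ind Q y := by
  simp only [ind_tr]
  exact integral_add_right_eq_self (ind Q) c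

theorem NQ_lim {m : ℕ} {Q : Set (Fin m → ℝ)} (hc : Convex ℝ Q) (hk : IsCompact Q) :
    Tendsto (fun k => (NQ Q k : ℝ) / (k:ℝ) ^ m) atTop (nhds (∫ y, ind Q y)) := by
  refine (Ak_lim hc hk 0).congr' ?_
  filter_upwards [eventually_gt_atTop 0] with k h
  rw [← Ak_tr hk.isBounded 0 h]
  simp [tr]

theorem main_bound {m : ℕ} (hm : 0 < m) {Q : Set (Fin m → ℝ)} (hc : Convex ℝ Q) (hk : IsCompact Q)
    (hi : (interior Q).Nonempty) (w : Fin m → Fin m → ℝ) (t : Fin m → ℝ)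
    (ht : ∀ j, 0 < t j) (hw : ∀ j, w j ∈ t j • (Q - Q)) (hw1 : ∀ j, 1 ≤ |w j j|)
    (hw2 : ∀ j i, j < i → w j i = 0) (μ : ℕ → ℝ) (hμ0 : ∀ j, 0 < μ j) (hmono : Monotone μ)
    (hμ : ∀ j : Fin m, (m + 1) * t j < 2 * μ j) (s : ℝ)
    (hs : Tendsto (fun k : ℕ => (k:ℝ) * ((NQ Q k : ℝ) / (k:ℝ) ^ m - ∫ y, ind Q y)) atTop
      (nhds ((∫ y, ind Q y) * s))) : s ≤ ∑ j ∈ Finset.range m, μ j := by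
  have hV := ind_pos hc hk hi
  set V := ∫ y, ind Q y with hVd
  let c : Fin m → ℝ := fun i => (∫ y : Fin m → ℝ, y i * ind Q y) / V
  have hc' : Convex ℝ (tr Q c) := hc.translate_preimage_left c
  have hk' : IsCompact (tr Q c) := by
    rw [tr_img]; exact (Homeomorph.addRight c).isCompact_preimage.2 hk
  have hi' : (interior (tr Q c)).Nonempty := by
    rw [tr_img, ← (Homeomorph.addRight c).preimage_interior]
    exact hi.preimage (Homeomorph.addRight c).surjective
  have hcen : Cen (ind (tr Q c)) := by
    intro i
    have h1 : ∫ y : Fin m → ℝ, y i * ind (tr Q c) y = ∫ y : Fin m → ℝ, (y i - c i) * ind Q y := by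
      rw [← integral_add_right_eq_self (fun y : Fin m → ℝ => (y i - c i) * ind Q y) c]
      simp [ind_tr]
    rw [h1]
    simp only [sub_mul]
    rw [integral_sub (coord_int (ind_LC hc hk) i) (((ind_LC hc hk).integrable volume).const_mul _),
      integral_const_mul, ← hVd]
    simp only [c]
    field_simp; ring
  have hcond := cond_of hm hc' hk' hi' hcen w t ht (by rwa [tr_diff]) hw1 hw2 μ hμ
  have h0 : 0 ∈ interior {z | ind (tr Q c) z ≠ 0} := by
    rw [ind_supp]; exact cen_zero hm hc' hk' hi' hcen
  have main := mainG' (ind_LC hc' hk') hcen h0 hμ0 hmono hcond c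
  have fin : ∀ η > 0, V * s ≤ (∑ j ∈ Finset.range m, μ j) * V + η := by
    intro η hη
    refine le_of_tendsto hs ?_
    filter_upwards [main η hη, eventually_gt_atTop 0] with k h1 h2
    rw [Ak_tr hk.isBounded c h2, tr_vol, ← hVd] at h1
    exact h1
  have := le_of_forall_pos_le_add fin
  rw [mul_comm] at this
  exact le_of_mul_le_mul_right this hV



theorem zr_mulVec (U : Matrix (Fin n) (Fin n) ℤ) (z : Fin n → ℤ) :
    (U.map (Int.cast : ℤ → ℝ)).mulVec (zr z) = zr (U.mulVec z) := by
  funext i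
  simp [Matrix.mulVec, dotProduct, zr]

theorem exists_L (U : Matrix (Fin n) (Fin n) ℤ) (hU : IsUnit U.det) :
    ∃ L : Euc n ≃L[ℝ] (Fin n → ℝ), (∀ z : Fin n → ℤ, L (WithLp.toLp 2 (zr z)) = zr (U.mulVec z)) ∧
      ∀ z : Fin n → ℤ, ∃ u : Fin n → ℤ, L.symm (zr z) = WithLp.toLp 2 (zr u) := by
  have h1 : U * U⁻¹ = 1 := Matrix.mul_nonsing_inv U hU
  have h2 : U⁻¹ * U = 1 := Matrix.nonsing_inv_mul U hU
  have c : ∀ A B : Matrix (Fin n) (Fin n) ℤ, A * B = 1 →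
      A.map (Int.cast : ℤ → ℝ) * B.map (Int.cast : ℤ → ℝ) = 1 := by
    intro A B h
    have := congrArg (fun M => M.map (Int.castRingHom ℝ)) h
    rw [Matrix.map_mul] at this
    simpa using this
  let T := (Matrix.toLin'OfInv (c _ _ h2) (c _ _ h1)).toContinuousLinearEquiv
  have hL : ∀ z : Fin n → ℤ, ((EuclideanSpace.equiv (Fin n) ℝ).trans T) (WithLp.toLp 2 (zr z))
      = zr (U.mulVec z) := by
    intro z
    rw [← zr_mulVec]
    simp [T, Matrix.toLin'OfInv]
    rfl
  refine ⟨(EuclideanSpace.equiv (Fin n) ℝ).trans T, hL, fun z => ⟨U⁻¹.mulVec z, ?_⟩⟩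
  rw [ContinuousLinearEquiv.symm_apply_eq, hL, Matrix.mulVec_mulVec, h1, Matrix.one_mulVec]

theorem lat_iff (x : Euc n) : x ∈ stdLattice n ↔ ∃ u : Fin n → ℤ, x = WithLp.toLp 2 (zr u) := by
  constructor
  · intro h
    choose u hu using h
    exact ⟨u, by ext i; simp [zr, hu]⟩
  · rintro ⟨u, rfl⟩ i
    exact ⟨u i, rfl⟩

theorem card_eq (P : Set (Euc n)) (U : Matrix (Fin n) (Fin n) ℤ) (L : Euc n ≃L[ℝ] (Fin n → ℝ))
    (h1 : ∀ z : Fin n → ℤ, L (WithLp.toLp 2 (zr z)) = zr (U.mulVec z))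
    (h2 : ∀ z : Fin n → ℤ, ∃ u : Fin n → ℤ, L.symm (zr z) = WithLp.toLp 2 (zr u)) (k : ℕ) :
    NQ (L '' P) k = Nat.card ↥(((k : ℝ) • P) ∩ stdLattice n) := by
  unfold NQ
  have hmem : ∀ x : Euc n, L x ∈ (k:ℝ) • (L '' P) ↔ x ∈ (k:ℝ) • P := by
    intro x
    rw [← image_smul_set]
    exact L.injective.mem_set_image
  refine Nat.card_eq_of_bijective (fun z => ⟨L.symm (zr z.1), ?_, ?_⟩) ⟨?_, ?_⟩
  · rw [← hmem]; simpa using z.2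
  · exact (lat_iff _).2 (h2 z.1)
  · intro z z' h
    have := L.symm.injective (congrArg Subtype.val h)
    apply Subtype.ext
    funext i
    have := congrFun this i
    simpa [zr] using this
  · rintro ⟨x, hx1, hx2⟩
    obtain ⟨u, rfl⟩ := (lat_iff x).1 hx2
    refine ⟨⟨U.mulVec u, ?_⟩, ?_⟩
    · rw [← h1, hmem]; exact hx1
    · apply Subtype.ext
      simp only
      rw [← h1]; simp

theorem diff_nhds {P : Set (Euc n)} (hint : (interior P).Nonempty) : P - P ∈ nhds (0 : Euc n) := by
  obtain ⟨a, ha⟩ := hint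
  have ho : IsOpen ((fun x : Euc n => x + a) ⁻¹' interior P) :=
    isOpen_interior.preimage (by fun_prop)
  refine mem_of_superset (ho.mem_nhds (by simpa using ha)) ?_
  intro x hx
  exact ⟨x + a, interior_subset hx, a, interior_subset ha, by simp⟩

theorem part1 (hn : 0 < n) (P : Set (Euc n)) (hc : Convex ℝ P) (hk : IsCompact P)
    (hint : (interior P).Nonempty) (γ : Fin n → ℂ)
    (hE : ∀ k : ℕ, 0 < k → (Nat.card ↥(((k : ℝ) • P) ∩ stdLattice n) : ℂ) =
        ∏ i, (1 + (k : ℂ) / γ i)) :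
    ∃ s : ℝ, ∑ i, γ i = (s:ℂ) ∧ s ≤ (((n : ℝ) + 1) / 2) *
          ∑ i : Fin n, succMin (P - P) (stdLattice n) ((i : ℕ) + 1) := by
  have h0 := diff_nhds hint
  set lam : ℕ → ℝ := fun i => succMin (P - P) (stdLattice n) i with hlam
  -- per delta bound
  have key : ∀ δ : ℝ, 0 < δ → ∃ s : ℝ, ∑ i, γ i = (s:ℂ) ∧
      s ≤ (((n : ℝ) + 1) / 2) * ∑ i : Fin n, lam (i + 1) + ((n:ℝ) + 1) * n * δ := by
    intro δ hδ
    obtain ⟨v, hv, hv2⟩ := sm_vecs (hc.sub hc) h0 hδ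
    have hv3 : ∀ j, ∃ u : Fin n → ℤ, v j = WithLp.toLp 2 (zr u) := fun j =>
      (lat_iff _).1 (hv2 j).1
    choose u hu using hv3
    let M : Matrix (Fin n) (Fin n) ℤ := Matrix.of fun i j => u j i
    obtain ⟨U, hU, hU2⟩ := triang n M
    obtain ⟨L, hL1, hL2⟩ := exists_L U hU
    have hM : M.det ≠ 0 := by
      intro hd
      obtain ⟨x, hx0, hx⟩ := Matrix.exists_mulVec_eq_zero_iff.2 hd
      apply hx0
      have : ∑ j, (x j : ℝ) • v j = 0 := by
        ext i
        have := congrFun hx i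
        simp only [Matrix.mulVec, dotProduct, M, Matrix.of_apply, Pi.zero_apply] at this
        have h2 : ((∑ j, u j i * x j : ℤ) : ℝ) = 0 := by rw [this]; simp
        push_cast at h2
        simp only [hu, zr, WithLp.ofLp_sum, Finset.sum_apply, WithLp.ofLp_smul, Pi.smul_apply,
          smul_eq_mul, WithLp.ofLp_zero, Pi.zero_apply]
        rw [← h2]
        exact Finset.sum_congr rfl fun j _ => mul_comm _ _
      have h3 := Fintype.linearIndependent_iff.1 hv (fun j => (x j : ℝ)) this
      funext j
      have := h3 j
      simpa using this
    have hdiag : ∀ j, (U * M) j j ≠ 0 := by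
      have hd : (U * M).det = ∏ j, (U * M) j j :=
        Matrix.det_of_isUpperTriangular (fun i j h => hU2 i j h)
      intro j hj
      have hz : ∏ j, (U * M) j j = 0 := Finset.prod_eq_zero (Finset.mem_univ j) hj
      rw [hz, Matrix.det_mul] at hd
      exact (mul_ne_zero hU.ne_zero hM) hd
    have hcol : ∀ j i, U.mulVec (u j) i = (U * M) i j := by
      intro j i
      simp [Matrix.mulVec, dotProduct, Matrix.mul_apply, M]
    let w : Fin n → Fin n → ℝ := fun j => zr (U.mulVec (u j))
    set Q := L '' P with hQ
    have hcQ : Convex ℝ Q := hc.linear_image (L : Euc n →ₗ[ℝ] (Fin n → ℝ))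
    have hkQ : IsCompact Q := hk.image L.continuous
    have hiQ : (interior Q).Nonempty := by
      have := L.toHomeomorph.image_interior P
      have h4 : (L.toHomeomorph '' interior P).Nonempty := hint.image _
      rw [this] at h4
      exact h4
    have hN := NQ_lim hcQ hkQ
    have hV := ind_pos hcQ hkQ hiQ
    obtain ⟨s, hs1, hs2⟩ := roots_lim γ (NQ Q) _ hV.ne'
      (fun k hk0 => by rw [hQ, card_eq P U L hL1 hL2 k]; exact hE k hk0) hN
    refine ⟨s, hs1, ?_⟩
    let μ : ℕ → ℝ := fun j => ((n:ℝ) + 1) / 2 * (lam (min (j + 1) n) + 2 * δ)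
    have hlam0 : ∀ i, 0 ≤ lam i := fun i => sm_nonneg _ _ _
    have hmin : ∀ j : ℕ, j < n → min (j + 1) n = j + 1 := fun j hj => by omega
    have := main_bound hn hcQ hkQ hiQ w (fun j => lam (j + 1) + δ)
      (fun j => by have := hlam0 (j + 1); positivity)
      (fun j => by
        have e : w j = L (v j) := by rw [hu, hL1]
        have e2 : Q - Q = L '' (P - P) := by
          rw [hQ]; exact (image_sub (L : Euc n →ₗ[ℝ] (Fin n → ℝ))).symm
        rw [e, e2, ← image_smul_set]
        exact mem_image_of_mem _ (hv2 j).2)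
      (fun j => by
        have := hdiag j
        rw [← hcol] at this
        have h5 := Int.one_le_abs this
        simp only [w, zr]
        exact_mod_cast h5)
      (fun j i hji => by
        simp only [w, zr]
        rw [hcol, hU2 i j hji]; simp)
      μ (fun j => by have := hlam0 (min (j + 1) n); simp only [μ]; positivity)
      (fun i j hij => by
        have : lam (min (i + 1) n) ≤ lam (min (j + 1) n) :=
          sm_mono h0 (by omega) (by omega)
        simp only [μ]
        gcongr)
      (fun j => by
        simp only [μ]
        rw [hmin j j.2]
        have : (0:ℝ) < (n:ℝ) + 1 := by positivity
        nlinarith)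
      s hs2
    refine this.trans (le_of_eq ?_)
    rw [Finset.sum_range]
    have e3 : ∀ j : Fin n, μ j = ((n:ℝ) + 1) / 2 * lam (j + 1) + ((n:ℝ) + 1) * δ := by
      intro j; simp only [μ]; rw [hmin j j.2]; ring
    rw [Finset.sum_congr rfl fun j _ => e3 j, Finset.sum_add_distrib, ← Finset.mul_sum]
    simp
    ring
  obtain ⟨s, hs, _⟩ := key 1 one_pos
  refine ⟨s, hs, le_of_forall_pos_le_add fun ε hε => ?_⟩
  obtain ⟨s', hs', hle⟩ := key (ε / (((n:ℝ) + 1) * n)) (by positivity)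
  have : s' = s := by rw [hs] at hs'; exact_mod_cast hs'.symm
  rw [this] at hle
  refine hle.trans (le_of_eq ?_)
  have : (n:ℝ) ≠ 0 := by positivity
  field_simp
  rfl



theorem mem_simplex (x : Euc n) : x ∈ stdSimplexSet n ↔ (∀ i, 0 ≤ x i) ∧ ∑ i, x i ≤ 1 := by
  constructor
  · intro h
    have hconv : Convex ℝ {x : Euc n | (∀ i, 0 ≤ x i) ∧ ∑ i, x i ≤ 1} := by
      rintro x ⟨hx1, hx2⟩ y ⟨hy1, hy2⟩ a b ha hb hab
      refine ⟨fun i => ?_, ?_⟩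
      · have := hx1 i
        have := hy1 i
        simp only [PiLp.add_apply, PiLp.smul_apply, smul_eq_mul]
        positivity
      · simp only [PiLp.add_apply, PiLp.smul_apply, smul_eq_mul, Finset.sum_add_distrib,
          ← Finset.mul_sum]
        nlinarith
    refine convexHull_min ?_ hconv h
    rintro y (rfl | ⟨i, rfl⟩)
    · simp
    · refine ⟨fun j => ?_, ?_⟩
      · by_cases h : j = i <;> simp [h]
      · simp [Pi.single_apply]
  · rintro ⟨h1, h2⟩
    have h0 : (0 : Euc n) ∈ stdSimplexSet n := subset_convexHull _ _ (mem_insert _ _)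
    have hs : ∀ i, EuclideanSpace.single i (1:ℝ) ∈ stdSimplexSet n := fun i =>
      subset_convexHull _ _ (mem_insert_of_mem _ ⟨i, rfl⟩)
    have hcv : Convex ℝ (stdSimplexSet n) := convex_convexHull ℝ _
    have := hcv.sum_mem
      (t := (Finset.univ : Finset (Fin (n+1))))
      (w := (Fin.cons (1 - ∑ i, x i) (fun i => x i) : Fin (n+1) → ℝ))
      (z := (Fin.cons 0 (fun i => EuclideanSpace.single i (1:ℝ)) : Fin (n+1) → Euc n))
      (fun i _ => by
        refine Fin.cases ?_ (fun j => ?_) i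
        · simpa using h2
        · simpa using h1 j)
      (by rw [Fin.sum_univ_succ]; simp)
      (fun i _ => by
        refine Fin.cases ?_ (fun j => ?_) i
        · simpa using h0
        · simpa using hs j)
    rw [Fin.sum_univ_succ] at this
    simp only [Fin.cons_zero, Fin.cons_succ, smul_zero, zero_add] at this
    convert this using 1
    ext j
    simp [Pi.single_apply]

theorem card_simplex (k : ℕ) (hk : 0 < k) :
    Nat.card ↥(((k : ℝ) • stdSimplexSet n) ∩ stdLattice n) = (n + k).choose n := by
  have hk' : (0:ℝ) < k := by exact_mod_cast hk
  have hmem : ∀ x : Euc n, x ∈ (k:ℝ) • stdSimplexSet n ↔ (∀ i, 0 ≤ x i) ∧ ∑ i, x i ≤ k := by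
    intro x
    rw [Set.mem_smul_set_iff_inv_smul_mem₀ hk'.ne', mem_simplex]
    simp only [PiLp.smul_apply, smul_eq_mul, ← Finset.mul_sum]
    refine and_congr (forall_congr' fun i => ?_) ?_
    · exact mul_nonneg_iff_of_pos_left (by positivity)
    · rw [inv_mul_le_iff₀ hk', mul_one]
  have hc := Finset.card_finsuppAntidiag_nat_eq_choose (s := (Finset.univ : Finset (Fin (n+1)))) k
  simp only [Finset.card_univ, Fintype.card_fin] at hc
  have e : (n + 1 + k - 1).choose k = (n + k).choose n := by
    rw [show n + 1 + k - 1 = n + k by omega]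
    exact (Nat.choose_symm_add).symm
  rw [← e, ← hc, ← Nat.card_eq_finsetCard]
  symm
  have hf : ∀ f ∈ (Finset.univ : Finset (Fin (n+1))).finsuppAntidiag k,
      f 0 + ∑ i : Fin n, f i.succ = k := by
    intro f hf
    rw [← Fin.sum_univ_succ]
    exact (Finset.mem_finsuppAntidiag.1 hf).1
  refine Nat.card_eq_of_bijective
    (fun f => ⟨WithLp.toLp 2 (fun i : Fin n => ((f.1 i.succ : ℕ) : ℝ)), ?_, ?_⟩) ⟨?_, ?_⟩
  · rw [hmem]
    refine ⟨fun i => by simp, ?_⟩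
    have h1 := hf f.1 f.2
    have h2 : ∑ i : Fin n, f.1 i.succ ≤ k := by omega
    simp only
    exact_mod_cast h2
  · intro i; exact ⟨(f.1 i.succ : ℕ), by simp⟩
  · intro f g hfg
    have h1 : ∀ i : Fin n, f.1 i.succ = g.1 i.succ := by
      intro i
      have := congrArg (fun x => (Subtype.val x) i) hfg
      simpa using this
    apply Subtype.ext
    ext i
    refine Fin.cases ?_ h1 i
    have a := hf f.1 f.2
    have b := hf g.1 g.2
    rw [Finset.sum_congr rfl fun i _ => h1 i] at a
    omega
  · rintro ⟨x, hx1, hx2⟩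
    rw [hmem] at hx1
    have hz : ∀ i, ∃ m : ℕ, x i = (m : ℝ) := by
      intro i
      obtain ⟨z, hz⟩ := hx2 i
      have h0 := hx1.1 i
      rw [hz] at h0
      have h1 : 0 ≤ z := by
        have : (0:ℝ) ≤ (z:ℝ) := h0
        exact_mod_cast this
      refine ⟨z.toNat, ?_⟩
      rw [hz]
      have : ((z.toNat : ℤ) : ℝ) = (z : ℝ) := by rw [Int.toNat_of_nonneg h1]
      rw [← this, Int.cast_natCast]
    choose m hm using hz
    have hs : ∑ i, m i ≤ k := by
      have := hx1.2
      simp only [hm] at this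
      exact_mod_cast this
    refine ⟨⟨Finsupp.equivFunOnFinite.symm (Fin.cons (k - ∑ i, m i) m), ?_⟩, ?_⟩
    · rw [Finset.mem_finsuppAntidiag]
      refine ⟨?_, by simp⟩
      rw [Fin.sum_univ_succ]
      simp
      omega
    · apply Subtype.ext
      ext i
      simp [hm]

theorem choose_prod (k : ℕ) : ∀ n : ℕ, (((n + k).choose n : ℕ) : ℂ) =
    ∏ i : Fin n, (1 + (k : ℂ) / (((i : ℕ) : ℂ) + 1)) := by
  intro n
  induction n with
  | zero => simp
  | succ n ih =>
    rw [Fin.prod_univ_castSucc]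
    simp only [Fin.val_castSucc, Fin.val_last]
    rw [← ih]
    have h := Nat.add_one_mul_choose_eq (n + k) n
    have h2 : ((n:ℂ) + k + 1) * ((n + k).choose n : ℕ) = ((n + k + 1).choose (n + 1) : ℕ) * (n + 1) := by
      exact_mod_cast h
    have hn : (n:ℂ) + 1 ≠ 0 := by exact_mod_cast Nat.succ_ne_zero n
    rw [show n + 1 + k = n + k + 1 by ring]
    field_simp
    rw [← h2]; ring

theorem sm_simplex (i : ℕ) (hi : i < n) :
    succMin (stdSimplexSet n - stdSimplexSet n) (stdLattice n) (i + 1) = 1 := by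
  have hi' : i + 1 ≤ n := hi
  have hset : (1:ℝ) ∈ {t : ℝ | 0 < t ∧ ∃ v : Fin (i + 1) → Euc n, LinearIndependent ℝ v ∧
      ∀ j, v j ∈ stdLattice n ∧ v j ∈ t • (stdSimplexSet n - stdSimplexSet n)} := by
    refine ⟨one_pos, fun j => EuclideanSpace.single (Fin.castLE hi' j) 1, ?_, ?_⟩
    · have := (EuclideanSpace.basisFun (Fin n) ℝ).toBasis.linearIndependent.comp
        (Fin.castLE hi') (Fin.castLE_injective hi')
      have e : (fun j => EuclideanSpace.single (Fin.castLE hi' j) (1:ℝ)) =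
          (EuclideanSpace.basisFun (Fin n) ℝ).toBasis ∘ Fin.castLE hi' := by
        ext j; simp
      rw [e]; exact this
    · intro j
      constructor
      · intro k
        by_cases hk : k = Fin.castLE hi' j
        · exact ⟨1, by simp [hk]⟩
        · exact ⟨0, by simp [hk]⟩
      · rw [one_smul]
        exact ⟨_, subset_convexHull _ _ (mem_insert_of_mem _ ⟨Fin.castLE hi' j, rfl⟩), 0,
          subset_convexHull _ _ (mem_insert _ _), by simp⟩
  apply le_antisymm
  · exact csInf_le (sm_bdd _ _ _) hset
  · refine le_csInf ⟨1, hset⟩ ?_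
    · rintro t ⟨ht, v, hv, hv2⟩
      have hne : v 0 ≠ 0 := hv.ne_zero 0
      obtain ⟨hl, hm⟩ := hv2 0
      obtain ⟨j, hj⟩ : ∃ j, v 0 j ≠ 0 := by
        by_contra hcon
        push Not at hcon
        apply hne
        ext j; simpa using hcon j
      obtain ⟨z, hz⟩ := hl j
      have h1 : (1:ℝ) ≤ |v 0 j| := by
        have hj2 : (z:ℝ) ≠ 0 := fun h => hj (hz.trans h)
        have hj3 : z ≠ 0 := by exact_mod_cast hj2
        have hj4 : (1:ℝ) ≤ |(z:ℝ)| := by exact_mod_cast Int.one_le_abs hj3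
        rw [hz]; exact hj4
      obtain ⟨d, ⟨a, ha, b, hb, rfl⟩, hd⟩ := hm
      have bd : ∀ a ∈ stdSimplexSet n, 0 ≤ a j ∧ a j ≤ 1 := by
        intro a ha
        obtain ⟨p1, p2⟩ := (mem_simplex a).1 ha
        exact ⟨p1 j, (Finset.single_le_sum (fun i _ => p1 i) (Finset.mem_univ j)).trans p2⟩
      have e : v 0 j = t * (a j - b j) := by rw [← hd]; simp
      rw [e, abs_mul, abs_of_pos ht] at h1
      have h3 : |a j - b j| ≤ 1 := by
        have := bd a ha
        have := bd b hb
        rw [abs_le]; constructor <;> linarith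
      nlinarith

theorem part2 (γ : Fin n → ℂ)
    (hE : ∀ k : ℕ, 0 < k → (Nat.card ↥(((k : ℝ) • stdSimplexSet n) ∩ stdLattice n) : ℂ) =
        ∏ i, (1 + (k : ℂ) / γ i)) :
    (∑ i, γ i) = ((((n : ℝ) + 1) / 2) *
          ∑ i : Fin n, succMin (stdSimplexSet n - stdSimplexSet n) (stdLattice n)
            ((i : ℕ) + 1) : ℝ) := by
  set N : ℕ → ℕ := fun k => (n + k).choose n with hN
  have h1 : ∀ k : ℕ, 0 < k → (N k : ℂ) = ∏ i, (1 + (k : ℂ) / γ i) := by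
    intro k hk; rw [← hE k hk, card_simplex k hk]
  have h2 : ∀ k : ℕ, 0 < k → (N k : ℂ) = ∏ i : Fin n, (1 + (k : ℂ) / (((i : ℕ) : ℂ) + 1)) :=
    fun k _ => choose_prod k n
  have h2' : ∀ k : ℕ, (N k : ℝ) = ∏ i : Fin n, (1 + (k : ℝ) / (((i : ℕ) : ℝ) + 1)) := by
    intro k
    have := choose_prod k n
    apply Complex.ofReal_injective
    push_cast
    exact this
  set V : ℝ := ∏ i : Fin n, (((i : ℕ) : ℝ) + 1)⁻¹ with hV
  have hV0 : V ≠ 0 := by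
    rw [hV]
    exact Finset.prod_ne_zero_iff.2 fun i _ => by positivity
  have hlim : Tendsto (fun k : ℕ => (N k : ℝ) / (k:ℝ) ^ n) atTop (nhds V) := by
    have hk : Tendsto (fun k : ℕ => ((k : ℝ))⁻¹) atTop (nhds 0) :=
      tendsto_inv_atTop_nhds_zero_nat
    have e2 : Tendsto (fun k : ℕ => ∏ i : Fin n, ((k:ℝ)⁻¹ + (((i : ℕ) : ℝ) + 1)⁻¹)) atTop
        (nhds V) := by
      refine tendsto_finsetProd _ fun i _ => ?_
      simpa using hk.add_const (((i : ℕ) : ℝ) + 1)⁻¹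
    refine e2.congr' ?_
    filter_upwards [eventually_gt_atTop 0] with k h
    have hk0 : (k:ℝ) ≠ 0 := by exact_mod_cast h.ne'
    rw [h2' k]
    have : (k:ℝ) ^ n = ∏ i : Fin n, (k:ℝ) := by simp
    rw [this, ← Finset.prod_div_distrib]
    refine Finset.prod_congr rfl fun i _ => ?_
    rw [div_eq_mul_inv _ (k:ℝ), add_mul, div_eq_mul_inv, one_mul, mul_comm (k:ℝ), mul_assoc,
      mul_inv_cancel₀ hk0, mul_one]
  obtain ⟨s, hs, hs2⟩ := roots_lim γ N V hV0 h1 hlim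
  obtain ⟨s', hs', hs2'⟩ := roots_lim (fun i : Fin n => ((i : ℕ) : ℂ) + 1) N V hV0 h2 hlim
  have e : s = s' := mul_left_cancel₀ hV0 (tendsto_nhds_unique hs2 hs2')
  rw [hs, e]
  congr 1
  have h3 : s' = ∑ i : Fin n, (((i : ℕ) : ℝ) + 1) := by
    apply Complex.ofReal_injective
    rw [← hs']; push_cast; rfl
  rw [h3, Finset.sum_congr rfl fun (i : Fin n) _ => sm_simplex (i : ℕ) i.2]
  simp only [Finset.sum_const, Finset.card_univ, Fintype.card_fin, nsmul_eq_mul, mul_one]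
  rw [← Finset.sum_range (fun i => (i:ℝ) + 1)]
  clear * -
  induction n with
  | zero => simp
  | succ n ih => rw [Finset.sum_range_succ, ih]; push_cast; ring

open scoped ComplexOrder in
/-- **Corollary i) (roots of the Ehrhart polynomial).** If `-γ_1,…,-γ_n` are the roots
of the Ehrhart polynomial of a lattice polytope `P`, i.e.
`#(kP ∩ ℤ^n) = ∏ (1 + k/γ_i)` for all positive integers `k`, then
`∑ γ_i ≤ ((n+1)/2)·∑ λ_i(DP,ℤ^n)`; the standard simplex `S_n` attains equality. -/
theorem statement15 {n : ℕ} (hn : 0 < n) (P : Set (Euc n))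
    (hP : IsLatticePolytope P) (hint : (interior P).Nonempty)
    (γ : Fin n → ℂ)
    (hE : ∀ k : ℕ, 0 < k →
      (Nat.card ↥(((k : ℝ) • P) ∩ stdLattice n) : ℂ) =
        ∏ i, (1 + (k : ℂ) / γ i)) :
    (∑ i, γ i) ≤
        ((((n : ℝ) + 1) / 2) *
          ∑ i : Fin n, succMin (P - P) (stdLattice n) ((i : ℕ) + 1) : ℝ) ∧
    ∀ γ' : Fin n → ℂ,
      (∀ k : ℕ, 0 < k →
        (Nat.card ↥(((k : ℝ) • stdSimplexSet n) ∩ stdLattice n) : ℂ) =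
          ∏ i, (1 + (k : ℂ) / γ' i)) →
      (∑ i, γ' i) =
        ((((n : ℝ) + 1) / 2) *
          ∑ i : Fin n, succMin (stdSimplexSet n - stdSimplexSet n) (stdLattice n)
            ((i : ℕ) + 1) : ℝ) := by
  obtain ⟨V, _, hPV⟩ := hP
  have hc : Convex ℝ P := by rw [hPV]; exact convex_convexHull ℝ _
  have hk : IsCompact P := by rw [hPV]; exact V.finite_toSet.isCompact_convexHull ℝ
  refine ⟨?_, fun γ' h => part2 γ' h⟩
  obtain ⟨s, hs, hle⟩ := part1 hn P hc hk hint γ hE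
  rw [hs]
  exact Complex.real_le_real.2 hle

end Paper
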